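/- Let 1 ≤ r ≤ s and 1 ≤ r' ≤ s', and let f, g : Matrix (Fin r) (Fin s) ℂ → Matrix (Fin r') (Fin s') ℂ be holomorphic polynomial maps that map Ω^I_{r,s} into Ω^I_{r',s'}, whose restrictions Ω^I_{r,s} → Ω^I_{r',s'} are proper, and which satisfy f(0) = g(0) = 0. Then f and g are equivalent if and only if they are isotropically equivalent at 0; that is, there exist automorphisms τ of Ω^I_{r,s} and σ of Ω^I_{r',s'} with f = σ ∘ g ∘ τ on Ω^I_{r,s} if and only if there exist such automorphisms additionally satisfying τ(0) = 0 and σ(0) = 0. -/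

import Mathlib

open Matrix
open scoped ComplexOrder

noncomputable section

attribute [local instance] Matrix.normedAddCommGroup Matrix.normedSpace

/-- The type I classical bounded symmetric domain `Ω^I_{r,s}`. -/
def OmegaI (r s : ℕ) : Set (Matrix (Fin r) (Fin s) ℂ) :=
  {Z | (1 - Z * Zᴴ).PosDef}

/-- `f` is a holomorphic polynomial map between complex matrix spaces: each component of the
output is a polynomial with complex coefficients in the components of the input. -/
def IsPolyMapI {r s r' s' : ℕ}
    (f : Matrix (Fin r) (Fin s) ℂ → Matrix (Fin r') (Fin s') ℂ) : Prop :=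
  ∀ i j, ∃ p : MvPolynomial (Fin r × Fin s) ℂ,
    ∀ Z, f Z i j = MvPolynomial.eval (fun q => Z q.1 q.2) p

/-- The restriction of `f` to `Ω₁ → Ω₂` is proper: preimages of compact subsets of the target
domain are compact. -/
def IsProperOn {E F : Type*} [TopologicalSpace E] [TopologicalSpace F]
    (f : E → F) (Ω₁ : Set E) (Ω₂ : Set F) : Prop :=
  ∀ K : Set F, K ⊆ Ω₂ → IsCompact K → IsCompact (Ω₁ ∩ f ⁻¹' K)

/-- `τ` is an automorphism of the domain `Ω`: a holomorphic bijection of `Ω` onto itself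
with holomorphic inverse. -/
def IsAutomorphismOf {E : Type*} [NormedAddCommGroup E] [NormedSpace ℂ E]
    (Ω : Set E) (τ : E → E) : Prop :=
  Set.MapsTo τ Ω Ω ∧ DifferentiableOn ℂ τ Ω ∧
    ∃ τinv : E → E, Set.MapsTo τinv Ω Ω ∧ DifferentiableOn ℂ τinv Ω ∧
      (∀ z ∈ Ω, τinv (τ z) = z) ∧ (∀ z ∈ Ω, τ (τinv z) = z)

namespace TypeI

/-! ### The domain in terms of squared Euclidean norms -/

/-- The squared Euclidean norm of a complex vector. -/
def nsq {n : ℕ} (x : Fin n → ℂ) : ℝ := ∑ i, ‖x i‖ ^ 2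

lemma nsq_nonneg {n : ℕ} (x : Fin n → ℂ) : 0 ≤ nsq x :=
  Finset.sum_nonneg fun _ _ => by positivity

lemma nsq_pos {n : ℕ} {x : Fin n → ℂ} (hx : x ≠ 0) : 0 < nsq x := by
  obtain ⟨i, hi⟩ := Function.ne_iff.1 hx
  exact Finset.sum_pos' (fun _ _ => by positivity)
    ⟨i, Finset.mem_univ _, by have : 0 < ‖x i‖ := norm_pos_iff.2 hi
                              positivity⟩

lemma nsq_zero {n : ℕ} : nsq (0 : Fin n → ℂ) = 0 := by simp [nsq]

lemma star_dotProduct_self {n : ℕ} (x : Fin n → ℂ) : star x ⬝ᵥ x = (nsq x : ℂ) := by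
  simp [nsq, dotProduct, Complex.conj_mul']

lemma norm_star_dotProduct_sq_le {n : ℕ} (x y : Fin n → ℂ) :
    ‖star x ⬝ᵥ y‖ ^ 2 ≤ nsq x * nsq y := by
  have h1 : ‖star x ⬝ᵥ y‖ ≤ ∑ i, ‖x i‖ * ‖y i‖ := by
    refine (norm_sum_le _ _).trans (le_of_eq ?_)
    simp
  calc ‖star x ⬝ᵥ y‖ ^ 2 ≤ (∑ i, ‖x i‖ * ‖y i‖) ^ 2 := by gcongr
    _ ≤ _ := Finset.sum_mul_sq_le_sq_mul_sq _ _ _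

lemma star_dotProduct_mul_conjTranspose {m n : ℕ} (Z : Matrix (Fin m) (Fin n) ℂ)
    (x : Fin m → ℂ) : star x ⬝ᵥ (Z * Zᴴ) *ᵥ x = (nsq (Zᴴ *ᵥ x) : ℂ) := by
  rw [← star_dotProduct_self, star_mulVec, conjTranspose_conjTranspose, ← mulVec_mulVec,
    dotProduct_mulVec]

lemma posDef_sub_iff {m n k : ℕ} (N : Matrix (Fin m) (Fin n) ℂ) (M : Matrix (Fin m) (Fin k) ℂ) :
    (N * Nᴴ - M * Mᴴ).PosDef ↔ ∀ x ≠ 0, nsq (Mᴴ *ᵥ x) < nsq (Nᴴ *ᵥ x) := by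
  rw [posDef_iff_dotProduct_mulVec]
  have hH : (N * Nᴴ - M * Mᴴ).IsHermitian :=
    (isHermitian_mul_conjTranspose_self N).sub (isHermitian_mul_conjTranspose_self M)
  simp only [hH, true_and, sub_mulVec, dotProduct_sub, star_dotProduct_mul_conjTranspose]
  refine forall_congr' fun x => imp_congr_right fun _ => ?_
  rw [sub_pos]
  norm_cast

lemma mem_omega_iff {r s : ℕ} {Z : Matrix (Fin r) (Fin s) ℂ} :
    Z ∈ OmegaI r s ↔ ∀ x ≠ 0, nsq (Zᴴ *ᵥ x) < nsq x := by
  have := posDef_sub_iff (1 : Matrix (Fin r) (Fin r) ℂ) Z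
  simpa [OmegaI] using this

lemma nsq_conj_mulVec_le {r s : ℕ} {Z : Matrix (Fin r) (Fin s) ℂ} (hZ : Z ∈ OmegaI r s)
    (x : Fin r → ℂ) : nsq (Zᴴ *ᵥ x) ≤ nsq x := by
  by_cases hx : x = 0
  · simp [hx, nsq_zero]
  · exact (mem_omega_iff.1 hZ x hx).le

lemma nsq_mulVec_lt {r s : ℕ} {Z : Matrix (Fin r) (Fin s) ℂ} (hZ : Z ∈ OmegaI r s)
    {y : Fin s → ℂ} (hy : y ≠ 0) : nsq (Z *ᵥ y) < nsq y := by
  by_cases h0 : Z *ᵥ y = 0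
  · rw [h0, nsq_zero]; exact nsq_pos hy
  have h1 := mem_omega_iff.1 hZ _ h0
  have h2 := norm_star_dotProduct_sq_le y (Zᴴ *ᵥ (Z *ᵥ y))
  have h3 : star y ⬝ᵥ Zᴴ *ᵥ (Z *ᵥ y) = (nsq (Z *ᵥ y) : ℂ) := by
    rw [← star_dotProduct_self, star_mulVec, dotProduct_mulVec]
  rw [h3, Complex.norm_real, Real.norm_eq_abs, sq_abs] at h2
  have h4 := nsq_pos h0
  have h5 := nsq_pos hy
  by_contra! h
  nlinarith [mul_lt_mul_of_pos_left h1 h5, mul_le_mul_of_nonneg_right h h4.le]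

lemma nsq_single {n : ℕ} (i : Fin n) : nsq (Pi.single i (1 : ℂ)) = 1 := by
  rw [nsq, Finset.sum_eq_single i] <;> simp +contextual

lemma row_lt {r s : ℕ} {Z : Matrix (Fin r) (Fin s) ℂ} (hZ : Z ∈ OmegaI r s) (i : Fin r) :
    ∑ j, ‖Z i j‖ ^ 2 < 1 := by
  have := mem_omega_iff.1 hZ (Pi.single i 1) (by simp)
  rw [nsq_single] at this
  simpa [nsq] using this

lemma col_lt {r s : ℕ} {Z : Matrix (Fin r) (Fin s) ℂ} (hZ : Z ∈ OmegaI r s) (j : Fin s) :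
    ∑ i, ‖Z i j‖ ^ 2 < 1 := by
  have := nsq_mulVec_lt hZ (y := Pi.single j 1) (by simp)
  rw [nsq_single] at this
  simpa [nsq] using this

lemma entry_lt {r s : ℕ} {Z : Matrix (Fin r) (Fin s) ℂ} (hZ : Z ∈ OmegaI r s) (i : Fin r)
    (j : Fin s) : ‖Z i j‖ < 1 := by
  have h1 : ‖Z i j‖ ^ 2 ≤ ∑ j, ‖Z i j‖ ^ 2 :=
    Finset.single_le_sum (f := fun j => ‖Z i j‖ ^ 2) (fun _ _ => by positivity)
      (Finset.mem_univ j)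
  have := row_lt hZ i
  by_contra! h
  nlinarith

lemma nsq_smul {n : ℕ} (c : ℂ) (x : Fin n → ℂ) : nsq (c • x) = ‖c‖ ^ 2 * nsq x := by
  simp [nsq, Finset.mul_sum, mul_pow]

lemma smul_mem_omega {r s : ℕ} {Z : Matrix (Fin r) (Fin s) ℂ} (hZ : Z ∈ OmegaI r s) {c : ℂ}
    (hc : ‖c‖ ≤ 1) : c • Z ∈ OmegaI r s := by
  rw [mem_omega_iff]
  intro x hx
  rw [conjTranspose_smul, smul_mulVec, nsq_smul]
  have h1 := mem_omega_iff.1 hZ x hx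
  have h2 := nsq_nonneg (Zᴴ *ᵥ x)
  have h3 : ‖star c‖ ^ 2 ≤ 1 := by
    rw [norm_star]; exact pow_le_one₀ (norm_nonneg _) hc
  nlinarith

lemma neg_mem_omega {r s : ℕ} {Z : Matrix (Fin r) (Fin s) ℂ} (hZ : Z ∈ OmegaI r s) :
    -Z ∈ OmegaI r s := by
  simpa using smul_mem_omega hZ (c := -1) (by simp)

lemma zero_mem_omega {r s : ℕ} : (0 : Matrix (Fin r) (Fin s) ℂ) ∈ OmegaI r s := by
  rw [mem_omega_iff]
  intro x hx
  simpa [nsq_zero] using nsq_pos hx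

lemma nsq_conj_mulVec_le_frob {r s : ℕ} (Z : Matrix (Fin r) (Fin s) ℂ) (x : Fin r → ℂ) :
    nsq (Zᴴ *ᵥ x) ≤ (∑ j, ∑ i, ‖Z i j‖ ^ 2) * nsq x := by
  rw [nsq, Finset.sum_mul]
  refine Finset.sum_le_sum fun j _ => ?_
  have := norm_star_dotProduct_sq_le (fun i => Z i j) x
  exact this

lemma omega_mem_nhds_zero {r s : ℕ} :
    OmegaI r s ∈ nhds (0 : Matrix (Fin r) (Fin s) ℂ) := by
  have hc : Continuous fun Z : Matrix (Fin r) (Fin s) ℂ => ∑ j, ∑ i, ‖Z i j‖ ^ 2 := by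
    fun_prop
  have := hc.tendsto 0
  simp only [Matrix.zero_apply, norm_zero, ne_eq, OfNat.ofNat_ne_zero, not_false_eq_true, zero_pow,
    Finset.sum_const_zero] at this
  filter_upwards [this.eventually (gt_mem_nhds one_pos)] with Z hZ
  rw [mem_omega_iff]
  intro x hx
  have h1 := nsq_conj_mulVec_le_frob Z x
  nlinarith [nsq_pos hx]

/-- A product `1 - Z * Uᴴ` with `Z` in the domain and `U` a contraction is invertible. -/
lemma det_one_sub_ne_zero {r s : ℕ} {Z U : Matrix (Fin r) (Fin s) ℂ} (hZ : Z ∈ OmegaI r s)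
    (hU : ∀ x, nsq (Uᴴ *ᵥ x) ≤ nsq x) : (1 - Z * Uᴴ).det ≠ 0 := by
  intro h
  obtain ⟨x, hx, hx0⟩ := exists_mulVec_eq_zero_iff.2 h
  rw [sub_mulVec, one_mulVec, sub_eq_zero, ← mulVec_mulVec] at hx0
  have hy : Uᴴ *ᵥ x ≠ 0 := by
    intro h'
    rw [h', mulVec_zero] at hx0
    exact hx hx0
  have h1 := nsq_mulVec_lt hZ hy
  rw [← hx0] at h1
  exact absurd (hU x) (not_le.2 h1)

lemma nsq_unitary {n : ℕ} {U : Matrix (Fin n) (Fin n) ℂ} (hU : U * Uᴴ = 1) (x : Fin n → ℂ) :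
    nsq (Uᴴ *ᵥ x) = nsq x := by
  have := star_dotProduct_mul_conjTranspose U x
  rw [hU, one_mulVec, star_dotProduct_self] at this
  exact_mod_cast this.symm

lemma unitary_mul_mem_omega {r s : ℕ} {Z : Matrix (Fin r) (Fin s) ℂ} (hZ : Z ∈ OmegaI r s)
    {U : Matrix (Fin r) (Fin r) ℂ} {V : Matrix (Fin s) (Fin s) ℂ} (hU : U * Uᴴ = 1)
    (hV : V * Vᴴ = 1) : U * Z * V ∈ OmegaI r s := by
  rw [mem_omega_iff]
  intro x hx
  rw [conjTranspose_mul, conjTranspose_mul, ← mulVec_mulVec, ← mulVec_mulVec,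
    nsq_unitary hV, ← nsq_unitary hU x]
  refine mem_omega_iff.1 hZ _ fun h => ?_
  have := nsq_unitary hU x
  rw [h, nsq_zero] at this
  exact (nsq_pos hx).ne this

end TypeI

namespace TypeI

/-! ### Matrices with entries in an algebra of functions -/

/-- All entries of the matrix-valued function `M` belong to the algebra of functions `S`. -/
def EntryMem {X : Type*} {m n : ℕ} (S : Subalgebra ℂ (X → ℂ))
    (M : X → Matrix (Fin m) (Fin n) ℂ) : Prop :=
  ∀ i j, (fun x => M x i j) ∈ S

namespace EntryMem

variable {X : Type*} {S : Subalgebra ℂ (X → ℂ)} {m n k : ℕ}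

lemma const (M : Matrix (Fin m) (Fin n) ℂ) : EntryMem S fun _ => M :=
  fun i j => S.algebraMap_mem (M i j)

lemma add {M N : X → Matrix (Fin m) (Fin n) ℂ} (hM : EntryMem S M) (hN : EntryMem S N) :
    EntryMem S fun x => M x + N x :=
  fun i j => S.add_mem (hM i j) (hN i j)

lemma sub {M N : X → Matrix (Fin m) (Fin n) ℂ} (hM : EntryMem S M) (hN : EntryMem S N) :
    EntryMem S fun x => M x - N x :=
  fun i j => S.sub_mem (hM i j) (hN i j)

lemma neg {M : X → Matrix (Fin m) (Fin n) ℂ} (hM : EntryMem S M) :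
    EntryMem S fun x => - M x :=
  fun i j => S.neg_mem (hM i j)

lemma smul {h : X → ℂ} (hh : h ∈ S) {M : X → Matrix (Fin m) (Fin n) ℂ} (hM : EntryMem S M) :
    EntryMem S fun x => h x • M x :=
  fun i j => S.mul_mem hh (hM i j)

lemma mul {M : X → Matrix (Fin m) (Fin n) ℂ} {N : X → Matrix (Fin n) (Fin k) ℂ}
    (hM : EntryMem S M) (hN : EntryMem S N) : EntryMem S fun x => M x * N x := by
  intro i j
  have : (fun x => (M x * N x) i j) = ∑ l, (fun x => M x i l) * fun x => N x l j := by
    ext x; simp [mul_apply]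
  rw [this]
  exact S.sum_mem fun l _ => S.mul_mem (hM i l) (hN l j)

lemma det {M : X → Matrix (Fin n) (Fin n) ℂ} (hM : EntryMem S M) :
    (fun x => (M x).det) ∈ S := by
  have : (fun x => (M x).det) =
      ∑ σ : Equiv.Perm (Fin n), ((Equiv.Perm.sign σ : ℤ) : ℂ) • ∏ i, fun x => M x (σ i) i := by
    ext x
    simp [det_apply', Finset.prod_apply]
  rw [this]
  exact S.sum_mem fun σ _ => S.smul_mem (S.prod_mem fun i _ => hM _ _) _

lemma adjugate {M : X → Matrix (Fin n) (Fin n) ℂ} (hM : EntryMem S M) :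
    EntryMem S fun x => (M x).adjugate := by
  intro i j
  simp only [adjugate_apply]
  refine det fun a b => ?_
  by_cases h : a = j
  · subst h
    simp only [updateRow_self]
    exact S.algebraMap_mem _
  · simp only [updateRow_ne h]
    exact hM a b

lemma inv {M : X → Matrix (Fin n) (Fin n) ℂ} (hM : EntryMem S M)
    (hd : (fun x => (M x).det⁻¹) ∈ S) : EntryMem S fun x => (M x)⁻¹ := by
  simp only [inv_def, Ring.inverse_eq_inv']
  exact smul hd hM.adjugate

lemma mvPolynomial {σ : Type*} {c : X → σ → ℂ} (hc : ∀ q, (fun x => c x q) ∈ S)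
    (p : MvPolynomial σ ℂ) : (fun x => MvPolynomial.eval (c x) p) ∈ S := by
  induction p using MvPolynomial.induction_on with
  | C a => simp only [MvPolynomial.eval_C]; exact S.algebraMap_mem a
  | add p q hp hq => simp only [map_add]; exact S.add_mem hp hq
  | mul_X p q hp =>
    simp only [map_mul, MvPolynomial.eval_X]
    exact S.mul_mem hp (hc q)

lemma comp_poly {r s : ℕ} {f : Matrix (Fin r) (Fin s) ℂ → Matrix (Fin m) (Fin n) ℂ}
    (hf : IsPolyMapI f) {M : X → Matrix (Fin r) (Fin s) ℂ} (hM : EntryMem S M) :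
    EntryMem S fun x => f (M x) := by
  intro i j
  obtain ⟨p, hp⟩ := hf i j
  have h : (fun x => f (M x) i j) =
      fun x => MvPolynomial.eval (fun q : Fin r × Fin s => M x q.1 q.2) p :=
    funext fun x => hp (M x)
  rw [h]
  exact mvPolynomial (σ := Fin r × Fin s) (c := fun x q => M x q.1 q.2) (fun q => hM q.1 q.2) p

lemma isPolyMap {r s : ℕ} {f : Matrix (Fin r) (Fin s) ℂ → Matrix (Fin m) (Fin n) ℂ}
    (hf : ∀ S : Subalgebra ℂ (Matrix (Fin r) (Fin s) ℂ → ℂ),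
      EntryMem S (fun Z => Z) → EntryMem S f) : IsPolyMapI f := by
  intro i j
  have h := hf (MvPolynomial.aeval (fun (q : Fin r × Fin s) (Z : Matrix (Fin r) (Fin s) ℂ) =>
    Z q.1 q.2)).range (fun i j => ⟨MvPolynomial.X (i, j), by simp⟩) i j
  obtain ⟨p, hp⟩ := h
  refine ⟨p, fun Z => ?_⟩
  refine (congrFun hp Z).symm.trans ?_
  clear hp
  induction p using MvPolynomial.induction_on with
  | C a => simp
  | add p q hp hq => simp_all
  | mul_X p q hp => simp_all

end EntryMem

/-- Functions differentiable on a set. -/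
def diffAlg {E : Type*} [NormedAddCommGroup E] [NormedSpace ℂ E] (U : Set E) :
    Subalgebra ℂ (E → ℂ) where
  carrier := {h | DifferentiableOn ℂ h U}
  mul_mem' ha hb := DifferentiableOn.mul ha hb
  add_mem' ha hb := DifferentiableOn.add ha hb
  algebraMap_mem' c := differentiableOn_const c

lemma mem_diffAlg {E : Type*} [NormedAddCommGroup E] [NormedSpace ℂ E] {U : Set E} {h : E → ℂ} :
    h ∈ diffAlg U ↔ DifferentiableOn ℂ h U := Iff.rfl

lemma differentiableOn_iff_entryMem {E : Type*} [NormedAddCommGroup E] [NormedSpace ℂ E]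
    {U : Set E} {m n : ℕ} {M : E → Matrix (Fin m) (Fin n) ℂ} :
    DifferentiableOn ℂ M U ↔ EntryMem (diffAlg U) M := by
  have h1 := differentiableOn_pi (𝕜 := ℂ) (s := U) (Φ := fun x i => (M x : Fin m → Fin n → ℂ) i)
  refine h1.trans (forall_congr' fun i => ?_)
  exact differentiableOn_pi (𝕜 := ℂ) (s := U) (Φ := fun x j => (M x : Fin m → Fin n → ℂ) i j)

lemma entryMem_id {r s : ℕ} (U : Set (Matrix (Fin r) (Fin s) ℂ)) :
    EntryMem (diffAlg U) fun Z => Z :=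
  differentiableOn_iff_entryMem.1 differentiableOn_id

/-- Continuous functions at a point. -/
def contAlg {X : Type*} [TopologicalSpace X] (a : X) : Subalgebra ℂ (X → ℂ) where
  carrier := {h | ContinuousAt h a}
  mul_mem' ha hb := ContinuousAt.mul ha hb
  add_mem' ha hb := ContinuousAt.add ha hb
  algebraMap_mem' _ := continuousAt_const

/-- Polynomial functions of one variable. -/
def polyAlg : Subalgebra ℂ (ℂ → ℂ) where
  carrier := {h | ∃ p : Polynomial ℂ, ∀ x, h x = p.eval x}
  mul_mem' := by
    rintro _ _ ⟨p, hp⟩ ⟨q, hq⟩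
    exact ⟨p * q, fun x => by simp [hp, hq]⟩
  add_mem' := by
    rintro _ _ ⟨p, hp⟩ ⟨q, hq⟩
    exact ⟨p + q, fun x => by simp [hp, hq]⟩
  algebraMap_mem' c := ⟨Polynomial.C c, fun x => by simp⟩

/-- Polynomial functions of several variables. -/
def mvAlg (σ : Type*) : Subalgebra ℂ ((σ → ℂ) → ℂ) where
  carrier := {h | ∃ p : MvPolynomial σ ℂ, ∀ x, h x = MvPolynomial.eval x p}
  mul_mem' := by
    rintro _ _ ⟨p, hp⟩ ⟨q, hq⟩
    exact ⟨p * q, fun x => by simp [hp, hq]⟩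
  add_mem' := by
    rintro _ _ ⟨p, hp⟩ ⟨q, hq⟩
    exact ⟨p + q, fun x => by simp [hp, hq]⟩
  algebraMap_mem' c := ⟨MvPolynomial.C c, fun x => by simp⟩

/-! ### Rectangular diagonal matrices -/

/-- The `r × s` matrix with diagonal entries `x 0, x 1, …`. -/
def Dg (r s : ℕ) (x : ℕ → ℂ) : Matrix (Fin r) (Fin s) ℂ :=
  of fun i j => if (i : ℕ) = j then x i else 0

lemma Dg_apply {r s : ℕ} (x : ℕ → ℂ) (i : Fin r) (j : Fin s) :
    Dg r s x i j = if (i : ℕ) = j then x i else 0 := rfl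

lemma Dg_eq_diagonal (n : ℕ) (x : ℕ → ℂ) : Dg n n x = diagonal fun i : Fin n => x i := by
  ext i j
  simp [Dg_apply, diagonal_apply, Fin.ext_iff]

lemma Dg_mul {a b c : ℕ} {x y : ℕ → ℂ} (h : ∀ k, k < a → k < c → b ≤ k → x k * y k = 0) :
    Dg a b x * Dg b c y = Dg a c (x * y) := by
  ext i k
  rw [mul_apply, Dg_apply]
  by_cases hb : (i : ℕ) < b
  · rw [Finset.sum_eq_single (⟨i, hb⟩ : Fin b)]
    · simp [Dg_apply]
    · intro j _ hj
      have : (i : ℕ) ≠ j := fun h' => hj (Fin.ext h'.symm)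
      simp [Dg_apply, this]
    · simp
  · rw [Finset.sum_eq_zero]
    · split_ifs with hik
      · exact (h i i.2 (hik ▸ k.2) (not_lt.1 hb)).symm
      · rfl
    · intro j _
      have : (i : ℕ) ≠ j := fun h' => hb (h' ▸ j.2)
      simp [Dg_apply, this]

lemma Dg_conjTranspose (r s : ℕ) (x : ℕ → ℂ) : (Dg r s x)ᴴ = Dg s r (star x) := by
  ext i j
  rw [conjTranspose_apply, Dg_apply, Dg_apply]
  split_ifs with h1 h2 h2
  · simp [h1]
  · exact absurd h1.symm h2
  · exact absurd h2.symm h1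
  · simp

lemma Dg_congr {r s : ℕ} {x y : ℕ → ℂ} (h : ∀ k, k < r → k < s → x k = y k) :
    Dg r s x = Dg r s y := by
  ext i j
  rw [Dg_apply, Dg_apply]
  split_ifs with hij
  · exact h i i.2 (hij ▸ j.2)
  · rfl

lemma Dg_one (n : ℕ) : Dg n n 1 = 1 := by
  rw [Dg_eq_diagonal]; exact diagonal_one

lemma Dg_zero (r s : ℕ) : Dg r s 0 = 0 := by
  ext i j; simp [Dg_apply]

lemma Dg_add (r s : ℕ) (x y : ℕ → ℂ) : Dg r s x + Dg r s y = Dg r s (x + y) := by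
  ext i j; simp only [Dg_apply, Matrix.add_apply]; split_ifs <;> simp

lemma Dg_sub (r s : ℕ) (x y : ℕ → ℂ) : Dg r s x - Dg r s y = Dg r s (x - y) := by
  ext i j; simp only [Dg_apply, Matrix.sub_apply]; split_ifs <;> simp

lemma Dg_smul (r s : ℕ) (c : ℂ) (x : ℕ → ℂ) : c • Dg r s x = Dg r s (c • x) := by
  ext i j; simp only [Dg_apply, Matrix.smul_apply]; split_ifs <;> simp

lemma Dg_neg (r s : ℕ) (x : ℕ → ℂ) : - Dg r s x = Dg r s (-x) := by
  ext i j; simp only [Dg_apply, Matrix.neg_apply]; split_ifs <;> simp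

lemma det_Dg (n : ℕ) (x : ℕ → ℂ) : (Dg n n x).det = ∏ i : Fin n, x i := by
  rw [Dg_eq_diagonal, det_diagonal]

lemma Dg_inv {n : ℕ} {x : ℕ → ℂ} (hx : ∀ k, k < n → x k ≠ 0) :
    (Dg n n x)⁻¹ = Dg n n x⁻¹ := by
  refine inv_eq_right_inv ?_
  rw [Dg_mul (by intros; omega), ← Dg_one]
  exact Dg_congr fun k hk _ => mul_inv_cancel₀ (hx k hk)

lemma EntryMem.diag {X : Type*} {S : Subalgebra ℂ (X → ℂ)} {r s : ℕ} {z : X → ℕ → ℂ}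
    (hz : ∀ k, k < r → k < s → (fun x => z x k) ∈ S) : EntryMem S fun x => Dg r s (z x) := by
  intro i j
  simp only [Dg_apply]
  split_ifs with h
  · exact hz i i.2 (h ▸ j.2)
  · exact S.zero_mem

lemma Dg_mem_omega {r s : ℕ} {z : ℕ → ℂ} (hz : ∀ k, k < r → k < s → ‖z k‖ < 1) :
    Dg r s z ∈ OmegaI r s := by
  let y : ℕ → ℂ := fun k => if k < s then z k else 0
  have h : Dg r s z = Dg r s y := Dg_congr fun k _ hs => by simp [y, hs]
  have hy : ∀ k, k < r → ‖y k‖ < 1 := by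
    intro k hk
    by_cases hs : k < s
    · simpa [y, hs] using hz k hk hs
    · simp [y, hs]
  rw [h, OmegaI, Set.mem_ofPred_eq, Dg_conjTranspose, Dg_mul, ← Dg_one, Dg_sub, Dg_eq_diagonal,
    posDef_diagonal_iff]
  · intro i
    have := hy i i.2
    have h2 : (1 - y * star y) (i : ℕ) = ((1 - ‖y i‖ ^ 2 : ℝ) : ℂ) := by
      simp [Complex.mul_conj']
    rw [h2]
    have : 0 < 1 - ‖y i‖ ^ 2 := by nlinarith [norm_nonneg (y i)]
    exact_mod_cast this
  · intro k _ _ hk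
    simp [y, not_lt.2 hk]

end TypeI

namespace TypeI

/-! ### One-parameter groups of Möbius transformations -/

/-- The diagonal matrix with entries `cosh (t * A k)`. -/
def CC (n : ℕ) (A : ℕ → ℝ) (t : ℂ) : Matrix (Fin n) (Fin n) ℂ :=
  Dg n n fun k => Complex.cosh (t * A k)

/-- The rectangular diagonal matrix with entries `sinh (t * A k)`. -/
def SS (m n : ℕ) (A : ℕ → ℝ) (t : ℂ) : Matrix (Fin m) (Fin n) ℂ :=
  Dg m n fun k => Complex.sinh (t * A k)

variable {r s : ℕ} {A : ℕ → ℝ}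

lemma CC_add {m n : ℕ} (hA : ∀ k, n ≤ k → A k = 0) (t u : ℂ) :
    CC m A (t + u) = CC m A t * CC m A u + SS m n A t * SS n m A u := by
  rw [CC, CC, CC, SS, SS, Dg_mul (by intros; omega),
    Dg_mul (fun k _ _ hk => by simp [hA k hk]), Dg_add]
  exact Dg_congr fun k _ _ => by simp [add_mul, Complex.cosh_add]

lemma SS_add {m n : ℕ} (t u : ℂ) :
    SS m n A (t + u) = SS m n A t * CC n A u + CC m A t * SS m n A u := by
  rw [CC, CC, SS, SS, SS, Dg_mul (by intros; omega), Dg_mul (by intros; omega), Dg_add]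
  exact Dg_congr fun k _ _ => by simp [add_mul, Complex.sinh_add]

lemma CC_zero (m : ℕ) : CC m A 0 = 1 := by
  rw [CC, ← Dg_one]; exact Dg_congr fun k _ _ => by simp

lemma SS_zero (m n : ℕ) : SS m n A 0 = 0 := by
  rw [SS, ← Dg_zero]; exact Dg_congr fun k _ _ => by simp

lemma CC_neg (m : ℕ) (t : ℂ) : CC m A (-t) = CC m A t :=
  Dg_congr fun k _ _ => by simp

lemma SS_neg (m n : ℕ) (t : ℂ) : SS m n A (-t) = - SS m n A t := by
  rw [SS, SS, Dg_neg]; exact Dg_congr fun k _ _ => by simp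

lemma CC_sq_sub {m n : ℕ} (hA : ∀ k, n ≤ k → A k = 0) (t : ℂ) :
    CC m A t * CC m A t - SS m n A t * SS n m A t = 1 := by
  have := CC_add (m := m) hA t (-t)
  rw [add_neg_cancel, CC_zero, CC_neg, SS_neg, Matrix.mul_neg, ← sub_eq_add_neg] at this
  exact this.symm

lemma CC_mul_SS (m n : ℕ) (t : ℂ) : CC m A t * SS m n A t = SS m n A t * CC n A t := by
  have := SS_add (m := m) (n := n) (A := A) t (-t)
  rw [add_neg_cancel, SS_zero, CC_neg, SS_neg, Matrix.mul_neg, ← sub_eq_add_neg] at this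
  exact (sub_eq_zero.1 this.symm).symm

lemma CC_conjTranspose (m : ℕ) (t : ℝ) : (CC m A t)ᴴ = CC m A t := by
  rw [CC, Dg_conjTranspose]
  refine Dg_congr fun k _ _ => ?_
  simp [← Complex.cosh_conj]

lemma SS_conjTranspose (m n : ℕ) (t : ℝ) : (SS m n A t)ᴴ = SS n m A t := by
  rw [SS, Dg_conjTranspose]
  refine Dg_congr fun k _ _ => ?_
  simp [← Complex.sinh_conj]

/-- The denominator of the Möbius transformation. -/
def mobN (r s : ℕ) (A : ℕ → ℝ) (t : ℂ) (Z : Matrix (Fin r) (Fin s) ℂ) :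
    Matrix (Fin r) (Fin r) ℂ :=
  CC r A t + Z * SS s r A t

/-- The numerator of the Möbius transformation. -/
def mobM (r s : ℕ) (A : ℕ → ℝ) (t : ℂ) (Z : Matrix (Fin r) (Fin s) ℂ) :
    Matrix (Fin r) (Fin s) ℂ :=
  SS r s A t + Z * CC s A t

/-- The Möbius transformation with parameter `t` along the diagonal direction `A`. -/
def mob (r s : ℕ) (A : ℕ → ℝ) (t : ℂ) (Z : Matrix (Fin r) (Fin s) ℂ) :
    Matrix (Fin r) (Fin s) ℂ :=
  (mobN r s A t Z)⁻¹ * mobM r s A t Z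

lemma mobN_add (hs : ∀ k, s ≤ k → A k = 0) (t u : ℂ) (Z : Matrix (Fin r) (Fin s) ℂ) :
    mobN r s A (t + u) Z = mobN r s A t Z * CC r A u + mobM r s A t Z * SS s r A u := by
  rw [mobN, mobN, mobM, CC_add hs, SS_add]
  simp only [Matrix.add_mul, Matrix.mul_add, Matrix.mul_assoc]
  abel

lemma mobM_add (hr : ∀ k, r ≤ k → A k = 0) (t u : ℂ) (Z : Matrix (Fin r) (Fin s) ℂ) :
    mobM r s A (t + u) Z = mobN r s A t Z * SS r s A u + mobM r s A t Z * CC s A u := by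
  rw [mobM, mobM, mobN, CC_add hr, SS_add]
  simp only [Matrix.add_mul, Matrix.mul_add, Matrix.mul_assoc]
  abel

lemma mobN_sub_mobM (hr : ∀ k, r ≤ k → A k = 0) (hs : ∀ k, s ≤ k → A k = 0) (t : ℝ)
    (Z : Matrix (Fin r) (Fin s) ℂ) :
    mobN r s A t Z * (mobN r s A t Z)ᴴ - mobM r s A t Z * (mobM r s A t Z)ᴴ = 1 - Z * Zᴴ := by
  simp only [mobN, mobM, conjTranspose_add, conjTranspose_mul, CC_conjTranspose,
    SS_conjTranspose]
  have h1 := CC_sq_sub (m := r) hs (t : ℂ)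
  have h2 := CC_sq_sub (m := s) hr (t : ℂ)
  have h3 := CC_mul_SS (A := A) r s t
  have h4 := CC_mul_SS (A := A) s r t
  calc _ = (CC r A t * CC r A t - SS r s A t * SS s r A t)
      + Z * (SS s r A t * CC r A t - CC s A t * SS s r A t)
      + (CC r A t * SS r s A t - SS r s A t * CC s A t) * Zᴴ
      - Z * (CC s A t * CC s A t - SS s r A t * SS r s A t) * Zᴴ := by
        simp only [Matrix.add_mul, Matrix.mul_add, Matrix.mul_sub, Matrix.sub_mul,
          Matrix.mul_assoc]
        abel
    _ = _ := by rw [h1, h2, h3, h4]; simp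

lemma isUnit_mobN (hr : ∀ k, r ≤ k → A k = 0) (hs : ∀ k, s ≤ k → A k = 0) (t : ℝ)
    {Z : Matrix (Fin r) (Fin s) ℂ} (hZ : Z ∈ OmegaI r s) : IsUnit (mobN r s A t Z).det := by
  have h1 : (mobN r s A t Z * (mobN r s A t Z)ᴴ - mobM r s A t Z * (mobM r s A t Z)ᴴ).PosDef := by
    rw [mobN_sub_mobM hr hs]; exact hZ
  rw [posDef_sub_iff] at h1
  rw [isUnit_iff_ne_zero]
  intro h
  have h2 : (mobN r s A t Z)ᴴ.det = 0 := by rw [det_conjTranspose, h, star_zero]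
  obtain ⟨x, hx, hx0⟩ := exists_mulVec_eq_zero_iff.2 h2
  have h3 := h1 x hx
  rw [hx0, nsq_zero] at h3
  exact absurd h3 (not_lt.2 (nsq_nonneg _))

lemma mob_mem (hr : ∀ k, r ≤ k → A k = 0) (hs : ∀ k, s ≤ k → A k = 0) (t : ℝ)
    {Z : Matrix (Fin r) (Fin s) ℂ} (hZ : Z ∈ OmegaI r s) : mob r s A t Z ∈ OmegaI r s := by
  have hu := isUnit_mobN hr hs t hZ
  have h1 : (1 - Z * Zᴴ).PosDef := hZ
  rw [← mobN_sub_mobM hr hs t Z] at h1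
  rw [OmegaI, Set.mem_ofPred_eq, mob]
  set N := mobN r s A t Z
  set M := mobM r s A t Z
  have h2 : 1 - N⁻¹ * M * (N⁻¹ * M)ᴴ = N⁻¹ * (N * Nᴴ - M * Mᴴ) * (N⁻¹)ᴴ := by
    have h3 : N⁻¹ * N = 1 := nonsing_inv_mul N hu
    have h4 : Nᴴ * (N⁻¹)ᴴ = 1 := by rw [← conjTranspose_mul, h3, conjTranspose_one]
    calc _ = 1 - N⁻¹ * (M * Mᴴ) * (N⁻¹)ᴴ := by simp only [conjTranspose_mul, Matrix.mul_assoc]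
      _ = (N⁻¹ * N) * (Nᴴ * (N⁻¹)ᴴ) - N⁻¹ * (M * Mᴴ) * (N⁻¹)ᴴ := by rw [h3, h4, Matrix.one_mul]
      _ = _ := by simp only [Matrix.mul_sub, Matrix.sub_mul, Matrix.mul_assoc]
  rw [h2]
  refine h1.mul_mul_conjTranspose_same ?_
  intro x y hxy
  have h5 := congrArg (fun v => v ᵥ* N) hxy
  simpa [vecMul_vecMul, nonsing_inv_mul N hu] using h5

lemma mobN_mob (hs : ∀ k, s ≤ k → A k = 0) {t u : ℂ} {Z : Matrix (Fin r) (Fin s) ℂ}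
    (ht : IsUnit (mobN r s A t Z).det) :
    mobN r s A t Z * mobN r s A u (mob r s A t Z) = mobN r s A (t + u) Z := by
  rw [mobN_add hs, mobN.eq_1 r s A u, mob, Matrix.mul_add, ← Matrix.mul_assoc,
    mul_nonsing_inv_cancel_left _ _ ht]

lemma mobM_mob (hr : ∀ k, r ≤ k → A k = 0) {t u : ℂ} {Z : Matrix (Fin r) (Fin s) ℂ}
    (ht : IsUnit (mobN r s A t Z).det) :
    mobN r s A t Z * mobM r s A u (mob r s A t Z) = mobM r s A (t + u) Z := by
  rw [mobM_add hr, mobM.eq_1 r s A u, mob, Matrix.mul_add, ← Matrix.mul_assoc,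
    mul_nonsing_inv_cancel_left _ _ ht]

lemma mob_mob (hr : ∀ k, r ≤ k → A k = 0) (hs : ∀ k, s ≤ k → A k = 0) (t u : ℝ)
    {Z : Matrix (Fin r) (Fin s) ℂ} (hZ : Z ∈ OmegaI r s) :
    mob r s A u (mob r s A t Z) = mob r s A (t + u) Z := by
  have ht := isUnit_mobN hr hs t hZ
  have h1 := mobN_mob (u := u) hs ht
  have h2 := mobM_mob (u := u) hr ht
  rw [mob.eq_1 r s A u, mob.eq_1 r s A (t + u), ← h1, ← h2, Matrix.mul_inv_rev, Matrix.mul_assoc,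
    nonsing_inv_mul_cancel_left _ _ ht]

lemma mob_zero (Z : Matrix (Fin r) (Fin s) ℂ) : mob r s A 0 Z = Z := by
  simp [mob, mobN, mobM, CC_zero, SS_zero]

lemma mob_neg_mob (hr : ∀ k, r ≤ k → A k = 0) (hs : ∀ k, s ≤ k → A k = 0) (t : ℝ)
    {Z : Matrix (Fin r) (Fin s) ℂ} (hZ : Z ∈ OmegaI r s) :
    mob r s A (-t) (mob r s A t Z) = Z := by
  have := mob_mob hr hs t (-t) hZ
  push_cast at this
  rw [this, add_neg_cancel, mob_zero]

lemma mob_mob_neg (hr : ∀ k, r ≤ k → A k = 0) (hs : ∀ k, s ≤ k → A k = 0) (t : ℝ)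
    {Z : Matrix (Fin r) (Fin s) ℂ} (hZ : Z ∈ OmegaI r s) :
    mob r s A t (mob r s A (-t) Z) = Z := by
  have := mob_neg_mob hr hs (-t) hZ
  push_cast at this
  rwa [neg_neg] at this

lemma mob_neg (t : ℂ) (Z : Matrix (Fin r) (Fin s) ℂ) :
    mob r s A (-t) (-Z) = - mob r s A t Z := by
  simp only [mob, mobN, mobM, CC_neg, SS_neg, Matrix.neg_mul, ← neg_add,
    Matrix.mul_neg, neg_neg]

lemma mobN_Dg (hs : ∀ k, s ≤ k → A k = 0) (t : ℂ) (z : ℕ → ℂ) :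
    mobN r s A t (Dg r s z) =
      Dg r r fun k => Complex.cosh (t * A k) + z k * Complex.sinh (t * A k) := by
  rw [mobN, CC, SS, Dg_mul (fun k _ _ hk => by simp [hs k hk]), Dg_add]
  rfl

lemma mob_Dg (hs : ∀ k, s ≤ k → A k = 0) (t : ℂ) (z : ℕ → ℂ)
    (h : ∀ k, k < r → Complex.cosh (t * A k) + z k * Complex.sinh (t * A k) ≠ 0) :
    mob r s A t (Dg r s z) = Dg r s fun k => (Complex.sinh (t * A k) + z k * Complex.cosh (t * A k))
      / (Complex.cosh (t * A k) + z k * Complex.sinh (t * A k)) := by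
  rw [mob, mobN_Dg hs, mobM, CC, SS, Dg_mul (by intros; omega), Dg_add, Dg_inv h,
    Dg_mul (by intros; omega)]
  refine Dg_congr fun k _ _ => ?_
  simp only [Pi.mul_apply, Pi.inv_apply, Pi.add_apply]
  rw [div_eq_inv_mul]

lemma EntryMem.mobN {X : Type*} {S : Subalgebra ℂ (X → ℂ)} {t : X → ℂ}
    (hc : ∀ k, (fun x => Complex.cosh (t x * A k)) ∈ S)
    (hs : ∀ k, (fun x => Complex.sinh (t x * A k)) ∈ S)
    {M : X → Matrix (Fin r) (Fin s) ℂ} (hM : EntryMem S M) :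
    EntryMem S fun x => mobN r s A (t x) (M x) :=
  (EntryMem.diag fun k _ _ => hc k).add (hM.mul (EntryMem.diag fun k _ _ => hs k))

lemma EntryMem.mobM {X : Type*} {S : Subalgebra ℂ (X → ℂ)} {t : X → ℂ}
    (hc : ∀ k, (fun x => Complex.cosh (t x * A k)) ∈ S)
    (hs : ∀ k, (fun x => Complex.sinh (t x * A k)) ∈ S)
    {M : X → Matrix (Fin r) (Fin s) ℂ} (hM : EntryMem S M) :
    EntryMem S fun x => mobM r s A (t x) (M x) :=
  (EntryMem.diag fun k _ _ => hs k).add (hM.mul (EntryMem.diag fun k _ _ => hc k))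

lemma EntryMem.mob {X : Type*} {S : Subalgebra ℂ (X → ℂ)} {t : X → ℂ}
    (hc : ∀ k, (fun x => Complex.cosh (t x * A k)) ∈ S)
    (hs : ∀ k, (fun x => Complex.sinh (t x * A k)) ∈ S)
    {M : X → Matrix (Fin r) (Fin s) ℂ} (hM : EntryMem S M)
    (hd : (fun x => (TypeI.mobN r s A (t x) (M x)).det⁻¹) ∈ S) :
    EntryMem S fun x => mob r s A (t x) (M x) :=
  ((hM.mobN hc hs).inv hd).mul (hM.mobM hc hs)

lemma inv_mem_diffAlg {E : Type*} [NormedAddCommGroup E] [NormedSpace ℂ E] {U : Set E}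
    {h : E → ℂ} (hh : h ∈ diffAlg U) (h0 : ∀ x ∈ U, h x ≠ 0) :
    (fun x => (h x)⁻¹) ∈ diffAlg U :=
  DifferentiableOn.inv hh h0

lemma mob_entryMem_diff {E : Type*} [NormedAddCommGroup E] [NormedSpace ℂ E] {U : Set E}
    (hr : ∀ k, r ≤ k → A k = 0) (hs : ∀ k, s ≤ k → A k = 0) (t : ℝ)
    {M : E → Matrix (Fin r) (Fin s) ℂ} (hM : EntryMem (diffAlg U) M)
    (hU : Set.MapsTo M U (OmegaI r s)) :
    EntryMem (diffAlg U) fun x => mob r s A t (M x) := by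
  have hc : ∀ k, (fun _ : E => Complex.cosh ((t : ℂ) * A k)) ∈ diffAlg U :=
    fun k => (diffAlg U).algebraMap_mem _
  have hs' : ∀ k, (fun _ : E => Complex.sinh ((t : ℂ) * A k)) ∈ diffAlg U :=
    fun k => (diffAlg U).algebraMap_mem _
  exact hM.mob hc hs' (inv_mem_diffAlg (hM.mobN hc hs').det
    fun x hx => (isUnit_mobN hr hs t (hU hx)).ne_zero)

/-! ### The automorphism group -/

lemma isAutomorphismOf_comp {E : Type*} [NormedAddCommGroup E] [NormedSpace ℂ E] {Ω : Set E}
    {τ σ : E → E} (hτ : IsAutomorphismOf Ω τ) (hσ : IsAutomorphismOf Ω σ) :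
    IsAutomorphismOf Ω fun z => σ (τ z) := by
  obtain ⟨h1, h2, τ', h3, h4, h5, h6⟩ := hτ
  obtain ⟨k1, k2, σ', k3, k4, k5, k6⟩ := hσ
  refine ⟨k1.comp h1, k2.comp h2 h1, fun z => τ' (σ' z), h3.comp k3, h4.comp k4 k3, ?_, ?_⟩
  · intro z hz
    simp only [k5 _ (h1 hz), h5 z hz]
  · intro z hz
    simp only [h6 _ (k3 hz), k6 z hz]

lemma isAutomorphismOf_mob (hr : ∀ k, r ≤ k → A k = 0) (hs : ∀ k, s ≤ k → A k = 0) (t : ℝ) :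
    IsAutomorphismOf (OmegaI r s) (mob r s A t) := by
  refine ⟨fun Z hZ => mob_mem hr hs t hZ,
    differentiableOn_iff_entryMem.2 (mob_entryMem_diff hr hs t (entryMem_id _) fun Z hZ => hZ),
    mob r s A (-t : ℝ), fun Z hZ => mob_mem hr hs (-t) hZ,
    differentiableOn_iff_entryMem.2 (mob_entryMem_diff hr hs (-t) (entryMem_id _) fun Z hZ => hZ),
    fun Z hZ => ?_, fun Z hZ => ?_⟩
  · push_cast
    exact mob_neg_mob hr hs t hZ
  · push_cast
    exact mob_mob_neg hr hs t hZ

lemma isAutomorphismOf_unitary {U : Matrix (Fin r) (Fin r) ℂ} {V : Matrix (Fin s) (Fin s) ℂ}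
    (hU : U * Uᴴ = 1) (hV : V * Vᴴ = 1) :
    IsAutomorphismOf (OmegaI r s) fun Z => U * Z * V := by
  have hU' := mul_eq_one_comm.1 hU
  have hV' := mul_eq_one_comm.1 hV
  refine ⟨fun Z hZ => unitary_mul_mem_omega hZ hU hV,
    differentiableOn_iff_entryMem.2 (((EntryMem.const U).mul (entryMem_id _)).mul
      (EntryMem.const V)), fun Z => Uᴴ * Z * Vᴴ,
    fun Z hZ => unitary_mul_mem_omega hZ (by simpa using hU') (by simpa using hV'),
    differentiableOn_iff_entryMem.2 (((EntryMem.const Uᴴ).mul (entryMem_id _)).mul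
      (EntryMem.const Vᴴ)), fun Z _ => ?_, fun Z _ => ?_⟩
  · calc Uᴴ * (U * Z * V) * Vᴴ = (Uᴴ * U) * Z * (V * Vᴴ) := by simp only [Matrix.mul_assoc]
      _ = Z := by rw [hU', hV, Matrix.one_mul, Matrix.mul_one]
  · calc U * (Uᴴ * Z * Vᴴ) * V = (U * Uᴴ) * Z * (Vᴴ * V) := by simp only [Matrix.mul_assoc]
      _ = Z := by rw [hU, hV', Matrix.one_mul, Matrix.mul_one]

end TypeI

namespace TypeI

open Metric Filter Topology

/-! ### The Schwarz lemma -/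

/-- Equality case of the Schwarz lemma for maps of the disc into the Euclidean ball. -/
lemma schwarz_vec {m : ℕ} {v : ℂ → Fin m → ℂ}
    (hd : ∀ k, DifferentiableOn ℂ (fun x => v x k) (ball 0 1))
    (hb : ∀ x ∈ ball (0 : ℂ) 1, ∑ k, ‖v x k‖ ^ 2 < 1) (h0 : v 0 = 0) {j : Fin m}
    (hj : HasDerivAt (fun x => v x j) 1 0) {x : ℂ} (hx : x ∈ ball (0 : ℂ) 1) (k : Fin m) :
    v x k = if k = j then x else 0 := by
  let ρ : ℂ → EuclideanSpace ℂ (Fin m) := fun x => WithLp.toLp 2 (v x)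
  have hρ : DifferentiableOn ℂ ρ (ball 0 1) := differentiableOn_euclidean.2 hd
  have hρ0 : ρ 0 = 0 := by simp [ρ, h0]
  have hmaps : Set.MapsTo ρ (ball 0 1) (closedBall (ρ 0) 1) := by
    intro y hy
    rw [hρ0, mem_closedBall_zero_iff]
    have : ‖ρ y‖ ^ 2 < 1 := by
      rw [EuclideanSpace.norm_sq_eq]; exact hb y hy
    nlinarith [norm_nonneg (ρ y)]
  have hz : (0 : ℂ) ∈ ball (0 : ℂ) 1 := mem_ball_self one_pos
  have hdiff : HasDerivAt ρ (deriv ρ 0) 0 :=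
    (hρ.differentiableAt (isOpen_ball.mem_nhds hz)).hasDerivAt
  have hdj : deriv ρ 0 j = 1 := by
    have h1 := (EuclideanSpace.proj (𝕜 := ℂ) j).hasFDerivAt.comp_hasDerivAt (0 : ℂ) hdiff
    exact HasDerivAt.unique h1 hj
  have hle : ‖deriv ρ 0‖ ≤ 1 := Complex.norm_deriv_le_one_of_mapsTo_ball hρ hmaps one_pos
  have hsq : ∑ k, ‖deriv ρ 0 k‖ ^ 2 ≤ 1 := by
    rw [← EuclideanSpace.norm_sq_eq]
    nlinarith [norm_nonneg (deriv ρ 0)]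
  have hsplit := Finset.add_sum_erase Finset.univ (fun k => ‖deriv ρ 0 k‖ ^ 2) (Finset.mem_univ j)
  simp only [hdj, norm_one, one_pow] at hsplit
  have hrest : ∑ k ∈ Finset.univ.erase j, ‖deriv ρ 0 k‖ ^ 2 = 0 :=
    le_antisymm (by linarith) (Finset.sum_nonneg fun _ _ => by positivity)
  have hk : ∀ k, k ≠ j → deriv ρ 0 k = 0 := by
    intro k hk
    have := (Finset.sum_eq_zero_iff_of_nonneg (fun _ _ => by positivity)).1 hrest k
      (Finset.mem_erase.2 ⟨hk, Finset.mem_univ k⟩)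
    simpa using this
  have hnorm : ‖deriv ρ 0‖ = 1 := by
    have : ‖deriv ρ 0‖ ^ 2 = 1 := by
      rw [EuclideanSpace.norm_sq_eq, ← hsplit, hrest, add_zero]
    nlinarith [norm_nonneg (deriv ρ 0)]
  have haff := Complex.affine_of_mapsTo_ball_of_norm_dslope_eq_div hρ hmaps hz
    (by rw [dslope_same, hnorm, div_one]) hx
  have hv : v x k = x * deriv ρ 0 k := by
    have := congrArg (fun w : EuclideanSpace ℂ (Fin m) => w k) haff
    simpa [hρ0, ρ, h0] using this
  rw [hv]
  split_ifs with h
  · rw [h, hdj, mul_one]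
  · rw [hk k h, mul_zero]

/-- A holomorphic map of the polydisc into the domain whose `(j, j')` entry has the derivative
`∑ p i * z i` with `∑ p i = 1` is explicitly known in the row `j` and the column `j'` at points
which are constant along the support of `p`. -/
lemma schwarz_polydisc {n r s : ℕ} {F : (Fin n → ℂ) → Matrix (Fin r) (Fin s) ℂ}
    (hd : EntryMem (diffAlg (ball 0 1)) F) (hm : Set.MapsTo F (ball 0 1) (OmegaI r s))
    (h0 : F 0 = 0) {j : Fin r} {j' : Fin s} {p : Fin n → ℂ} (hp : ∑ i, p i = 1)
    (hderiv : ∀ z : Fin n → ℂ, HasDerivAt (fun x : ℂ => F (x • z) j j') (∑ i, p i * z i) 0)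
    {z : Fin n → ℂ} (hz : z ∈ ball (0 : Fin n → ℂ) 1) {μ : ℂ} (hμ : ∀ i, p i ≠ 0 → z i = μ) :
    (∀ k, F z j k = if k = j' then μ else 0) ∧ (∀ k, F z k j' = if k = j then μ else 0) := by
  -- the case where `μ` is a largest coordinate
  have key : ∀ z : Fin n → ℂ, ∀ μ : ℂ, ‖μ‖ < 1 → μ ≠ 0 → (∀ i, ‖z i‖ ≤ ‖μ‖) →
      (∀ i, p i ≠ 0 → z i = μ) →
      (∀ k, F z j k = if k = j' then μ else 0) ∧ (∀ k, F z k j' = if k = j then μ else 0) := by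
    intro z μ hμ1 hμ0 hzμ hpz
    let w : Fin n → ℂ := μ⁻¹ • z
    have hw : ∀ i, ‖w i‖ ≤ 1 := by
      intro i
      have : 0 < ‖μ‖ := norm_pos_iff.2 hμ0
      simp only [w, Pi.smul_apply, smul_eq_mul, norm_mul, norm_inv]
      rw [inv_mul_le_iff₀ this, mul_one]
      exact hzμ i
    have hball : Set.MapsTo (fun x : ℂ => x • w) (ball 0 1) (ball 0 1) := by
      intro x hx
      rw [mem_ball_zero_iff] at hx ⊢
      have : ‖w‖ ≤ 1 := (pi_norm_le_iff_of_nonneg zero_le_one).2 hw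
      rw [norm_smul]
      nlinarith [norm_nonneg x, norm_nonneg w]
    have hdw : ∀ a b, DifferentiableOn ℂ (fun x : ℂ => F (x • w) a b) (ball 0 1) := fun a b =>
      DifferentiableOn.comp (g := fun z => F z a b) (f := fun x : ℂ => x • w) (hd a b)
        (by fun_prop) hball
    have hdj : HasDerivAt (fun x : ℂ => F (x • w) j j') 1 0 := by
      have h1 := hderiv w
      have h2 : ∑ i, p i * w i = 1 := by
        rw [← hp]
        refine Finset.sum_congr rfl fun i _ => ?_
        by_cases hi : p i = 0
        · simp [hi]
        · simp [w, hpz i hi, hμ0]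
      rwa [h2] at h1
    have hF0 : ∀ a b, F ((0 : ℂ) • w) a b = 0 := by simp [h0]
    have hμb : μ ∈ ball (0 : ℂ) 1 := by simpa using hμ1
    have hzw : μ • w = z := by simp [w, smul_smul, hμ0]
    refine ⟨fun k => ?_, fun k => ?_⟩
    · have := schwarz_vec (v := fun x k => F (x • w) j k) (fun k => hdw j k)
        (fun x hx => row_lt (hm (hball hx)) j) (funext fun k => hF0 j k) hdj hμb k
      simpa only [hzw] using this
    · have := schwarz_vec (v := fun x k => F (x • w) k j') (fun k => hdw k j')
        (fun x hx => col_lt (hm (hball hx)) j') (funext fun k => hF0 k j') hdj hμb k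
      simpa only [hzw] using this
  obtain ⟨i₀, hi₀⟩ : ∃ i, p i ≠ 0 := by
    by_contra! h
    simp [h] at hp
  let ζ : ℂ → Fin n → ℂ := fun x i => if p i = 0 then z i else x
  have hζμ : ζ μ = z := by
    funext i
    by_cases hi : p i = 0
    · simp [ζ, hi]
    · simp [ζ, hi, hμ i hi]
  rw [mem_ball_zero_iff] at hz
  have hz' : ∀ i, ‖z i‖ < 1 := fun i => (norm_le_pi_norm z i).trans_lt hz
  have hμ1 : μ ∈ ball (0 : ℂ) 1 := by
    rw [mem_ball_zero_iff, ← hμ i₀ hi₀]; exact hz' i₀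
  have hζb : Set.MapsTo ζ (ball 0 1) (ball 0 1) := by
    intro x hx
    rw [mem_ball_zero_iff] at hx ⊢
    rw [pi_norm_lt_iff one_pos]
    intro i
    by_cases hi : p i = 0
    · simpa [ζ, hi] using hz' i
    · simpa [ζ, hi] using hx
  have hζd : DifferentiableOn ℂ ζ (ball 0 1) := by
    refine differentiableOn_pi.2 fun i => ?_
    by_cases hi : p i = 0
    · simp only [ζ, hi, if_true]; fun_prop
    · simp only [ζ, hi, if_false]; fun_prop
  obtain ⟨t, ht1, ht2⟩ := exists_between hz
  have ht0 : 0 < t := (norm_nonneg z).trans_lt ht1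
  have htb : (t : ℂ) ∈ ball (0 : ℂ) 1 := by
    rw [mem_ball_zero_iff, Complex.norm_real, Real.norm_of_nonneg ht0.le]; exact ht2
  have hev : ∀ᶠ x in 𝓝 (t : ℂ), ‖z‖ < ‖x‖ ∧ ‖x‖ < 1 := by
    have h1 : Tendsto (fun x : ℂ => ‖x‖) (𝓝 (t : ℂ)) (𝓝 t) := by
      have := (continuous_norm (E := ℂ)).tendsto (t : ℂ)
      rwa [Complex.norm_real, Real.norm_of_nonneg ht0.le] at this
    exact (h1.eventually (lt_mem_nhds ht1)).and (h1.eventually (gt_mem_nhds ht2))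
  have hev' : ∀ᶠ x in 𝓝 (t : ℂ), (∀ k, F (ζ x) j k = if k = j' then x else 0) ∧
      (∀ k, F (ζ x) k j' = if k = j then x else 0) := by
    filter_upwards [hev] with x hx
    refine key (ζ x) x hx.2 (norm_pos_iff.1 ((norm_nonneg z).trans_lt hx.1)) (fun i => ?_)
      (fun i hi => by simp [ζ, hi])
    by_cases hi : p i = 0
    · simpa [ζ, hi] using (norm_le_pi_norm z i).trans hx.1.le
    · simp [ζ, hi]
  have ext : ∀ (h g : ℂ → ℂ), DifferentiableOn ℂ h (ball 0 1) → DifferentiableOn ℂ g (ball 0 1) →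
      (∀ᶠ x in 𝓝 (t : ℂ), h x = g x) → h μ = g μ := fun h g hh hg he =>
    (hh.analyticOnNhd isOpen_ball).eqOn_of_preconnected_of_eventuallyEq
      (hg.analyticOnNhd isOpen_ball) (convex_ball _ _).isPreconnected htb he hμ1
  have hdF : ∀ a b, DifferentiableOn ℂ (fun x => F (ζ x) a b) (ball 0 1) := fun a b =>
    DifferentiableOn.comp (g := fun z => F z a b) (hd a b) hζd hζb
  have hite : ∀ P : Prop, [Decidable P] →
      DifferentiableOn ℂ (fun x : ℂ => if P then x else 0) (ball 0 1) := by
    intro P _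
    split_ifs <;> fun_prop
  rw [← hζμ]
  exact ⟨fun k => ext _ _ (hdF j k) (hite _) (hev'.mono fun x hx => hx.1 k),
    fun k => ext _ _ (hdF k j') (hite _) (hev'.mono fun x hx => hx.2 k)⟩

end TypeI

namespace TypeI

open Metric Filter Topology

/-! ### Singular value decomposition -/

lemma exists_svd {r s : ℕ} (hrs : r ≤ s) (M : Matrix (Fin r) (Fin s) ℂ) :
    ∃ (U : Matrix (Fin r) (Fin r) ℂ) (V : Matrix (Fin s) (Fin s) ℂ) (σ : ℕ → ℝ),
      U * Uᴴ = 1 ∧ V * Vᴴ = 1 ∧ (∀ k, 0 ≤ σ k) ∧ (∀ k, r ≤ k → σ k = 0) ∧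
      M = U * Dg r s (fun k => (σ k : ℂ)) * V := by
  have hpsd : (M * Mᴴ).PosSemidef := posSemidef_self_mul_conjTranspose M
  have hH : (M * Mᴴ).IsHermitian := hpsd.isHermitian
  let U : Matrix (Fin r) (Fin r) ℂ := hH.eigenvectorUnitary
  have hU1 : Uᴴ * U = 1 := Unitary.coe_star_mul_self hH.eigenvectorUnitary
  have hU2 : U * Uᴴ = 1 := Unitary.coe_mul_star_self hH.eigenvectorUnitary
  let Y : Matrix (Fin r) (Fin s) ℂ := Uᴴ * M
  have hMY : M = U * Y := by rw [← Matrix.mul_assoc, hU2, Matrix.one_mul]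
  have hY : Y * Yᴴ = diagonal fun i => ((hH.eigenvalues i : ℝ) : ℂ) := by
    have h1 : M * Mᴴ = U * (diagonal fun i => ((hH.eigenvalues i : ℝ) : ℂ)) * Uᴴ :=
      hH.spectral_theorem
    calc Y * Yᴴ = Uᴴ * (M * Mᴴ) * U := by
          simp only [Y, conjTranspose_mul, conjTranspose_conjTranspose, Matrix.mul_assoc]
      _ = (Uᴴ * U) * (diagonal fun i => ((hH.eigenvalues i : ℝ) : ℂ)) * (Uᴴ * U) := by
          refine (congrArg (fun X => Uᴴ * X * U) h1).trans ?_
          simp only [Matrix.mul_assoc]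
      _ = _ := by rw [hU1, Matrix.one_mul, Matrix.mul_one]
  have hev : ∀ i, 0 ≤ hH.eigenvalues i := hpsd.eigenvalues_nonneg
  let σ : ℕ → ℝ := fun k => if h : k < r then √(hH.eigenvalues ⟨k, h⟩) else 0
  have hσ0 : ∀ k, 0 ≤ σ k := by
    intro k
    simp only [σ]
    split_ifs
    · positivity
    · exact le_rfl
  have hσr : ∀ k, r ≤ k → σ k = 0 := fun k hk => by simp [σ, not_lt.2 hk]
  have hσ : ∀ i : Fin r, σ i * σ i = hH.eigenvalues i := fun i => by
    simp [σ, Real.mul_self_sqrt (hev i)]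
  let y : Fin r → EuclideanSpace ℂ (Fin s) := fun i => WithLp.toLp 2 (Y i)
  have hinner : ∀ i j, inner ℂ (y i) (y j) = if i = j then ((σ i * σ i : ℝ) : ℂ) else 0 := by
    intro i j
    have h1 : inner ℂ (y i) (y j) = (Y * Yᴴ) j i := by
      simp [y, EuclideanSpace.inner_eq_star_dotProduct, mul_apply, dotProduct]
    rw [h1, hY, diagonal_apply, hσ]
    by_cases h : i = j
    · simp [h]
    · simp [h, Ne.symm h]
  let v : Fin s → EuclideanSpace ℂ (Fin s) := fun j =>
    if h : (j : ℕ) < r then (((σ j)⁻¹ : ℝ) : ℂ) • y ⟨j, h⟩ else 0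
  have hv : Orthonormal ℂ (({j : Fin s | σ j ≠ 0} : Set (Fin s)).domRestrict v) := by
    rw [orthonormal_iff_ite]
    rintro ⟨i, hi⟩ ⟨j, hj⟩
    have hi' : σ i ≠ 0 := hi
    have hj' : σ j ≠ 0 := hj
    have hir : (i : ℕ) < r := by
      by_contra h; exact hi' (hσr _ (not_lt.1 h))
    have hjr : (j : ℕ) < r := by
      by_contra h; exact hj' (hσr _ (not_lt.1 h))
    simp only [Set.domRestrict_apply, v, hir, hjr, dif_pos, inner_smul_left, inner_smul_right,
      hinner, Subtype.mk.injEq, Fin.ext_iff]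
    by_cases h : (i : ℕ) = j
    · have hjc : (σ j : ℂ) ≠ 0 := by exact_mod_cast hj'
      simp only [h, if_true, Complex.conj_ofReal]
      push_cast
      field_simp
    · simp [h]
  obtain ⟨b, hb⟩ := hv.exists_orthonormalBasis_extension_of_card_eq (by simp)
  let V : Matrix (Fin s) (Fin s) ℂ := of fun j k => b j k
  have hV : V * Vᴴ = 1 := by
    ext i j
    have h1 : (V * Vᴴ) i j = inner ℂ (b j) (b i) := by
      simp [V, EuclideanSpace.inner_eq_star_dotProduct, mul_apply, dotProduct]
    rw [h1, orthonormal_iff_ite.1 b.orthonormal, one_apply]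
    simp [eq_comm]
  refine ⟨U, V, σ, hU2, hV, hσ0, hσr, ?_⟩
  rw [Matrix.mul_assoc]
  refine hMY.trans (congrArg _ ?_)
  ext i k
  have his : (i : ℕ) < s := i.2.trans_le hrs
  rw [mul_apply, Finset.sum_eq_single (⟨i, his⟩ : Fin s)]
  · simp only [Dg_apply, if_true]
    by_cases h0 : σ i = 0
    · have h2 : y i = 0 := by
        rw [← inner_self_eq_zero (𝕜 := ℂ), hinner]; simp [h0]
      have h3 : Y i k = y i k := rfl
      rw [h3, h2, h0]; simp
    · have h2 : b ⟨i, his⟩ = (((σ i)⁻¹ : ℝ) : ℂ) • y i := by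
        rw [hb _ h0]; simp [v]
      have h3 : (σ i : ℂ) ≠ 0 := by exact_mod_cast h0
      simp [V, h2, y, h3]
  · intro j _ hj
    have : (i : ℕ) ≠ j := fun h => hj (Fin.ext h.symm)
    simp [Dg_apply, this]
  · simp

lemma svd_lt_one {r s : ℕ} {M : Matrix (Fin r) (Fin s) ℂ} (hM : M ∈ OmegaI r s)
    {U : Matrix (Fin r) (Fin r) ℂ} {V : Matrix (Fin s) (Fin s) ℂ} {σ : ℕ → ℝ}
    (hU : U * Uᴴ = 1) (hV : V * Vᴴ = 1) (hσ : ∀ k, 0 ≤ σ k)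
    (h : M = U * Dg r s (fun k => (σ k : ℂ)) * V) {k : ℕ} (hr : k < r) (hs : k < s) : σ k < 1 := by
  have h1 : Uᴴ * M * Vᴴ ∈ OmegaI r s :=
    unitary_mul_mem_omega hM (by simpa using mul_eq_one_comm.1 hU)
      (by simpa using mul_eq_one_comm.1 hV)
  have h2 : Uᴴ * M * Vᴴ = Dg r s fun k => (σ k : ℂ) := by
    calc Uᴴ * M * Vᴴ = (Uᴴ * U) * Dg r s (fun k => (σ k : ℂ)) * (V * Vᴴ) := by
          rw [h]; simp only [Matrix.mul_assoc]
      _ = _ := by rw [mul_eq_one_comm.1 hU, hV, Matrix.one_mul, Matrix.mul_one]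
  rw [h2] at h1
  have := entry_lt h1 ⟨k, hr⟩ ⟨k, hs⟩
  simpa [Dg_apply, abs_of_nonneg (hσ k)] using this

/-! ### Cartan's theorem -/

lemma hasDerivAt_smul_self {E : Type*} [NormedAddCommGroup E] [NormedSpace ℂ E] (v : E) :
    HasDerivAt (fun x : ℂ => x • v) v 0 := by
  simpa using (hasDerivAt_id (0 : ℂ)).smul_const v

/-- Extension of a finite vector by zero. -/
def zext {n : ℕ} (z : Fin n → ℂ) (k : ℕ) : ℂ := if h : k < n then z ⟨k, h⟩ else 0

lemma zext_val {n : ℕ} (z : Fin n → ℂ) (i : Fin n) : zext z i = z i := by simp [zext]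

lemma zext_smul {n : ℕ} (c : ℂ) (z : Fin n → ℂ) : zext (c • z) = c • zext z := by
  funext k; simp only [zext, Pi.smul_apply]; split_ifs <;> simp

lemma Dg_zext_mem {r s : ℕ} {z : Fin r → ℂ} (hz : z ∈ ball (0 : Fin r → ℂ) 1) :
    Dg r s (zext z) ∈ OmegaI r s := by
  refine Dg_mem_omega fun k hk _ => ?_
  rw [mem_ball_zero_iff] at hz
  simpa [zext, hk] using (norm_le_pi_norm z ⟨k, hk⟩).trans_lt hz

lemma entryMem_Dg_zext {r s : ℕ} {S : Subalgebra ℂ ((Fin r → ℂ) → ℂ)}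
    (hS : ∀ i, (fun z : Fin r → ℂ => z i) ∈ S) :
    EntryMem S fun z : Fin r → ℂ => Dg r s (zext z) := by
  refine EntryMem.diag fun k hk _ => ?_
  simpa [zext, hk] using hS ⟨k, hk⟩

lemma hasFDerivAt_conj_smul {E : Type*} [NormedAddCommGroup E] [NormedSpace ℂ E] {S T : E → E}
    {S' T' : E →L[ℂ] E} (hS : HasFDerivAt S S' 0) (hT : HasFDerivAt T T' 0) (h0 : T 0 = 0)
    (h : S'.comp T' = ContinuousLinearMap.id ℂ E) {c : ℂ} (hc : c ≠ 0) :
    HasFDerivAt (fun Z => S (c⁻¹ • T (c • Z))) (ContinuousLinearMap.id ℂ E) 0 := by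
  have h1 : HasFDerivAt (fun Z : E => c • Z) (c • ContinuousLinearMap.id ℂ E) 0 :=
    (hasFDerivAt_id 0).const_smul c
  have h2 : HasFDerivAt (fun Z => T (c • Z)) (T'.comp (c • ContinuousLinearMap.id ℂ E)) 0 :=
    HasFDerivAt.comp (g := T) 0 (by rwa [smul_zero]) h1
  have h4 := HasFDerivAt.comp (g := S) (f := fun Z => c⁻¹ • T (c • Z)) 0
    (by simpa [h0] using hS) (h2.const_smul c⁻¹)
  have h5 : S'.comp (c⁻¹ • T'.comp (c • ContinuousLinearMap.id ℂ E))
      = ContinuousLinearMap.id ℂ E := by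
    ext1 Z
    simpa [smul_smul, hc] using congrArg (fun L => L Z) h
  rw [h5] at h4
  exact h4

lemma eq_of_hasFDerivAt_id {r s : ℕ} (hrs : r ≤ s)
    {G : Matrix (Fin r) (Fin s) ℂ → Matrix (Fin r) (Fin s) ℂ}
    (hd : DifferentiableOn ℂ G (OmegaI r s)) (hm : Set.MapsTo G (OmegaI r s) (OmegaI r s))
    (h0 : G 0 = 0) (hG : HasFDerivAt G (ContinuousLinearMap.id ℂ _) 0)
    {Z : Matrix (Fin r) (Fin s) ℂ} (hZ : Z ∈ OmegaI r s) : G Z = Z := by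
  obtain ⟨U, V, σ, hU, hV, hσ0, hσr, hZe⟩ := exists_svd hrs Z
  have hU' := mul_eq_one_comm.1 hU
  have hV' := mul_eq_one_comm.1 hV
  let K : (Fin r → ℂ) → Matrix (Fin r) (Fin s) ℂ := fun z => U * Dg r s (zext z) * V
  have hK : Set.MapsTo K (ball 0 1) (OmegaI r s) := fun z hz =>
    unitary_mul_mem_omega (Dg_zext_mem hz) hU hV
  have hKd : EntryMem (diffAlg (ball 0 1)) K := by
    refine ((EntryMem.const U).mul (entryMem_Dg_zext fun i => ?_)).mul (EntryMem.const V)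
    rw [mem_diffAlg]; fun_prop
  let F : (Fin r → ℂ) → Matrix (Fin r) (Fin s) ℂ := fun z => Uᴴ * G (K z) * Vᴴ
  have hFd : EntryMem (diffAlg (ball 0 1)) F :=
    ((EntryMem.const Uᴴ).mul (differentiableOn_iff_entryMem.1
      (hd.comp (differentiableOn_iff_entryMem.2 hKd) hK))).mul (EntryMem.const Vᴴ)
  have hFm : Set.MapsTo F (ball 0 1) (OmegaI r s) := fun z hz =>
    unitary_mul_mem_omega (hm (hK hz)) (by simpa using hU') (by simpa using hV')
  have hzext0 : zext (0 : Fin r → ℂ) = 0 := by funext k; simp [zext]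
  have hK0 : K 0 = 0 := by
    simp [K, hzext0, Dg_zero]
  have hF0 : F 0 = 0 := by simp [F, hK0, h0]
  have hUK : ∀ z, Uᴴ * K z * Vᴴ = Dg r s (zext z) := by
    intro z
    calc Uᴴ * K z * Vᴴ = (Uᴴ * U) * Dg r s (zext z) * (V * Vᴴ) := by
          simp only [K, Matrix.mul_assoc]
      _ = _ := by rw [hU', hV, Matrix.one_mul, Matrix.mul_one]
  have hKs : ∀ (x : ℂ) z, K (x • z) = x • K z := by
    intro x z
    simp only [K, zext_smul, ← Dg_smul, Matrix.mul_smul, Matrix.smul_mul]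
  have hmain : ∀ z ∈ ball (0 : Fin r → ℂ) 1, F z = Dg r s (zext z) := by
    intro z hz
    ext i k
    have his : (i : ℕ) < s := i.2.trans_le hrs
    let i' : Fin s := ⟨i, his⟩
    have hder : ∀ z : Fin r → ℂ, HasDerivAt (fun x : ℂ => F (x • z) i i')
        (∑ l, (Pi.single i 1 : Fin r → ℂ) l * z l) 0 := by
      intro z
      let L : Matrix (Fin r) (Fin s) ℂ →ₗ[ℂ] ℂ :=
        { toFun := fun X => (Uᴴ * X * Vᴴ) i i'
          map_add' := fun X Y => by simp [Matrix.mul_add, Matrix.add_mul]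
          map_smul' := fun c X => by simp }
      have h1 : HasDerivAt (fun x : ℂ => x • K z) (K z) 0 := hasDerivAt_smul_self (K z)
      have h2 : HasDerivAt (fun x : ℂ => G (x • K z)) (K z) 0 := by
        have := HasFDerivAt.comp_hasDerivAt (l := G) (f := fun x : ℂ => x • K z)
          (l' := ContinuousLinearMap.id ℂ _) (0 : ℂ) (by rwa [zero_smul]) h1
        exact this
      have h3 := L.toContinuousLinearMap.hasFDerivAt.comp_hasDerivAt (0 : ℂ) h2
      have h4 : L.toContinuousLinearMap (K z) = ∑ l, (Pi.single i 1 : Fin r → ℂ) l * z l := by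
        change (Uᴴ * K z * Vᴴ) i i' = _
        rw [hUK, Dg_apply, if_pos rfl, zext_val]
        simp [Pi.single_apply]
      refine (h3.congr_deriv h4).congr_of_eventuallyEq (Eventually.of_forall fun x => ?_)
      simp only [F, hKs, Function.comp_apply]
      rfl
    have := (schwarz_polydisc hFd hFm hF0 (p := Pi.single i 1) (by simp) hder hz (μ := z i)
      (fun l hl => by
        have : l = i := by
          by_contra h; exact hl (by simp [h])
        rw [this])).1 k
    rw [this, Dg_apply, zext_val]
    by_cases h : (i : ℕ) = k
    · rw [if_pos h, if_pos (Fin.ext h.symm)]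
    · rw [if_neg h, if_neg fun h' => h (by rw [h'])]
  have hz : (fun i : Fin r => (σ i : ℂ)) ∈ ball (0 : Fin r → ℂ) 1 := by
    rw [mem_ball_zero_iff, pi_norm_lt_iff one_pos]
    intro i
    rw [Complex.norm_real, Real.norm_of_nonneg (hσ0 i)]
    exact svd_lt_one hZ hU hV hσ0 hZe i.2 (i.2.trans_le hrs)
  have hKZ : K (fun i : Fin r => (σ i : ℂ)) = Z := by
    rw [hZe]
    simp only [K]
    congr 2
    exact Dg_congr fun k hk _ => by simp [zext, hk]
  have h1 := hmain _ hz
  rw [← hUK] at h1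
  have h2 := congrArg (fun X => U * X * V) h1
  simp only [F, hKZ] at h2
  have h3 : ∀ X : Matrix (Fin r) (Fin s) ℂ, U * (Uᴴ * X * Vᴴ) * V = X := by
    intro X
    calc U * (Uᴴ * X * Vᴴ) * V = (U * Uᴴ) * X * (Vᴴ * V) := by simp only [Matrix.mul_assoc]
      _ = X := by rw [hU, hV', Matrix.one_mul, Matrix.mul_one]
  rwa [h3, h3] at h2

/-- Cartan's theorem: an automorphism fixing the origin is linear. -/
theorem exists_linear_of_isAutomorphismOf {r s : ℕ} (hrs : r ≤ s)
    {T : Matrix (Fin r) (Fin s) ℂ → Matrix (Fin r) (Fin s) ℂ}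
    (hT : IsAutomorphismOf (OmegaI r s) T) (h0 : T 0 = 0) :
    ∃ L : Matrix (Fin r) (Fin s) ℂ →L[ℂ] Matrix (Fin r) (Fin s) ℂ, ∀ Z ∈ OmegaI r s, T Z = L Z := by
  obtain ⟨hTm, hTd, S, hSm, hSd, hST, hTS⟩ := hT
  have hS0 : S 0 = 0 := by
    have := hST 0 zero_mem_omega
    rwa [h0] at this
  have hT' : HasFDerivAt T (fderiv ℂ T 0) 0 :=
    (hTd.differentiableAt omega_mem_nhds_zero).hasFDerivAt
  have hS' : HasFDerivAt S (fderiv ℂ S 0) 0 :=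
    (hSd.differentiableAt omega_mem_nhds_zero).hasFDerivAt
  have hcomp : (fderiv ℂ S 0).comp (fderiv ℂ T 0) = ContinuousLinearMap.id ℂ _ := by
    have h1 : HasFDerivAt (S ∘ T) ((fderiv ℂ S 0).comp (fderiv ℂ T 0)) 0 :=
      HasFDerivAt.comp 0 (by rwa [h0]) hT'
    refine h1.unique ((hasFDerivAt_id 0).congr_of_eventuallyEq ?_)
    filter_upwards [omega_mem_nhds_zero] with Z hZ
    exact hST Z hZ
  have hrot : ∀ c : ℂ, ‖c‖ = 1 → ∀ Z ∈ OmegaI r s, T (c • Z) = c • T Z := by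
    intro c hc Z hZ
    have hc0 : c ≠ 0 := by
      intro h; rw [h, norm_zero] at hc; exact zero_ne_one hc
    have hci : ‖c⁻¹‖ = 1 := by rw [norm_inv, hc, inv_one]
    have hm1 : Set.MapsTo (fun Z : Matrix (Fin r) (Fin s) ℂ => c • Z) (OmegaI r s) (OmegaI r s) :=
      fun Z hZ => smul_mem_omega hZ hc.le
    have hm2 : Set.MapsTo (fun Z => c⁻¹ • T (c • Z)) (OmegaI r s) (OmegaI r s) :=
      fun Z hZ => smul_mem_omega (hTm (hm1 hZ)) hci.le
    have hd1 : DifferentiableOn ℂ (fun Z => c⁻¹ • T (c • Z)) (OmegaI r s) :=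
      (hTd.comp (by fun_prop) hm1).const_smul c⁻¹
    have hder : HasFDerivAt (fun Z => S (c⁻¹ • T (c • Z))) (ContinuousLinearMap.id ℂ _) 0 :=
      hasFDerivAt_conj_smul hS' hT' h0 hcomp hc0
    have h1 := eq_of_hasFDerivAt_id hrs (hSd.comp hd1 hm2) (hSm.comp hm2)
      (by simp [h0, hS0]) hder hZ
    have h2 := congrArg T h1
    simp only [Function.comp_apply] at h2
    rw [hTS _ (hm2 hZ)] at h2
    rw [← h2, smul_smul, mul_inv_cancel₀ hc0, one_smul]
  refine ⟨fderiv ℂ T 0, fun Z hZ => ?_⟩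
  have hmaps : Set.MapsTo (fun x : ℂ => x • Z) (closedBall 0 1) (OmegaI r s) := fun x hx =>
    smul_mem_omega hZ (by simpa using hx)
  have hcl : DiffContOnCl ℂ (fun x : ℂ => T (x • Z)) (ball 0 1) := by
    refine DifferentiableOn.diffContOnCl ?_
    rw [closure_ball _ one_ne_zero]
    exact hTd.comp (by fun_prop) hmaps
  have hcl2 : DiffContOnCl ℂ (fun x : ℂ => x • T Z) (ball 0 1) :=
    Differentiable.diffContOnCl (by fun_prop)
  have heq := Complex.eqOn_of_eqOn_frontier isBounded_ball hcl hcl2 (by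
    intro x hx
    rw [frontier_ball _ one_ne_zero, mem_sphere_zero_iff_norm] at hx
    exact hrot x hx Z hZ)
  have h1 : HasDerivAt (fun x : ℂ => x • Z) Z 0 :=
    hasDerivAt_smul_self Z
  have h2 : HasDerivAt (fun x : ℂ => T (x • Z)) (fderiv ℂ T 0 Z) 0 :=
    HasFDerivAt.comp_hasDerivAt (l := T) (0 : ℂ) (by rwa [zero_smul]) h1
  have h3 : HasDerivAt (fun x : ℂ => x • T Z) (T Z) 0 :=
    hasDerivAt_smul_self (T Z)
  refine (h3.congr_of_eventuallyEq ?_).unique h2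
  filter_upwards [ball_mem_nhds (0 : ℂ) one_pos] with x hx
  exact heq hx

end TypeI

namespace TypeI

open Metric Filter Topology

/-! ### Auxiliary facts on polynomials -/

/-- A polynomial without zeros on the torus `(ℂ \ {0})ⁿ` is a monomial. -/
lemma exists_eval_eq_monomial {n : ℕ} (p : MvPolynomial (Fin n) ℂ)
    (hp : ∀ t : Fin n → ℂ, (∀ i, t i ≠ 0) → MvPolynomial.eval t p ≠ 0) :
    ∃ (c : ℂ) (k : Fin n → ℕ), ∀ t, MvPolynomial.eval t p = c * ∏ i, t i ^ k i := by
  have h1 : (∏ i, MvPolynomial.X i : MvPolynomial (Fin n) ℂ) ∈ (Ideal.span {p}).radical := by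
    rw [← MvPolynomial.vanishingIdeal_zeroLocus_eq_radical (K := ℂ)]
    rw [MvPolynomial.mem_vanishingIdeal_iff]
    intro x hx
    have h2 : MvPolynomial.eval x p = 0 := by
      simpa using hx p (Ideal.mem_span_singleton_self p)
    rw [map_prod, Finset.prod_eq_zero_iff]
    by_contra h
    refine hp x (fun i hi => h ⟨i, Finset.mem_univ i, by simpa using hi⟩) h2
  obtain ⟨N, hN⟩ := h1
  rw [Ideal.mem_span_singleton] at hN
  have h3 : (∏ i, MvPolynomial.X i : MvPolynomial (Fin n) ℂ) ^ N
      = MvPolynomial.monomial (Finsupp.equivFunOnFinite.symm fun _ => N) 1 := by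
    rw [MvPolynomial.monomial_eq, Finsupp.prod_fintype _ _ (by simp)]
    simp [Finset.prod_pow]
  rw [h3, MvPolynomial.dvd_monomial_iff_exists one_ne_zero] at hN
  obtain ⟨m, b, -, -, rfl⟩ := hN
  refine ⟨b, m, fun t => ?_⟩
  rw [MvPolynomial.eval_monomial, Finsupp.prod_fintype _ _ (by simp)]

lemma natDegree_le_of_tendsto {p : Polynomial ℂ} {k : ℕ} {l : ℂ}
    (h : Tendsto (fun u => p.eval u⁻¹ * u ^ k) (𝓝[≠] 0) (𝓝 l)) : p.natDegree ≤ k := by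
  by_contra! hk
  have h1 : Tendsto (fun u : ℂ => u ^ (p.natDegree - k)) (𝓝[≠] 0) (𝓝 0) := by
    have : Continuous fun u : ℂ => u ^ (p.natDegree - k) := by fun_prop
    have h := this.tendsto 0
    rw [zero_pow (by omega)] at h
    exact h.mono_left nhdsWithin_le_nhds
  have h2 := h.mul h1
  have h3 : Tendsto (fun u : ℂ => p.reverse.eval u) (𝓝[≠] 0) (𝓝 (p.reverse.eval 0)) :=
    (p.reverse.continuous.tendsto 0).mono_left nhdsWithin_le_nhds
  have h4 := tendsto_nhds_unique (h3.congr' ?_) h2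
  · rw [mul_zero, ← Polynomial.coeff_zero_eq_eval_zero, Polynomial.coeff_zero_reverse,
      Polynomial.leadingCoeff_eq_zero] at h4
    simp [h4] at hk
  · filter_upwards [self_mem_nhdsWithin] with u hu
    have hu : u ≠ 0 := hu
    have : Invertible u⁻¹ := invertibleOfNonzero (inv_ne_zero hu)
    have h5 := Polynomial.eval₂_reverse_mul_pow (RingHom.id ℂ) u⁻¹ p
    simp only [Polynomial.eval₂_id, invOf_eq_inv, inv_inv] at h5
    rw [← h5, mul_assoc, mul_assoc, ← pow_add, Nat.add_sub_cancel' hk.le, ← mul_pow,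
      inv_mul_cancel₀ hu, one_pow, mul_one]

lemma norm_coeff_one_le {q : Polynomial ℂ} {k : ℕ} (hk : q.natDegree ≤ k) (h0 : q.coeff 0 = 1)
    (hq : ∀ x : ℂ, ‖x‖ < 1 → q.eval x ≠ 0) : ‖q.coeff 1‖ ≤ k := by
  have h1 := (IsAlgClosed.splits q).eval_derivative_div_eval_of_ne_zero (hq 0 (by simp))
  rw [← Polynomial.coeff_zero_eq_eval_zero, ← Polynomial.coeff_zero_eq_eval_zero, h0, div_one,
    Polynomial.coeff_derivative] at h1
  simp only [zero_add, Nat.cast_zero, mul_one] at h1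
  rw [h1]
  refine (norm_multiset_sum_le _).trans ?_
  rw [Multiset.map_map]
  have h2 : ∀ x ∈ q.roots.map (norm ∘ fun z : ℂ => 1 / (0 - z)), x ≤ 1 := by
    intro x hx
    obtain ⟨z, hz, rfl⟩ := Multiset.mem_map.1 hx
    have hz1 : 1 ≤ ‖z‖ := by
      by_contra! h
      exact hq z h (Polynomial.isRoot_of_mem_roots hz)
    simpa using inv_le_one_of_one_le₀ hz1
  refine (Multiset.sum_le_card_nsmul _ _ h2).trans ?_
  rw [Multiset.card_map, nsmul_eq_mul, mul_one]
  exact_mod_cast (Polynomial.card_roots' q).trans hk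

/-- First order expansion of `det (1 - F W)` for a polynomial curve `F` through the origin. -/
lemma exists_polynomial_det {m n : ℕ} {F : ℂ → Matrix (Fin m) (Fin n) ℂ} (hF : EntryMem polyAlg F)
    (h0 : F 0 = 0) {F' : Matrix (Fin m) (Fin n) ℂ}
    (hF' : ∀ i j, HasDerivAt (fun x => F x i j) (F' i j) 0) (W : Matrix (Fin n) (Fin m) ℂ) :
    ∃ q : Polynomial ℂ, (∀ x, (1 - F x * W).det = q.eval x) ∧ q.coeff 0 = 1 ∧
      q.coeff 1 = - trace (F' * W) := by
  choose P hP using hF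
  have h1 : ∀ i j, ∃ Q, P i j = Polynomial.X * Q := by
    intro i j
    rw [← dvd_def, Polynomial.X_dvd_iff, Polynomial.coeff_zero_eq_eval_zero, ← hP]
    simp [h0]
  choose Q hQ using h1
  have h2 : ∀ i j, (Q i j).coeff 0 = F' i j := by
    intro i j
    have h3 : HasDerivAt (fun x => F x i j) ((P i j).derivative.eval 0) 0 := by
      simp only [hP]
      exact (P i j).hasDerivAt 0
    rw [← (h3.unique (hF' i j)), hQ]
    simp [Polynomial.coeff_zero_eq_eval_zero]
  let M : Matrix (Fin m) (Fin m) (Polynomial ℂ) := - (of Q * W.map Polynomial.C)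
  have hM := Matrix.det_one_add_smul (Polynomial.X : Polynomial ℂ) M
  refine ⟨(1 + (Polynomial.X : Polynomial ℂ) • M).det, fun x => ?_, ?_, ?_⟩
  · rw [← Polynomial.coe_evalRingHom, RingHom.map_det]
    congr 1
    ext i j
    simp only [M, Matrix.sub_apply, Matrix.mul_apply, hP, hQ, RingHom.mapMatrix_apply, Matrix.map_apply,
      Matrix.add_apply, Matrix.smul_apply, Matrix.neg_apply, Polynomial.coe_evalRingHom]
    rw [Polynomial.eval_add]
    simp only [smul_eq_mul, Polynomial.eval_mul, Polynomial.eval_X, Polynomial.eval_neg,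
      Polynomial.eval_finsetSum, of_apply, Polynomial.eval_C, Finset.mul_sum, mul_neg,
      mul_assoc, ← sub_eq_add_neg]
    rw [one_apply, one_apply]
    split_ifs <;> simp
  · rw [hM]
    simp [Polynomial.coeff_zero_eq_eval_zero]
  · rw [hM]
    have : ∀ q : Polynomial ℂ, (q * Polynomial.X ^ 2).coeff 1 = 0 := fun q => by
      rw [Polynomial.coeff_mul_X_pow', if_neg (by norm_num)]
    have h5 : (trace M).coeff 0 = - trace (F' * W) := by
      simp [M, trace, Matrix.mul_apply, Polynomial.finsetSum_coeff, h2]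
    rw [Polynomial.coeff_add, this, Polynomial.coeff_add, Polynomial.coeff_mul_X, h5]
    simp [Polynomial.coeff_one]

/-! ### The extremal inequality -/

lemma log_tangent {x y : ℝ} (hx : 0 ≤ x) (hx1 : x < 1) (hy : 0 ≤ y) (hy1 : y < 1) :
    -Real.log (1 - x ^ 2) + 2 * x / (1 - x ^ 2) * (y - x) + (x - y) ^ 2 / (1 - x ^ 2) ≤
      -Real.log (1 - y ^ 2) := by
  have h1 : 0 < 1 - x ^ 2 := by nlinarith
  have h2 : 0 < 1 - y ^ 2 := by nlinarith
  have h3 := Real.log_le_sub_one_of_pos (div_pos h2 h1)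
  rw [Real.log_div h2.ne' h1.ne'] at h3
  have h4 : (1 - y ^ 2) / (1 - x ^ 2) - 1 =
      -(2 * x / (1 - x ^ 2) * (y - x) + (x - y) ^ 2 / (1 - x ^ 2)) := by
    field_simp
    ring
  linarith

lemma extremal_equality {n n' : ℕ} {α : Fin n → ℝ} {β : Fin n' → ℝ} {k : Fin n → ℕ}
    {m : Fin n → Fin n' → ℝ} (hα0 : ∀ i, 0 ≤ α i) (hα1 : ∀ i, α i < 1) (hβ0 : ∀ j, 0 ≤ β j)
    (hβ1 : ∀ j, β j < 1) (hm : ∀ i j, 0 ≤ m i j) (h1 : ∀ i, ∑ j, m i j ≤ k i)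
    (h2 : ∀ j, ∑ i, m i j ≤ 1) (h3 : ∀ i, k i * α i ≤ ∑ j, m i j * β j)
    (h4 : ∏ j, (1 - β j ^ 2) = ∏ i, (1 - α i ^ 2) ^ k i) :
    (∀ i j, m i j ≠ 0 → β j = α i) ∧ (∀ j, 0 < β j → ∑ i, m i j = 1) ∧
      (∀ i, 0 < α i → ∑ j, m i j = k i) ∧ (∀ i, 0 < α i → ∑ j, m i j * β j = k i * α i) := by
  have hα2 : ∀ i, 0 < 1 - α i ^ 2 := fun i => by nlinarith [hα0 i, hα1 i]
  have hβ2 : ∀ j, 0 < 1 - β j ^ 2 := fun j => by nlinarith [hβ0 j, hβ1 j]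
  let φ : ℝ → ℝ := fun x => -Real.log (1 - x ^ 2)
  let c : Fin n → ℝ := fun i => 2 * α i / (1 - α i ^ 2)
  have hc : ∀ i, 0 ≤ c i := fun i => div_nonneg (by linarith [hα0 i]) (hα2 i).le
  have hφβ : ∀ j, β j ^ 2 ≤ φ (β j) := by
    intro j
    have := log_tangent le_rfl one_pos (hβ0 j) (hβ1 j)
    simpa using this
  have hφα : ∀ i, φ (α i) - c i * α i ≤ - α i ^ 2 := by
    intro i
    have h := log_tangent (hα0 i) (hα1 i) le_rfl one_pos
    have h' : α i ^ 2 ≤ α i ^ 2 / (1 - α i ^ 2) :=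
      le_div_self (sq_nonneg _) (hα2 i) (by nlinarith [hα0 i])
    simp only [zero_sub, sub_zero] at h
    norm_num at h
    simp only [φ, c]
    linarith
  have htan : ∀ i j, (α i - β j) ^ 2 ≤ φ (β j) - φ (α i) - c i * (β j - α i) := by
    intro i j
    have h := log_tangent (hα0 i) (hα1 i) (hβ0 j) (hβ1 j)
    have h' : (α i - β j) ^ 2 ≤ (α i - β j) ^ 2 / (1 - α i ^ 2) :=
      le_div_self (sq_nonneg _) (hα2 i) (by nlinarith [hα0 i])
    simp only [φ, c]
    linarith
  have hsum : ∑ j, φ (β j) = ∑ i, k i * φ (α i) := by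
    have := congrArg Real.log h4
    rw [Real.log_prod (fun j _ => (hβ2 j).ne'),
      Real.log_prod (fun i _ => (pow_pos (hα2 i) _).ne')] at this
    simp only [Real.log_pow] at this
    simp only [φ, mul_neg, Finset.sum_neg_distrib, this]
  -- the four nonnegative defects
  have d1 : ∀ j, 0 ≤ φ (β j) * (1 - ∑ i, m i j) := fun j =>
    mul_nonneg ((sq_nonneg _).trans (hφβ j)) (by linarith [h2 j])
  have d2 : ∀ i j, 0 ≤ m i j * (φ (β j) - φ (α i) - c i * (β j - α i)) := fun i j =>
    mul_nonneg (hm i j) ((sq_nonneg _).trans (htan i j))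
  have d3 : ∀ i, 0 ≤ (c i * α i - φ (α i)) * (k i - ∑ j, m i j) := fun i =>
    mul_nonneg (by nlinarith [hφα i, sq_nonneg (α i)]) (by linarith [h1 i])
  have d4 : ∀ i, 0 ≤ c i * (∑ j, m i j * β j - k i * α i) := fun i =>
    mul_nonneg (hc i) (by linarith [h3 i])
  have htot : ∑ j, φ (β j) * (1 - ∑ i, m i j) +
      (∑ i, ∑ j, m i j * (φ (β j) - φ (α i) - c i * (β j - α i)) +
      (∑ i, (c i * α i - φ (α i)) * (k i - ∑ j, m i j) +
      ∑ i, c i * (∑ j, m i j * β j - k i * α i))) = 0 := by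
    have e1 : ∑ j, φ (β j) * (1 - ∑ i, m i j) =
        ∑ j, φ (β j) - ∑ i, ∑ j, m i j * φ (β j) := by
      rw [Finset.sum_comm, ← Finset.sum_sub_distrib]
      refine Finset.sum_congr rfl fun j _ => ?_
      rw [← Finset.sum_mul]
      ring
    rw [e1, hsum, ← Finset.sum_add_distrib, ← Finset.sum_add_distrib, ← Finset.sum_sub_distrib,
      ← Finset.sum_add_distrib]
    refine Finset.sum_eq_zero fun i _ => ?_
    have e2 : ∑ j, m i j * (φ (β j) - φ (α i) - c i * (β j - α i)) =
        ∑ j, m i j * φ (β j) - (∑ j, m i j) * (φ (α i) - c i * α i)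
          - c i * ∑ j, m i j * β j := by
      rw [Finset.sum_mul, Finset.mul_sum, ← Finset.sum_sub_distrib, ← Finset.sum_sub_distrib]
      exact Finset.sum_congr rfl fun j _ => by ring
    rw [e2]
    ring
  have s1 := Finset.sum_nonneg fun j (_ : j ∈ Finset.univ) => d1 j
  have s2 := Finset.sum_nonneg fun i (_ : i ∈ Finset.univ) =>
    Finset.sum_nonneg fun j (_ : j ∈ Finset.univ) => d2 i j
  have s3 := Finset.sum_nonneg fun i (_ : i ∈ Finset.univ) => d3 i
  have s4 := Finset.sum_nonneg fun i (_ : i ∈ Finset.univ) => d4 i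
  have z1 := (Finset.sum_eq_zero_iff_of_nonneg fun j _ => d1 j).1 (by linarith)
  have z2 := (Finset.sum_eq_zero_iff_of_nonneg fun i (_ : i ∈ Finset.univ) =>
    Finset.sum_nonneg fun j (_ : j ∈ Finset.univ) => d2 i j).1 (by linarith)
  have z3 := (Finset.sum_eq_zero_iff_of_nonneg fun i _ => d3 i).1 (by linarith)
  have z4 := (Finset.sum_eq_zero_iff_of_nonneg fun i _ => d4 i).1 (by linarith)
  refine ⟨fun i j hij => ?_, fun j hj => ?_, fun i hi => ?_, fun i hi => ?_⟩
  · have := (Finset.sum_eq_zero_iff_of_nonneg fun j _ => d2 i j).1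
      (z2 i (Finset.mem_univ i)) j (Finset.mem_univ j)
    have h := htan i j
    rw [(mul_eq_zero.1 this).resolve_left hij] at h
    nlinarith [sq_nonneg (α i - β j), pow_eq_zero_iff (two_ne_zero) |>.1
      (le_antisymm h (sq_nonneg (α i - β j)))]
  · have h := (mul_eq_zero.1 (z1 j (Finset.mem_univ j))).resolve_left
      (((pow_pos hj 2).trans_le (hφβ j)).ne')
    linarith
  · have h := (mul_eq_zero.1 (z3 i (Finset.mem_univ i))).resolve_left (by
      have := hφα i
      have := pow_pos hi 2
      linarith)
    linarith
  · have h := (mul_eq_zero.1 (z4 i (Finset.mem_univ i))).resolve_left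
      (div_pos (by linarith) (hα2 i)).ne'
    linarith

end TypeI

namespace TypeI

open Metric Filter Topology

/-- Origin-preserving polynomial maps `f, g` between type I domains, intertwined by the time-one
Möbius transformations along `A` and `B`. -/
structure Intertwined (r s r' s' : ℕ) (A B : ℕ → ℝ)
    (f g : Matrix (Fin r) (Fin s) ℂ → Matrix (Fin r') (Fin s') ℂ) : Prop where
  le : r ≤ s
  le' : r' ≤ s'
  nonneg : ∀ k, 0 ≤ A k
  nonneg' : ∀ k, 0 ≤ B k
  eq_zero : ∀ k, r ≤ k → A k = 0
  eq_zero' : ∀ k, r' ≤ k → B k = 0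
  polyf : IsPolyMapI f
  polyg : IsPolyMapI g
  mapsf : Set.MapsTo f (OmegaI r s) (OmegaI r' s')
  mapsg : Set.MapsTo g (OmegaI r s) (OmegaI r' s')
  f_zero : f 0 = 0
  g_zero : g 0 = 0
  comm : ∀ Z ∈ OmegaI r s, f (mob r s A 1 Z) = mob r' s' B 1 (g Z)

/-- The components of `tanh A`. -/
def th (A : ℕ → ℝ) (k : ℕ) : ℂ := (Real.tanh (A k) : ℝ)

lemma cosh_ofReal_ne_zero (a : ℝ) : Complex.cosh a ≠ 0 := by
  rw [← Complex.ofReal_cosh]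
  exact_mod_cast (Real.cosh_pos _).ne'

lemma th_mul_cosh (A : ℕ → ℝ) (k : ℕ) : th A k * Complex.cosh (A k) = Complex.sinh (A k) := by
  rw [th, Complex.ofReal_tanh, Complex.tanh_eq_sinh_div_cosh,
    div_mul_cancel₀ _ (cosh_ofReal_ne_zero _)]

lemma th_eq_zero_iff {A : ℕ → ℝ} {k : ℕ} : th A k = 0 ↔ A k = 0 := by
  rw [th, Complex.ofReal_eq_zero, Real.tanh_eq_sinh_div_cosh, div_eq_zero_iff, Real.sinh_eq_zero]
  simp [(Real.cosh_pos _).ne']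

lemma norm_th_lt_one (A : ℕ → ℝ) (k : ℕ) : ‖th A k‖ < 1 := by
  rw [th, Complex.norm_real]
  exact Real.abs_tanh_lt_one _

lemma one_sub_th_mul_ne_zero {A : ℕ → ℝ} {k : ℕ} {z : ℂ} (hz : ‖z‖ < 1) : 1 - th A k * z ≠ 0 := by
  intro h
  have h1 : ‖th A k * z‖ < 1 := by
    rw [norm_mul]
    exact mul_lt_one_of_nonneg_of_lt_one_left (norm_nonneg _) (norm_th_lt_one A k) hz.le
  rw [← sub_eq_zero.1 h, norm_one] at h1
  exact lt_irrefl _ h1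

lemma mobN_mul_mob {r s : ℕ} {A : ℕ → ℝ} (hr : ∀ k, r ≤ k → A k = 0) (hs : ∀ k, s ≤ k → A k = 0)
    (t : ℝ) {Z : Matrix (Fin r) (Fin s) ℂ} (hZ : Z ∈ OmegaI r s) :
    mobN r s A t Z * mob r s A t Z = mobM r s A t Z :=
  mul_nonsing_inv_cancel_left _ _ (isUnit_mobN hr hs t hZ)

lemma isPreconnected_forall_ne {n : ℕ} (a : Fin n → ℂ) :
    IsPreconnected {x : ℂ | ∀ i, 1 - a i * x ≠ 0} := by
  have h : {x : ℂ | ∀ i, 1 - a i * x ≠ 0} = (⋃ i, {x : ℂ | 1 - a i * x = 0})ᶜ := by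
    ext x; simp
  rw [h]
  refine (Set.Countable.isPathConnected_compl_of_one_lt_rank (E := ℂ) (by simp)
    (Set.countable_iUnion fun i => Set.Subsingleton.countable ?_)).isConnected.isPreconnected
  intro x hx y hy
  have hx : 1 - a i * x = 0 := hx
  have hy : 1 - a i * y = 0 := hy
  have ha : a i ≠ 0 := by rintro h; simp [h] at hx
  exact mul_left_cancel₀ ha (by linear_combination hy - hx)

lemma isOpen_forall_ne {n : ℕ} (a : Fin n → ℂ) : IsOpen {x : ℂ | ∀ i, 1 - a i * x ≠ 0} := by
  simp only [Set.ofPred_forall]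
  exact isOpen_iInter_of_finite fun i => isOpen_ne_fun (by fun_prop) (by fun_prop)

namespace Intertwined

variable {r s r' s' : ℕ} {A B : ℕ → ℝ}
  {f g : Matrix (Fin r) (Fin s) ℂ → Matrix (Fin r') (Fin s') ℂ}

lemma eq_zero_s (h : Intertwined r s r' s' A B f g) : ∀ k, s ≤ k → A k = 0 :=
  fun k hk => h.eq_zero k (h.le.trans hk)

lemma eq_zero_s' (h : Intertwined r s r' s' A B f g) : ∀ k, s' ≤ k → B k = 0 :=
  fun k hk => h.eq_zero' k (h.le'.trans hk)

lemma neg (h : Intertwined r s r' s' A B f g) :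
    Intertwined r s r' s' A B (fun Z => -g (-Z)) (fun Z => -f (-Z)) where
  le := h.le
  le' := h.le'
  nonneg := h.nonneg
  nonneg' := h.nonneg'
  eq_zero := h.eq_zero
  eq_zero' := h.eq_zero'
  polyf := EntryMem.isPolyMap fun _ hS => (hS.neg.comp_poly h.polyg).neg
  polyg := EntryMem.isPolyMap fun _ hS => (hS.neg.comp_poly h.polyf).neg
  mapsf := fun _ hZ => neg_mem_omega (h.mapsg (neg_mem_omega hZ))
  mapsg := fun _ hZ => neg_mem_omega (h.mapsf (neg_mem_omega hZ))
  f_zero := by simp [h.g_zero]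
  g_zero := by simp [h.f_zero]
  comm := fun Z hZ => by
    have h1 : mob r s A ((-1 : ℝ) : ℂ) (-Z) ∈ OmegaI r s :=
      mob_mem h.eq_zero h.eq_zero_s _ (neg_mem_omega hZ)
    have h2 := h.comm _ h1
    have h3 := mob_mob_neg h.eq_zero h.eq_zero_s 1 (neg_mem_omega hZ)
    have h4 := mob_neg_mob h.eq_zero' h.eq_zero_s' 1 (h.mapsg h1)
    push_cast at h1 h2 h3 h4
    rw [h3] at h2
    rw [← h2] at h4
    have h5 := mob_neg (A := A) (-1) (-Z)
    have h6 := mob_neg (A := B) (-1) (f (-Z))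
    rw [neg_neg] at h5 h6
    rw [neg_neg] at h5
    rw [h5, neg_neg, h6, h4]

/-- The functional equation, continued to the set where the Möbius transformation is defined. -/
lemma functional_eq (h : Intertwined r s r' s' A B f g) (z : ℕ → ℂ)
    (hz : ∀ i : Fin r, 1 - th A i * z i ≠ 0) :
    mobN r' s' B 1 (g (Dg r s fun k => (z k - th A k) / (1 - th A k * z k))) * f (Dg r s z) =
      mobM r' s' B 1 (g (Dg r s fun k => (z k - th A k) / (1 - th A k * z k))) := by
  have key : ∀ z : ℕ → ℂ, (∀ i : Fin r, ‖z i‖ < 1) →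
      mobN r' s' B 1 (g (Dg r s fun k => (z k - th A k) / (1 - th A k * z k))) * f (Dg r s z) =
        mobM r' s' B 1 (g (Dg r s fun k => (z k - th A k) / (1 - th A k * z k))) := by
    intro z hz
    have hZ : Dg r s z ∈ OmegaI r s := Dg_mem_omega fun k hk _ => hz ⟨k, hk⟩
    have h1 : mob r s A (-1) (Dg r s z) =
        Dg r s fun k => (z k - th A k) / (1 - th A k * z k) := by
      have hk : ∀ k, Complex.cosh (-1 * A k) + z k * Complex.sinh (-1 * A k) =
          Complex.cosh (A k) * (1 - th A k * z k) := by
        intro k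
        simp only [neg_mul, one_mul, Complex.cosh_neg, Complex.sinh_neg, ← th_mul_cosh]
        ring
      rw [mob_Dg h.eq_zero_s]
      · refine Dg_congr fun k hkr _ => ?_
        have hnum : Complex.sinh (-1 * A k) + z k * Complex.cosh (-1 * A k) =
            Complex.cosh (A k) * (z k - th A k) := by
          simp only [neg_mul, one_mul, Complex.cosh_neg, Complex.sinh_neg, ← th_mul_cosh]
          ring
        rw [hk, hnum, mul_div_mul_left _ _ (cosh_ofReal_ne_zero (A k))]
      · intro k hkr
        rw [hk]
        exact mul_ne_zero (cosh_ofReal_ne_zero _) (one_sub_th_mul_ne_zero (hz ⟨k, hkr⟩))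
    have h2 : mob r s A ((-1 : ℝ) : ℂ) (Dg r s z) ∈ OmegaI r s :=
      mob_mem h.eq_zero h.eq_zero_s _ hZ
    have h3 := h.comm _ h2
    have h4 := mob_mob_neg h.eq_zero h.eq_zero_s 1 hZ
    have h5 := mobN_mul_mob h.eq_zero' h.eq_zero_s' 1 (h.mapsg h2)
    push_cast at h3 h4 h5
    rw [h1] at h3 h4 h5
    rw [h4] at h3
    rw [h3, h5]
  set U : Set ℂ := {x | ∀ i : Fin r, 1 - (th A i * z i) * x ≠ 0} with hU
  have hUo : IsOpen U := isOpen_forall_ne _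
  have hd : EntryMem (diffAlg U) fun x : ℂ =>
      mobN r' s' B 1 (g (Dg r s fun k => (x * z k - th A k) / (1 - th A k * (x * z k)))) *
        f (Dg r s fun k => x * z k) -
      mobM r' s' B 1 (g (Dg r s fun k => (x * z k - th A k) / (1 - th A k * (x * z k)))) := by
    have h1 : EntryMem (diffAlg U) fun x : ℂ =>
        g (Dg r s fun k => (x * z k - th A k) / (1 - th A k * (x * z k))) := by
      refine EntryMem.comp_poly h.polyg (EntryMem.diag fun k hk _ => ?_)
      rw [mem_diffAlg]
      refine DifferentiableOn.div (by fun_prop) (by fun_prop) fun x hx => ?_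
      have := hx ⟨k, hk⟩
      rwa [mul_assoc, mul_comm (z _)] at this
    have h2 : EntryMem (diffAlg U) fun x : ℂ => f (Dg r s fun k => x * z k) := by
      refine EntryMem.comp_poly h.polyf (EntryMem.diag fun k hk _ => ?_)
      rw [mem_diffAlg]
      fun_prop
    exact (((EntryMem.const _).add (h1.mul (EntryMem.const _))).mul h2).sub
      ((EntryMem.const _).add (h1.mul (EntryMem.const _)))
  have hev : ∀ᶠ x : ℂ in 𝓝 0, ∀ i : Fin r, ‖x * z i‖ < 1 := by
    rw [eventually_all]
    intro i
    have : ContinuousAt (fun x : ℂ => ‖x * z i‖) 0 := by fun_prop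
    exact this.eventually_lt_const (by simp)
  have hU0 : (0 : ℂ) ∈ U := by simp [hU]
  have hU1 : (1 : ℂ) ∈ U := by simpa [hU] using hz
  rw [← sub_eq_zero]
  ext i j
  have h1 := ((mem_diffAlg.1 (hd i j)).analyticOnNhd hUo).eqOn_zero_of_preconnected_of_eventuallyEq_zero
    (isPreconnected_forall_ne _) hU0 (by
      filter_upwards [hev] with x hx
      rw [Pi.zero_apply, key (fun k => x * z k) hx, sub_self, Matrix.zero_apply]) hU1
  simpa using h1

end Intertwined

/-- The diagonal matrix of `tanh B`. -/
def TT (r' s' : ℕ) (B : ℕ → ℝ) : Matrix (Fin s') (Fin r') ℂ := Dg s' r' (th B)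

lemma SS_one_eq (r' s' : ℕ) (B : ℕ → ℝ) : SS s' r' B 1 = TT r' s' B * CC r' B 1 := by
  rw [SS, TT, CC, Dg_mul (by intros; omega)]
  refine Dg_congr fun k _ _ => ?_
  simp [th_mul_cosh]

lemma det_CC_ne_zero (r' : ℕ) (B : ℕ → ℝ) : (CC r' B 1).det ≠ 0 := by
  rw [CC, det_Dg]
  refine Finset.prod_ne_zero_iff.2 fun i _ => ?_
  rw [one_mul]
  exact cosh_ofReal_ne_zero _

section

variable {r' s' : ℕ} {B : ℕ → ℝ} {X Y : Matrix (Fin r') (Fin s') ℂ}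

lemma det_mobN_mul (hs : ∀ k, s' ≤ k → B k = 0) (h : mobN r' s' B 1 Y * X = mobM r' s' B 1 Y) :
    (mobN r' s' B 1 Y).det * ((1 - X * TT r' s' B).det * (CC r' B 1).det) = 1 := by
  have h1 : (1 - X * TT r' s' B) * CC r' B 1 = CC r' B 1 - X * SS s' r' B 1 := by
    rw [Matrix.sub_mul, Matrix.one_mul, Matrix.mul_assoc, ← SS_one_eq]
  rw [← det_mul, ← det_mul, h1, Matrix.mul_sub, ← Matrix.mul_assoc, h, mobN, mobM, Matrix.add_mul,
    Matrix.add_mul, Matrix.mul_assoc, Matrix.mul_assoc, CC_mul_SS, add_sub_add_right_eq_sub,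
    CC_sq_sub hs, det_one]

lemma det_one_sub_mul_eq (hs : ∀ k, s' ≤ k → B k = 0)
    (h : mobN r' s' B 1 Y * X = mobM r' s' B 1 Y) (W : Matrix (Fin s') (Fin r') ℂ) :
    (1 - X * W).det = (1 - X * TT r' s' B).det *
      ((CC r' B 1).det * (mobN r' s' B 1 Y - mobM r' s' B 1 Y * W).det) := by
  have h1 : mobN r' s' B 1 Y - mobM r' s' B 1 Y * W = mobN r' s' B 1 Y * (1 - X * W) := by
    rw [Matrix.mul_sub, Matrix.mul_one, ← Matrix.mul_assoc, h]
  rw [h1, det_mul]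
  have := det_mobN_mul hs h
  linear_combination -(1 - X * W).det * this

end

namespace Intertwined

variable {r s r' s' : ℕ} {A B : ℕ → ℝ}
  {f g : Matrix (Fin r) (Fin s) ℂ → Matrix (Fin r') (Fin s') ℂ}

lemma exists_det_eq_prod (h : Intertwined r s r' s' A B f g) :
    ∃ k : Fin r → ℕ, (∀ i : Fin r, A i = 0 → k i = 0) ∧ ∀ z : ℕ → ℂ, (∀ i, A i = 0 → z i = 0) →
      (1 - f (Dg r s z) * TT r' s' B).det = ∏ i : Fin r, (1 - th A i * z i) ^ k i := by
  have h1 : EntryMem (mvAlg (Fin r)) fun t : Fin r → ℂ =>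
      1 - f (Dg r s fun k => (1 - zext t k) / th A k) * TT r' s' B := by
    refine (EntryMem.const _).sub ((EntryMem.comp_poly h.polyf (EntryMem.diag fun k hk _ => ?_)).mul
      (EntryMem.const _))
    refine ⟨(1 - MvPolynomial.X ⟨k, hk⟩) * MvPolynomial.C (th A k)⁻¹, fun t => ?_⟩
    simp [zext, hk, div_eq_mul_inv]
  obtain ⟨p, hp⟩ := h1.det
  obtain ⟨c, k, hk⟩ := exists_eval_eq_monomial p (fun t ht => by
    rw [← hp]
    refine fun h0 => one_ne_zero (((det_mobN_mul h.eq_zero_s' (h.functional_eq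
      (fun k => (1 - zext t k) / th A k) fun i => ?_)).symm.trans ?_) : (1 : ℂ) = 0)
    · by_cases hA : th A i = 0
      · simp [hA]
      · rw [mul_div_cancel₀ _ hA, sub_sub_cancel, zext_val]
        exact ht i
    · simp only [h0, zero_mul, mul_zero])
  have hc : c = 1 := by
    have h2 := hk 1
    rw [← hp] at h2
    have h3 : (Dg r s fun k => (1 - zext (1 : Fin r → ℂ) k) / th A k) = 0 := by
      rw [← Dg_zero]
      exact Dg_congr fun k hk _ => by simp [zext, hk]
    simp only [h3, h.f_zero] at h2
    simpa using h2.symm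
  refine ⟨fun i => if A i = 0 then 0 else k i, fun i hi => if_pos hi, fun z hz => ?_⟩
  have h2 := hk fun i => 1 - th A i * z i
  rw [← hp, hc, one_mul] at h2
  have h3 : (Dg r s fun k => (1 - zext (fun i : Fin r => 1 - th A i * z i) k) / th A k) =
      Dg r s z := by
    refine Dg_congr fun k hk _ => ?_
    by_cases hA : A k = 0
    · simp [th_eq_zero_iff.2 hA, hz k hA]
    · have : th A k ≠ 0 := fun h => hA (th_eq_zero_iff.1 h)
      simp [zext, hk, this]
  simp only [h3] at h2
  rw [h2]
  refine Finset.prod_congr rfl fun i _ => ?_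
  beta_reduce
  split_ifs with hA
  · simp [th_eq_zero_iff.2 hA]
  · rfl

lemma natDegree_le (h : Intertwined r s r' s' A B f g) {k : Fin r → ℕ}
    (hk : ∀ z : ℕ → ℂ, (∀ i, A i = 0 → z i = 0) →
      (1 - f (Dg r s z) * TT r' s' B).det = ∏ i : Fin r, (1 - th A i * z i) ^ k i)
    {v : ℕ → ℂ} (hv : ∀ i, A i = 0 → v i = 0) {W : Matrix (Fin s') (Fin r') ℂ} {q : Polynomial ℂ}
    (hq : ∀ x, (1 - f (Dg r s (x • v)) * W).det = q.eval x) :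
    q.natDegree ≤ ∑ i : Fin r, if v i = 0 then 0 else k i := by
  have hth : ∀ i, v i ≠ 0 → th A i ≠ 0 := fun i hi h0 => hi (hv i (th_eq_zero_iff.1 h0))
  let w : ℂ → ℕ → ℂ := fun u i =>
    if v i = 0 then - th A i else (v i - th A i * u) / (u - th A i * v i)
  let R : ℂ → ℂ := fun u => (∏ i : Fin r, if v i = 0 then 1 else (u - th A i * v i) ^ k i) *
    ((CC r' B 1).det * (mobN r' s' B 1 (g (Dg r s (w u))) -
      mobM r' s' B 1 (g (Dg r s (w u))) * W).det)
  have hw : EntryMem (contAlg (0 : ℂ)) fun u => g (Dg r s (w u)) := by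
    refine EntryMem.comp_poly h.polyg (EntryMem.diag fun i _ _ => ?_)
    change ContinuousAt (fun u => w u i) 0
    simp only [w]
    split_ifs with hvi
    · exact continuousAt_const
    · refine ContinuousAt.div (by fun_prop) (by fun_prop) ?_
      rw [zero_sub, neg_ne_zero]
      exact mul_ne_zero (hth i hvi) hvi
  have hR : ContinuousAt R 0 := by
    have h1 : ContinuousAt (fun u : ℂ => ∏ i : Fin r,
        if v i = 0 then 1 else (u - th A i * v i) ^ k i) 0 := by
      refine tendsto_finsetProd _ fun i _ => ?_
      split_ifs
      · exact tendsto_const_nhds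
      · exact ContinuousAt.tendsto (by fun_prop)
    have h2 : ContinuousAt (fun u => (mobN r' s' B 1 (g (Dg r s (w u))) -
        mobM r' s' B 1 (g (Dg r s (w u))) * W).det) (0 : ℂ) :=
      EntryMem.det (((EntryMem.const _).add (hw.mul (EntryMem.const _))).sub
        (((EntryMem.const _).add (hw.mul (EntryMem.const _))).mul (EntryMem.const _)))
    exact h1.mul (continuousAt_const.mul h2)
  refine natDegree_le_of_tendsto (l := R 0) ((hR.tendsto.mono_left nhdsWithin_le_nhds).congr' ?_)
  have hev : ∀ᶠ u : ℂ in 𝓝[≠] 0, ∀ i : Fin r, v i ≠ 0 → u - th A i * v i ≠ 0 := by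
    rw [eventually_all]
    intro i
    refine Filter.Eventually.filter_mono nhdsWithin_le_nhds ?_
    by_cases hvi : v i = 0
    · simp [hvi]
    · have : ContinuousAt (fun u : ℂ => u - th A i * v i) 0 := by fun_prop
      filter_upwards [this.eventually_ne (by
        rw [zero_sub, neg_ne_zero]
        exact mul_ne_zero (hth i hvi) hvi)] with u hu _ using hu
  filter_upwards [hev, self_mem_nhdsWithin] with u hu hu0
  have hu0 : u ≠ 0 := hu0
  have hfac : ∀ i : Fin r, (1 - th A i * (u⁻¹ • v) i) * u = u - th A i * v i := by
    intro i
    simp only [Pi.smul_apply, smul_eq_mul]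
    field_simp
  have hfe := h.functional_eq (u⁻¹ • v) fun i h0 => by
    have := hfac i
    rw [h0, zero_mul] at this
    by_cases hvi : v i = 0
    · simp [hvi] at h0
    · exact hu i hvi this.symm
  have hwu : (Dg r s fun k => ((u⁻¹ • v) k - th A k) / (1 - th A k * (u⁻¹ • v) k)) =
      Dg r s (w u) := by
    refine Dg_congr fun i hi _ => ?_
    simp only [w]
    split_ifs with hvi
    · simp [hvi]
    · have h1 := hfac ⟨i, hi⟩
      simp only at h1
      rw [← h1, ← mul_div_mul_right _ _ hu0]
      congr 1
      simp only [Pi.smul_apply, smul_eq_mul]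
      field_simp
  rw [hwu] at hfe
  rw [← hq, det_one_sub_mul_eq h.eq_zero_s' hfe, hk _ (fun i hi => by simp [hv i hi])]
  have hprod : (∏ i : Fin r, (1 - th A i * (u⁻¹ • v) i) ^ k i) *
      u ^ (∑ i : Fin r, if v i = 0 then 0 else k i) =
      ∏ i : Fin r, if v i = 0 then 1 else (u - th A i * v i) ^ k i := by
    rw [← Finset.prod_pow_eq_pow_sum, ← Finset.prod_mul_distrib]
    refine Finset.prod_congr rfl fun i _ => ?_
    split_ifs with hvi
    · simp [hvi]
    · rw [← mul_pow, hfac]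
  simp only [R]
  rw [← hprod]
  ring

end Intertwined

end TypeI

namespace TypeI

open Metric Filter Topology

lemma tanh_nonneg {x : ℝ} (hx : 0 ≤ x) : 0 ≤ Real.tanh x := by
  rw [Real.tanh_eq_sinh_div_cosh]
  exact div_nonneg (Real.sinh_nonneg_iff.2 hx) (Real.cosh_pos x).le

/-- The finite vector `z`, restricted to the support of `A` and extended by zero. -/
def mz {n : ℕ} (A : ℕ → ℝ) (z : Fin n → ℂ) (k : ℕ) : ℂ := if A k = 0 then 0 else zext z k

lemma mz_smul {n : ℕ} (A : ℕ → ℝ) (c : ℂ) (z : Fin n → ℂ) : mz A (c • z) = c • mz A z := by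
  funext k
  simp [mz, zext_smul]

lemma mz_of_eq_zero {n : ℕ} {A : ℕ → ℝ} (z : Fin n → ℂ) {k : ℕ} (hk : A k = 0) : mz A z k = 0 :=
  if_pos hk

lemma norm_mz_lt {n : ℕ} {A : ℕ → ℝ} {z : Fin n → ℂ} (hz : z ∈ ball (0 : Fin n → ℂ) 1)
    {k : ℕ} (hk : k < n) : ‖mz A z k‖ < 1 := by
  rw [mz]
  split_ifs
  · simp
  · rw [zext, dif_pos hk]
    exact (norm_le_pi_norm z _).trans_lt (mem_ball_zero_iff.1 hz)

lemma exists_hasDerivAt_smul {n : ℕ} {h : (Fin n → ℂ) → ℂ} (hd : DifferentiableAt ℂ h 0) :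
    ∃ p : Fin n → ℂ, ∀ z : Fin n → ℂ, HasDerivAt (fun x : ℂ => h (x • z)) (∑ i, p i * z i) 0 := by
  refine ⟨fun i => fderiv ℂ h 0 fun j => if i = j then 1 else 0, fun z => ?_⟩
  have h1 : HasFDerivAt h (fderiv ℂ h 0) ((0 : ℂ) • z) := by
    rw [zero_smul]; exact hd.hasFDerivAt
  have h2 := h1.comp_hasDerivAt (0 : ℂ) (hasDerivAt_smul_self z)
  have h3 : fderiv ℂ h 0 z = ∑ i, z i • fderiv ℂ h 0 fun j => if i = j then 1 else 0 :=
    LinearMap.pi_apply_eq_sum_univ (fderiv ℂ h 0).toLinearMap z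
  have h4 : ∑ i, (fderiv ℂ h 0 fun j => if i = j then 1 else 0) * z i = fderiv ℂ h 0 z := by
    rw [h3]
    exact Finset.sum_congr rfl fun i _ => mul_comm _ _
  rw [h4]
  exact h2

lemma nsq_conj_Dg_le {r s : ℕ} {u : ℕ → ℂ} (hu : ∀ k, ‖u k‖ ≤ 1) (x : Fin r → ℂ) :
    nsq ((Dg r s u)ᴴ *ᵥ x) ≤ nsq x := by
  have h1 : ∀ c : ℝ, 0 < c → c < 1 → c ^ 2 * nsq ((Dg r s u)ᴴ *ᵥ x) ≤ nsq x := by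
    intro c hc0 hc1
    have h2 : (c : ℂ) • Dg r s u ∈ OmegaI r s := by
      rw [Dg_smul]
      refine Dg_mem_omega fun k _ _ => ?_
      rw [Pi.smul_apply, norm_smul, Complex.norm_real, Real.norm_of_nonneg hc0.le]
      nlinarith [hu k, norm_nonneg (u k)]
    have h3 := nsq_conj_mulVec_le h2 x
    rwa [conjTranspose_smul, smul_mulVec, nsq_smul, norm_star, Complex.norm_real,
      Real.norm_of_nonneg hc0.le] at h3
  have h2 : Tendsto (fun c : ℝ => c ^ 2 * nsq ((Dg r s u)ᴴ *ᵥ x)) (𝓝[<] 1)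
      (𝓝 (1 ^ 2 * nsq ((Dg r s u)ᴴ *ᵥ x))) :=
    ((continuous_id.pow 2).mul continuous_const).continuousAt.tendsto.mono_left nhdsWithin_le_nhds
  rw [one_pow, one_mul] at h2
  refine le_of_tendsto h2 ?_
  filter_upwards [Ioo_mem_nhdsLT (show (0 : ℝ) < 1 by norm_num)] with c hc using h1 c hc.1 hc.2

lemma trace_mul_Dg {m n : ℕ} (hmn : m ≤ n) (M : Matrix (Fin m) (Fin n) ℂ) (w : ℕ → ℂ) :
    trace (M * Dg n m w) = ∑ j, M j (Fin.castLE hmn j) * w j := by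
  refine Finset.sum_congr rfl fun j _ => ?_
  rw [diag_apply, Matrix.mul_apply, Finset.sum_eq_single (Fin.castLE hmn j)]
  · simp [Dg_apply]
  · intro b _ hb
    rw [Dg_apply, if_neg, mul_zero]
    exact fun h => hb (Fin.ext h)
  · simp

/-- The conjugate phase of a complex number. -/
def phase (z : ℂ) : ℂ := if z = 0 then 0 else star z / ‖z‖

lemma mul_phase (z : ℂ) : z * phase z = (‖z‖ : ℝ) := by
  rw [phase]
  split_ifs with h
  · simp [h]
  · have h1 : (‖z‖ : ℂ) ≠ 0 := by simpa using h
    rw [mul_div_assoc', div_eq_iff h1]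
    simp only [Complex.star_def, Complex.mul_conj, Complex.normSq_eq_norm_sq]
    push_cast
    ring

lemma norm_phase_le (z : ℂ) : ‖phase z‖ ≤ 1 := by
  rw [phase]
  split_ifs with h
  · simp
  · rw [norm_div, norm_star, Complex.norm_real, norm_norm]
    exact div_self_le_one _

namespace Intertwined

variable {r s r' s' : ℕ} {A B : ℕ → ℝ}
  {f g : Matrix (Fin r) (Fin s) ℂ → Matrix (Fin r') (Fin s') ℂ}

lemma entryMem_mz {S : Subalgebra ℂ ((Fin r → ℂ) → ℂ)} (h : Intertwined r s r' s' A B f g)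
    (hS : ∀ i, (fun z : Fin r → ℂ => z i) ∈ S) :
    EntryMem S fun z : Fin r → ℂ => f (Dg r s (mz A z)) := by
  refine EntryMem.comp_poly h.polyf (EntryMem.diag fun k hk _ => ?_)
  by_cases hA : A k = 0
  · simp only [mz, hA, if_true]
    exact S.zero_mem
  · simp only [mz, hA, if_false, zext, hk, dif_pos]
    exact hS _

lemma mapsTo_mz (h : Intertwined r s r' s' A B f g) :
    Set.MapsTo (fun z : Fin r → ℂ => f (Dg r s (mz A z))) (ball 0 1) (OmegaI r' s') :=
  fun _ hz => h.mapsf (Dg_mem_omega fun _ hk _ => norm_mz_lt hz hk)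

lemma entryMem_smul (h : Intertwined r s r' s' A B f g) (v : ℕ → ℂ) :
    EntryMem polyAlg fun x : ℂ => f (Dg r s (x • v)) := by
  refine EntryMem.comp_poly h.polyf (EntryMem.diag fun k _ _ => ⟨Polynomial.X * Polynomial.C (v k),
    fun x => by
      rw [Polynomial.eval_mul, Polynomial.eval_X, Polynomial.eval_C]
      rfl⟩)

lemma apply_th (h : Intertwined r s r' s' A B f g) : f (Dg r s (th A)) = Dg r' s' (th B) := by
  have h1 := h.functional_eq (th A) fun i => one_sub_th_mul_ne_zero (norm_th_lt_one A i)
  have h2 : (Dg r s fun k => (th A k - th A k) / (1 - th A k * th A k)) = 0 := by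
    rw [← Dg_zero]
    exact Dg_congr fun k _ _ => by simp
  rw [h2, h.g_zero, mobN, mobM, Matrix.zero_mul, Matrix.zero_mul, add_zero, add_zero] at h1
  have h3 : SS r' s' B 1 = CC r' B 1 * Dg r' s' (th B) := by
    rw [SS, CC, Dg_mul (by intros; omega)]
    refine Dg_congr fun k _ _ => ?_
    simp [← th_mul_cosh, mul_comm]
  rw [h3] at h1
  have h4 : IsUnit (CC r' B 1).det := (det_CC_ne_zero r' B).isUnit
  rw [← Matrix.nonsing_inv_mul_cancel_left _ (f _) h4, h1, Matrix.nonsing_inv_mul_cancel_left _ _ h4]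

lemma prod_tanh (h : Intertwined r s r' s' A B f g) {k : Fin r → ℕ}
    (hk : ∀ z : ℕ → ℂ, (∀ i, A i = 0 → z i = 0) →
      (1 - f (Dg r s z) * TT r' s' B).det = ∏ i : Fin r, (1 - th A i * z i) ^ k i) :
    ∏ j : Fin r', (1 - Real.tanh (B j) ^ 2) = ∏ i : Fin r, (1 - Real.tanh (A i) ^ 2) ^ k i := by
  have h1 := hk (th A) fun i hi => th_eq_zero_iff.2 hi
  rw [h.apply_th, TT, Dg_mul (by intro k hk _ hk'; have := h.le'; omega), ← Dg_one, Dg_sub, det_Dg]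
    at h1
  have h2 : ((∏ j : Fin r', (1 - Real.tanh (B j) ^ 2) : ℝ) : ℂ) =
      ((∏ i : Fin r, (1 - Real.tanh (A i) ^ 2) ^ k i : ℝ) : ℂ) := by
    simp only [Pi.sub_apply, Pi.mul_apply, Pi.one_apply, th] at h1
    push_cast at h1 ⊢
    simpa only [sq] using h1
  exact_mod_cast h2

lemma exists_first_order (h : Intertwined r s r' s' A B f g) {k : Fin r → ℕ}
    (hk0 : ∀ i : Fin r, A i = 0 → k i = 0)
    (hk : ∀ z : ℕ → ℂ, (∀ i, A i = 0 → z i = 0) →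
      (1 - f (Dg r s z) * TT r' s' B).det = ∏ i : Fin r, (1 - th A i * z i) ^ k i) :
    ∃ p : Fin r → Fin r' → ℂ,
      (∀ j (z : Fin r → ℂ), HasDerivAt
        (fun x : ℂ => f (Dg r s (mz A (x • z))) j (Fin.castLE h.le' j)) (∑ i, p i j * z i) 0) ∧
      (∀ i j, p i j ≠ 0 → B j = A i) ∧ (∀ j : Fin r', B j ≠ 0 → ∑ i, p i j = 1) ∧
      ∑ i, k i = (Finset.univ.filter fun j : Fin r' => B j ≠ 0).card := by
  have hFd : EntryMem (diffAlg Set.univ) fun z : Fin r → ℂ => f (Dg r s (mz A z)) :=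
    h.entryMem_mz fun i => by rw [mem_diffAlg]; fun_prop
  have hFd' : ∀ a b, Differentiable ℂ fun z : Fin r → ℂ => f (Dg r s (mz A z)) a b :=
    fun a b => differentiableOn_univ.1 (mem_diffAlg.1 (hFd a b))
  choose P hP using fun a b => exists_hasDerivAt_smul (hFd' a b 0)
  set p : Fin r → Fin r' → ℂ := fun i j => P j (Fin.castLE h.le' j) i with hp
  have hpd : ∀ j (z : Fin r → ℂ), HasDerivAt
      (fun x : ℂ => f (Dg r s (mz A (x • z))) j (Fin.castLE h.le' j)) (∑ i, p i j * z i) 0 :=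
    fun j z => hP j (Fin.castLE h.le' j) z
  have hp0 : ∀ (i : Fin r) j, A i = 0 → p i j = 0 := by
    intro i j hi
    have h1 := hpd j (Pi.single i 1)
    have h2 : ∀ x : ℂ, mz A (x • (Pi.single i 1 : Fin r → ℂ)) = mz A (0 : Fin r → ℂ) := by
      intro x
      funext l
      simp only [mz]
      split_ifs with hl
      · rfl
      · simp only [zext]
        split_ifs with hlr
        · have : (⟨l, hlr⟩ : Fin r) ≠ i := by rintro rfl; exact hl hi
          simp [this]
        · rfl
    simp only [h2] at h1
    have h3 := h1.unique (hasDerivAt_const _ _)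
    simpa [Pi.single_apply] using h3
  -- the determinants of the pencils along the coordinate directions
  have hdet : ∀ (i : Fin r) (w : ℕ → ℂ), ∃ q : Polynomial ℂ,
      (∀ x : ℂ, (1 - f (Dg r s (x • mz A (Pi.single i 1 : Fin r → ℂ))) * Dg s' r' w).det
        = q.eval x) ∧ q.coeff 0 = 1 ∧ q.coeff 1 = - ∑ j, p i j * w j := by
    intro i w
    obtain ⟨q, hq1, hq2, hq3⟩ := exists_polynomial_det (F' := of fun a b => P a b i)
      (h.entryMem_smul (mz A (Pi.single i 1 : Fin r → ℂ)))
      (by rw [zero_smul, Dg_zero, h.f_zero]) (fun a b => by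
        have h1 := hP a b (Pi.single i 1)
        simp only [mz_smul] at h1
        simpa [Pi.single_apply] using h1) (Dg s' r' w)
    exact ⟨q, hq1, hq2, by rw [hq3, trace_mul_Dg h.le']; rfl⟩
  have hdeg : ∀ (i : Fin r), A i ≠ 0 → ∀ (w : ℕ → ℂ) (q : Polynomial ℂ),
      (∀ x : ℂ, (1 - f (Dg r s (x • mz A (Pi.single i 1 : Fin r → ℂ))) * Dg s' r' w).det
        = q.eval x) → q.natDegree ≤ k i := by
    intro i hi w q hq
    refine (h.natDegree_le hk (fun l hl => mz_of_eq_zero _ hl) hq).trans ?_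
    rw [Finset.sum_eq_single i]
    · split_ifs <;> simp
    · intro l _ hl
      rw [if_pos]
      rw [mz, zext_val, Pi.single_eq_of_ne hl, ite_self]
    · simp
  have hm1 : ∀ i, ∑ j, ‖p i j‖ ≤ k i := by
    intro i
    by_cases hi : A i = 0
    · simp [hp0 i _ hi]
    obtain ⟨q, hq1, hq2, hq3⟩ := hdet i (zext fun j => phase (p i j))
    have h1 := norm_coeff_one_le (hdeg i hi _ q hq1) hq2 fun x hx => by
      rw [← hq1]
      have h2 : Dg s' r' (zext fun j => phase (p i j)) =
          (Dg r' s' (star (zext fun j => phase (p i j))))ᴴ := by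
        rw [Dg_conjTranspose, star_star]
      rw [h2, ← mz_smul]
      refine det_one_sub_ne_zero (h.mapsTo_mz ?_) fun y => nsq_conj_Dg_le (fun l => ?_) y
      · rw [mem_ball_zero_iff, norm_smul]
        refine mul_lt_one_of_nonneg_of_lt_one_left (norm_nonneg _) hx ?_
        rw [Pi.norm_single, norm_one]
      · rw [Pi.star_apply, norm_star, zext]
        split_ifs
        · exact norm_phase_le _
        · simp
    rw [hq3, norm_neg] at h1
    simp only [zext_val, mul_phase] at h1
    rwa [← Complex.ofReal_sum, Complex.norm_real,
      Real.norm_of_nonneg (Finset.sum_nonneg fun _ _ => norm_nonneg _)] at h1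
  have hm2 : ∀ j, ∑ i, ‖p i j‖ ≤ 1 := by
    intro j
    have hε : ‖fun i => phase (p i j)‖ ≤ 1 :=
      (pi_norm_le_iff_of_nonneg zero_le_one).2 fun i => norm_phase_le _
    have h1 : ‖deriv (fun x : ℂ => f (Dg r s (mz A (x • fun i => phase (p i j)))) j
        (Fin.castLE h.le' j)) 0‖ ≤ 1 := by
      refine Complex.norm_deriv_le_one_of_mapsTo_ball (R := 1) ?_ ?_ one_pos
      · have h2 : Differentiable ℂ fun x : ℂ => x • fun i => phase (p i j) := by fun_prop
        exact ((hFd' _ _).comp h2).differentiableOn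
      · intro x hx
        have h3 : (fun l => mz A (0 • fun i => phase (p i j) : Fin r → ℂ) l) = 0 := by
          funext l; simp [mz, zext]
        have h4 : f (Dg r s (mz A ((0 : ℂ) • fun i => phase (p i j) : Fin r → ℂ))) = 0 := by
          rw [mz_smul, zero_smul, Dg_zero, h.f_zero]
        rw [h4, Matrix.zero_apply, mem_closedBall_zero_iff]
        refine (entry_lt (h.mapsTo_mz ?_) _ _).le
        rw [mem_ball_zero_iff] at hx ⊢
        rw [norm_smul]
        exact mul_lt_one_of_nonneg_of_lt_one_left (norm_nonneg _) hx hε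
    rw [(hpd j _).deriv] at h1
    simp only [mul_phase] at h1
    rwa [← Complex.ofReal_sum, Complex.norm_real,
      Real.norm_of_nonneg (Finset.sum_nonneg fun _ _ => norm_nonneg _)] at h1
  have hm3 : ∀ i, ∑ j, p i j * th B j = k i * th A i := by
    intro i
    by_cases hi : A i = 0
    · simp [hp0 i _ hi, hk0 i hi]
    obtain ⟨q, hq1, hq2, hq3⟩ := hdet i (th B)
    have h1 : ∀ x : ℂ, q.eval x = (1 - th A i * x) ^ k i := by
      intro x
      rw [← hq1]
      refine (hk _ fun l hl => by simp [mz_of_eq_zero _ hl]).trans ?_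
      rw [Finset.prod_eq_single i]
      · simp [mz, hi, zext_val]
      · intro l _ hl
        simp [mz, zext_val, Pi.single_eq_of_ne hl]
      · simp
    have h2 : HasDerivAt (fun x => q.eval x) (q.derivative.eval 0) 0 := q.hasDerivAt 0
    simp only [h1] at h2
    have h3 : HasDerivAt (fun x : ℂ => (1 - th A i * x) ^ k i)
        (k i * (1 - th A i * 0) ^ (k i - 1) * (-(th A i * 1))) 0 :=
      (((hasDerivAt_id (0 : ℂ)).const_mul (th A i)).const_sub 1).pow (k i)
    have h4 := h2.unique h3
    rw [← Polynomial.coeff_zero_eq_eval_zero, Polynomial.coeff_derivative, zero_add, hq3] at h4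
    simp at h4
    linear_combination h4
  have hβ : ∀ j : Fin r', 0 ≤ Real.tanh (B j) := fun j => tanh_nonneg (h.nonneg' _)
  have hα : ∀ i : Fin r, 0 ≤ Real.tanh (A i) := fun i => tanh_nonneg (h.nonneg _)
  have hpos : ∀ {x : ℝ}, 0 ≤ x → x ≠ 0 → 0 < Real.tanh x := fun {x} hx hx0 => by
    rw [Real.tanh_eq_sinh_div_cosh]
    exact div_pos (Real.sinh_pos_iff.2 (hx.lt_of_ne' hx0)) (Real.cosh_pos x)
  obtain ⟨c1, c2, c3, c4⟩ := extremal_equality (m := fun i j => ‖p i j‖) hα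
    (fun i => Real.tanh_lt_one _) hβ (fun i => Real.tanh_lt_one _) (fun _ _ => norm_nonneg _) hm1 hm2
    (fun i => by
      have h1 := norm_sum_le Finset.univ fun j => p i j * th B j
      rw [hm3 i] at h1
      simpa [th, -Complex.ofReal_tanh, abs_of_nonneg (hβ _), abs_of_nonneg (hα _)] using h1)
    (h.prod_tanh hk)
  have hAB : ∀ i j, p i j ≠ 0 → B j = A i := fun i j hij =>
    Real.tanh_injective (c1 i j (norm_ne_zero_iff.2 hij))
  refine ⟨p, hpd, hAB, fun j hj => ?_, ?_⟩
  · have hpj : ∀ i, p i j = (‖p i j‖ : ℝ) := by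
      intro i
      by_cases hi : A i = 0
      · simp [hp0 i _ hi]
      have h1 : ∑ l, (‖p i l‖ - (p i l).re) * Real.tanh (B l) = 0 := by
        have h2 := congrArg Complex.re (hm3 i)
        have h3 := c4 i (hpos (h.nonneg _) hi)
        simp only [Complex.re_sum, th, Complex.re_mul_ofReal, ← Complex.ofReal_natCast,
          ← Complex.ofReal_mul, Complex.ofReal_re] at h2
        simp only [sub_mul, Finset.sum_sub_distrib]
        rw [h2, h3, sub_self]
      rw [Finset.sum_eq_zero_iff_of_nonneg fun l _ =>
        mul_nonneg (sub_nonneg.2 (Complex.re_le_norm _)) (hβ l)] at h1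
      have h2 := (mul_eq_zero.1 (h1 j (Finset.mem_univ j))).resolve_right
        (hpos (h.nonneg' _) hj).ne'
      have h3 := Complex.re_eq_norm.1 (sub_eq_zero.1 h2).symm
      exact (Complex.norm_of_nonneg' h3).symm
    have h1 := c2 j (hpos (h.nonneg' _) hj)
    rw [Finset.sum_congr rfl fun i _ => hpj i, ← Complex.ofReal_sum, h1, Complex.ofReal_one]
  · have h1 : ∀ i, (k i : ℝ) = ∑ j, ‖p i j‖ := by
      intro i
      by_cases hi : A i = 0
      · simp [hp0 i _ hi, hk0 i hi]
      · exact (c3 i (hpos (h.nonneg _) hi)).symm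
    have h2 : ∀ j : Fin r', ∑ i, ‖p i j‖ = if B j ≠ 0 then 1 else 0 := by
      intro j
      split_ifs with hj
      · exact c2 j (hpos (h.nonneg' _) hj)
      · refine Finset.sum_eq_zero fun i _ => ?_
        by_contra hij
        have hij := norm_ne_zero_iff.1 hij
        exact hij (hp0 i j (by rw [← hAB i j hij]; exact not_not.1 hj))
    have h3 : ((∑ i, k i : ℕ) : ℝ) =
        ((Finset.univ.filter fun j : Fin r' => B j ≠ 0).card : ℝ) := by
      push_cast
      rw [Finset.sum_congr rfl fun i _ => h1 i, Finset.sum_comm,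
        Finset.sum_congr rfl fun j _ => h2 j, Finset.sum_boole]
    exact_mod_cast h3

end Intertwined

end TypeI

namespace TypeI

open Metric Filter Topology

lemma eq_zero_of_mem_polyAlg {h : ℂ → ℂ} (hh : h ∈ polyAlg) (h0 : ∀ᶠ x in 𝓝 0, h x = 0) (x : ℂ) :
    h x = 0 := by
  obtain ⟨p, hp⟩ := hh
  have h1 : AnalyticOnNhd ℂ (fun x => p.eval x) Set.univ :=
    fun x _ => p.differentiable.analyticAt x
  have h2 := h1.eqOn_zero_of_preconnected_of_eventuallyEq_zero isPreconnected_univ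
    (Set.mem_univ 0) (by filter_upwards [h0] with y hy; rw [← hp, hy, Pi.zero_apply])
  rw [hp]
  exact h2 (Set.mem_univ x)

/-- The determinant of a diagonal matrix with one column changed. -/
lemma det_updateCol_diagonal {n : ℕ} (d b : Fin n → ℂ) (m : Fin n) :
    ((diagonal d).updateCol m b).det = (∏ j ∈ Finset.univ.erase m, d j) * b m := by
  rw [← cramer_apply, cramer_eq_adjugate_mulVec, adjugate_diagonal, mulVec_diagonal]

lemma natDegree_one_sub (c : ℂ) :
    (1 - Polynomial.C c * Polynomial.X : Polynomial ℂ).natDegree = if c = 0 then 0 else 1 := by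
  split_ifs with hc
  · simp [hc]
  · rw [Polynomial.natDegree_sub_eq_right_of_natDegree_lt]
    · exact Polynomial.natDegree_C_mul_X c hc
    · rw [Polynomial.natDegree_C_mul_X c hc, Polynomial.natDegree_one]
      exact one_pos

lemma one_sub_C_mul_X_ne_zero (c : ℂ) : (1 - Polynomial.C c * Polynomial.X : Polynomial ℂ) ≠ 0 := by
  intro h
  simpa using congrArg (Polynomial.eval 0) h

namespace Intertwined

variable {r s r' s' : ℕ} {A B : ℕ → ℝ}
  {f g : Matrix (Fin r) (Fin s) ℂ → Matrix (Fin r') (Fin s') ℂ}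

lemma apply_smul_row_col (h : Intertwined r s r' s' A B f g) {φ : ℝ → ℂ} (hφ0 : φ 0 = 0)
    {p : Fin r → Fin r' → ℂ}
    (hp : ∀ j (z : Fin r → ℂ), HasDerivAt
        (fun x : ℂ => f (Dg r s (mz A (x • z))) j (Fin.castLE h.le' j)) (∑ i, p i j * z i) 0)
    (hAB : ∀ i j, p i j ≠ 0 → B j = A i) {j : Fin r'} (hj : ∑ i, p i j = 1) (x : ℂ) :
    (∀ b, f (Dg r s (x • fun k => φ (A k))) j b =
      if b = Fin.castLE h.le' j then x * φ (B j) else 0) ∧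
    (∀ a, f (Dg r s (x • fun k => φ (A k))) a (Fin.castLE h.le' j) =
      if a = j then x * φ (B j) else 0) := by
  have hev : ∀ᶠ x : ℂ in 𝓝 0, (x • fun i : Fin r => φ (A i)) ∈ ball (0 : Fin r → ℂ) 1 := by
    have : ContinuousAt (fun x : ℂ => x • fun i : Fin r => φ (A i)) 0 := by fun_prop
    exact this.eventually_mem (by rw [zero_smul]; exact ball_mem_nhds _ one_pos)
  have hmz : ∀ x : ℂ, f (Dg r s (mz A (x • fun i : Fin r => φ (A i)))) =
      f (Dg r s (x • fun k => φ (A k))) := by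
    intro x
    congr 1
    refine Dg_congr fun k hk _ => ?_
    rw [mz_smul, Pi.smul_apply, Pi.smul_apply, mz, zext, dif_pos hk]
    split_ifs with hA
    · rw [hA, hφ0]
    · rfl
  have key : ∀ᶠ x : ℂ in 𝓝 0, (∀ b, f (Dg r s (x • fun k => φ (A k))) j b =
        if b = Fin.castLE h.le' j then x * φ (B j) else 0) ∧
      (∀ a, f (Dg r s (x • fun k => φ (A k))) a (Fin.castLE h.le' j) =
        if a = j then x * φ (B j) else 0) := by
    filter_upwards [hev] with x hx
    have h1 := schwarz_polydisc (F := fun z : Fin r → ℂ => f (Dg r s (mz A z)))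
      (h.entryMem_mz fun i => by rw [mem_diffAlg]; fun_prop) h.mapsTo_mz (by
        have : mz A (0 : Fin r → ℂ) = 0 := by funext k; simp [mz, zext]
        simp only [this, Dg_zero, h.f_zero]) hj (hp j) hx (μ := x * φ (B j)) fun i hi => by
          rw [Pi.smul_apply, hAB i j hi, smul_eq_mul]
    simpa only [hmz] using h1
  have hlin : ∀ c : ℂ, (fun x : ℂ => x * c) ∈ polyAlg := fun c =>
    ⟨Polynomial.X * Polynomial.C c, fun x => by
      rw [Polynomial.eval_mul, Polynomial.eval_X, Polynomial.eval_C]⟩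
  have hite : ∀ (P : Prop) [Decidable P],
      (fun x : ℂ => if P then x * φ (B j) else 0) ∈ polyAlg := by
    intro P _
    split_ifs
    · exact hlin _
    · exact polyAlg.zero_mem
  refine ⟨fun b => sub_eq_zero.1 (eq_zero_of_mem_polyAlg (polyAlg.sub_mem
    (h.entryMem_smul (fun k => φ (A k)) j b) (hite (b = Fin.castLE h.le' j))) ?_ x),
    fun a => sub_eq_zero.1 (eq_zero_of_mem_polyAlg (polyAlg.sub_mem
    (h.entryMem_smul (fun k => φ (A k)) a (Fin.castLE h.le' j)) (hite (a = j))) ?_ x)⟩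
  · filter_upwards [key] with y hy using sub_eq_zero.2 (hy.1 b)
  · filter_upwards [key] with y hy using sub_eq_zero.2 (hy.2 a)

lemma apply_spectral (h : Intertwined r s r' s' A B f g) {φ : ℝ → ℂ} (hφ0 : φ 0 = 0)
    (hφ : ∀ i : Fin r, A i ≠ 0 → φ (A i) ≠ 0) :
    f (Dg r s fun k => φ (A k)) = Dg r' s' fun k => φ (B k) := by
  obtain ⟨k, hk0, hk⟩ := h.exists_det_eq_prod
  obtain ⟨p, hp, hAB, hp1, hcard⟩ := h.exists_first_order hk0 hk
  have hrc := fun (j : Fin r') (hj : B j ≠ 0) => h.apply_smul_row_col hφ0 hp hAB (hp1 j hj)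
  have hφB : ∀ j : Fin r', B j ≠ 0 → φ (B j) ≠ 0 := by
    intro j hj
    obtain ⟨i, hi⟩ : ∃ i, p i j ≠ 0 := by
      by_contra! hc
      simpa [hc] using hp1 j hj
    rw [hAB i j hi] at hj ⊢
    exact hφ i hj
  have hzero : ∀ (m : Fin r') (n : Fin s'), B m = 0 → B n = 0 → ∀ x : ℂ,
      f (Dg r s (x • fun k => φ (A k))) m n = 0 := by
    intro m n hm hn
    obtain ⟨Q, hQ⟩ := h.entryMem_smul (fun k => φ (A k)) m n
    replace hQ : ∀ x : ℂ, f (Dg r s (x • fun k => φ (A k))) m n = Q.eval x := hQ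
    have hdet : ∀ x : ℂ, (1 - f (Dg r s (x • fun k => φ (A k))) *
        (Dg s' r' (fun k => if B k = 0 then 0 else 1) + Matrix.single n m 1)).det =
        ((∏ j : Fin r', (1 - Polynomial.C (φ (B j)) * Polynomial.X)) * (1 - Q)).eval x := by
      intro x
      have h1 : 1 - f (Dg r s (x • fun k => φ (A k))) *
          (Dg s' r' (fun k => if B k = 0 then 0 else 1) + Matrix.single n m 1) =
          (diagonal fun j : Fin r' => 1 - φ (B j) * x).updateCol m
            fun a => (if a = m then 1 else 0) - f (Dg r s (x • fun k => φ (A k))) a n := by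
        ext a a'
        have h2 : (f (Dg r s (x • fun k => φ (A k))) *
            Dg s' r' (fun k => if B k = 0 then 0 else 1)) a a' =
            f (Dg r s (x • fun k => φ (A k))) a (Fin.castLE h.le' a') *
              if B a' = 0 then 0 else 1 := by
          rw [Matrix.mul_apply, Finset.sum_eq_single (Fin.castLE h.le' a')]
          · simp [Dg_apply]
          · intro b _ hb
            rw [Dg_apply, if_neg, mul_zero]
            exact fun hc => hb (Fin.ext hc)
          · simp
        rw [Matrix.mul_add, Matrix.sub_apply, Matrix.add_apply, h2, Matrix.one_apply]
        by_cases ham : a' = m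
        · subst ham
          rw [updateCol_self, if_pos hm, mul_zero, zero_add, Matrix.mul_single_apply_same, mul_one]
        · rw [updateCol_ne ham, Matrix.mul_single_apply_of_ne _ _ _ _ _ ham, add_zero,
            diagonal_apply]
          by_cases hB : B a' = 0
          · simp only [hB, if_true, mul_zero, sub_zero]
            split_ifs with haa
            · rw [haa, hB, hφ0, zero_mul, sub_zero]
            · rfl
          · rw [(hrc a' hB x).2 a, if_neg hB, mul_one]
            split_ifs with haa
            · rw [haa, mul_comm]
            · rw [sub_zero]
      have hE : (1 - Q).eval x = 1 - f (Dg r s (x • fun k => φ (A k))) m n := by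
        rw [Polynomial.eval_sub, Polynomial.eval_one, hQ]
      rw [h1, det_updateCol_diagonal, if_pos rfl, Polynomial.eval_mul, hE, Polynomial.eval_prod,
        ← Finset.mul_prod_erase _ _ (Finset.mem_univ m)]
      simp [hm, hφ0]
    have hQ1 : (1 - Q) ≠ 0 := by
      intro h0
      have h1 := congrArg (Polynomial.eval 0) h0
      rw [Polynomial.eval_sub, ← hQ, zero_smul, Dg_zero, h.f_zero] at h1
      simp at h1
    have h1 := h.natDegree_le hk (v := fun k => φ (A k)) (fun i hi => by simp only [hi, hφ0]) hdet
    have h2 : (∑ i : Fin r, if φ (A i) = 0 then 0 else k i) ≤ ∑ i, k i :=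
      Finset.sum_le_sum fun i _ => by split_ifs <;> simp
    rw [Polynomial.natDegree_mul (Finset.prod_ne_zero_iff.2 fun j _ => one_sub_C_mul_X_ne_zero _) hQ1,
      Polynomial.natDegree_prod _ _ fun j _ => one_sub_C_mul_X_ne_zero _] at h1
    have h3 : ∑ j : Fin r', (1 - Polynomial.C (φ (B j)) * Polynomial.X : Polynomial ℂ).natDegree =
        (Finset.univ.filter fun j : Fin r' => B j ≠ 0).card := by
      rw [Finset.card_filter]
      refine Finset.sum_congr rfl fun j _ => ?_
      rw [natDegree_one_sub]
      by_cases hj : B j = 0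
      · simp [hj, hφ0]
      · simp [hj, hφB j hj]
    have h4 : (1 - Q).natDegree = 0 := by omega
    intro x
    rw [hQ]
    have h5 := Polynomial.eq_C_of_natDegree_eq_zero h4
    have h6 := congrArg (Polynomial.eval x) h5
    have h7 := congrArg (Polynomial.eval 0) h5
    have h8 : Q.eval 0 = 0 := by rw [← hQ, zero_smul, Dg_zero, h.f_zero, Matrix.zero_apply]
    simp only [Polynomial.eval_sub, Polynomial.eval_one, Polynomial.eval_C, h8] at h6 h7
    linear_combination h7 - h6
  ext a b
  have hone : (fun k => φ (A k)) = (1 : ℂ) • fun k => φ (A k) := by rw [one_smul]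
  rw [Dg_apply, hone]
  by_cases ha : B a = 0
  · have : (if (a : ℕ) = b then φ (B a) else 0) = 0 := by rw [ha, hφ0, ite_self]
    rw [this]
    by_cases hb : B b = 0
    · exact hzero a b ha hb 1
    · have hbr : (b : ℕ) < r' := by
        by_contra hc
        exact hb (h.eq_zero' b (not_lt.1 hc))
      have h1 := (hrc ⟨b, hbr⟩ hb 1).2 a
      rw [if_neg (by rintro rfl; exact hb ha)] at h1
      exact h1
  · rw [(hrc a ha 1).1 b, one_mul]
    simp only [Fin.ext_iff, Fin.val_castLE, eq_comm]

end Intertwined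

end TypeI

namespace TypeI

/-! ### Growth of hyperbolic functions -/

lemma abs_sinh_re_le_norm_cosh (z : ℂ) : |Real.sinh z.re| ≤ ‖Complex.cosh z‖ := by
  have h := abs_norm_sub_norm_le (Complex.exp z) (-Complex.exp (-z))
  rw [norm_neg, sub_neg_eq_add, Complex.norm_exp, Complex.norm_exp, Complex.neg_re] at h
  rw [Real.sinh_eq, Complex.cosh, norm_div, abs_div, Complex.norm_ofNat, abs_two]
  linarith

lemma abs_sinh_re_le_norm_sinh (z : ℂ) : |Real.sinh z.re| ≤ ‖Complex.sinh z‖ := by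
  have h := abs_norm_sub_norm_le (Complex.exp z) (Complex.exp (-z))
  rw [Complex.norm_exp, Complex.norm_exp, Complex.neg_re] at h
  rw [Real.sinh_eq, Complex.sinh, norm_div, abs_div, Complex.norm_ofNat, abs_two]
  linarith

lemma norm_cosh_le (z : ℂ) : ‖Complex.cosh z‖ ≤ Real.exp |z.re| := by
  have h := norm_add_le (Complex.exp z) (Complex.exp (-z))
  rw [Complex.norm_exp, Complex.norm_exp, Complex.neg_re] at h
  have h1 := Real.exp_le_exp.2 (le_abs_self z.re)
  have h2 := Real.exp_le_exp.2 (neg_le_abs z.re)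
  rw [Complex.cosh, norm_div, Complex.norm_ofNat]
  linarith

lemma norm_sinh_le (z : ℂ) : ‖Complex.sinh z‖ ≤ Real.exp |z.re| := by
  have h := norm_sub_le (Complex.exp z) (Complex.exp (-z))
  rw [Complex.norm_exp, Complex.norm_exp, Complex.neg_re] at h
  have h1 := Real.exp_le_exp.2 (le_abs_self z.re)
  have h2 := Real.exp_le_exp.2 (neg_le_abs z.re)
  rw [Complex.sinh, norm_div, Complex.norm_ofNat]
  linarith

lemma cosh_ne_zero_of_re {z : ℂ} (hz : z.re ≠ 0) : Complex.cosh z ≠ 0 := by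
  intro h
  have := abs_sinh_re_le_norm_cosh z
  rw [h, norm_zero, abs_nonpos_iff, Real.sinh_eq_zero] at this
  exact hz this

lemma sinh_ne_zero_of_re {z : ℂ} (hz : z.re ≠ 0) : Complex.sinh z ≠ 0 := by
  intro h
  have := abs_sinh_re_le_norm_sinh z
  rw [h, norm_zero, abs_nonpos_iff, Real.sinh_eq_zero] at this
  exact hz this

/-! ### Entire functions of exponential type in the real part -/

/-- Entire functions growing at most exponentially in `|Re t|`, uniformly in `Im t`. -/
def expAlg : Subalgebra ℂ (ℂ → ℂ) where
  carrier := {e | Differentiable ℂ e ∧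
    ∃ K C : ℝ, 0 ≤ K ∧ 0 ≤ C ∧ ∀ t : ℂ, ‖e t‖ ≤ K * Real.exp (C * |t.re|)}
  mul_mem' := by
    rintro a b ⟨ha, K, C, hK, hC, h⟩ ⟨hb, K', C', hK', hC', h'⟩
    refine ⟨ha.mul hb, K * K', C + C', by positivity, by positivity, fun t => ?_⟩
    rw [Pi.mul_apply, norm_mul, add_mul, Real.exp_add, mul_mul_mul_comm]
    exact mul_le_mul (h t) (h' t) (norm_nonneg _) (by positivity)
  add_mem' := by
    rintro a b ⟨ha, K, C, hK, hC, h⟩ ⟨hb, K', C', hK', hC', h'⟩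
    refine ⟨ha.add hb, K + K', C + C', by positivity, by positivity, fun t => ?_⟩
    have h1 : Real.exp (C * |t.re|) ≤ Real.exp ((C + C') * |t.re|) :=
      Real.exp_le_exp.2 (mul_le_mul_of_nonneg_right (by linarith) (abs_nonneg _))
    have h2 : Real.exp (C' * |t.re|) ≤ Real.exp ((C + C') * |t.re|) :=
      Real.exp_le_exp.2 (mul_le_mul_of_nonneg_right (by linarith) (abs_nonneg _))
    rw [add_mul]
    exact (norm_add_le _ _).trans (add_le_add ((h t).trans (mul_le_mul_of_nonneg_left h1 hK))
      ((h' t).trans (mul_le_mul_of_nonneg_left h2 hK')))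
  algebraMap_mem' c := ⟨differentiable_const c, ‖c‖, 0, norm_nonneg _, le_rfl, fun t => by simp⟩

lemma cosh_mem_expAlg (a : ℝ) : (fun t : ℂ => Complex.cosh (t * a)) ∈ expAlg := by
  refine ⟨by fun_prop, 1, |a|, zero_le_one, abs_nonneg _, fun t => ?_⟩
  have := norm_cosh_le (t * a)
  rwa [Complex.re_mul_ofReal, abs_mul, mul_comm |t.re|, ← one_mul (Real.exp _)] at this

lemma sinh_mem_expAlg (a : ℝ) : (fun t : ℂ => Complex.sinh (t * a)) ∈ expAlg := by
  refine ⟨by fun_prop, 1, |a|, zero_le_one, abs_nonneg _, fun t => ?_⟩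
  have := norm_sinh_le (t * a)
  rwa [Complex.re_mul_ofReal, abs_mul, mul_comm |t.re|, ← one_mul (Real.exp _)] at this

/-- An entire function of exponential type that is bounded on both axes is constant. -/
lemma apply_eq_of_mem_expAlg {e : ℂ → ℂ} (he : Differentiable ℂ e) {K C M : ℝ}
    (hb : ∀ t : ℂ, ‖e t‖ ≤ K * Real.exp (C * ‖t‖)) (hre : ∀ t : ℝ, ‖e t‖ ≤ M)
    (him : ∀ t : ℝ, ‖e (t * Complex.I)‖ ≤ M) (z w : ℂ) : e z = e w := by
  refine he.apply_eq_apply_of_bounded ?_ z w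
  have hO : ∀ s : Set ℂ, ∃ c < (2 : ℝ), ∃ B, e =O[Bornology.cobounded ℂ ⊓ Filter.principal s]
      fun z => Real.exp (B * ‖z‖ ^ c) := fun s =>
    ⟨1, by norm_num, C, Asymptotics.IsBigO.of_bound K (Filter.Eventually.of_forall fun z => by
      rw [Real.rpow_one, Real.norm_of_nonneg (Real.exp_nonneg _)]; exact hb z)⟩
  refine isBounded_iff_forall_norm_le.2 ⟨M, ?_⟩
  rintro _ ⟨z, rfl⟩
  rcases le_total 0 z.re with h1 | h1 <;> rcases le_total 0 z.im with h2 | h2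
  · exact PhragmenLindelof.quadrant_I he.diffContOnCl (hO _) (fun x _ => hre x)
      (fun x _ => him x) h1 h2
  · exact PhragmenLindelof.quadrant_IV he.diffContOnCl (hO _) (fun x _ => hre x)
      (fun x _ => him x) h1 h2
  · exact PhragmenLindelof.quadrant_II he.diffContOnCl (hO _) (fun x _ => hre x)
      (fun x _ => him x) h1 h2
  · exact PhragmenLindelof.quadrant_III he.diffContOnCl (hO _) (fun x _ => hre x)
      (fun x _ => him x) h1 h2

/-- The origin together with the complement of the imaginary axis. -/
def offAxis : Set ℂ := {t | t = 0 ∨ t.re ≠ 0}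

/-- Functions which, off the imaginary axis, are quotients of an entire function of exponential
type by a power of `W`. -/
def quotAlg {W : ℂ → ℂ} (hW : W ∈ expAlg) : Subalgebra ℂ (ℂ → ℂ) where
  carrier := {c | ∃ e ∈ expAlg, ∃ N : ℕ, ∀ t ∈ offAxis, c t * W t ^ N = e t}
  mul_mem' := by
    rintro a b ⟨e, he, N, h⟩ ⟨e', he', N', h'⟩
    refine ⟨e * e', mul_mem he he', N + N', fun t ht => ?_⟩
    rw [Pi.mul_apply, Pi.mul_apply, ← h t ht, ← h' t ht]
    ring
  add_mem' := by
    rintro a b ⟨e, he, N, h⟩ ⟨e', he', N', h'⟩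
    refine ⟨e * W ^ N' + e' * W ^ N, add_mem (mul_mem he (pow_mem hW _))
      (mul_mem he' (pow_mem hW _)), N + N', fun t ht => ?_⟩
    simp only [Pi.mul_apply, Pi.add_apply, Pi.pow_apply, ← h t ht, ← h' t ht]
    ring
  algebraMap_mem' c := ⟨_, expAlg.algebraMap_mem c, 0, fun t _ => by simp⟩

lemma expAlg_le_quotAlg {W : ℂ → ℂ} (hW : W ∈ expAlg) : expAlg ≤ quotAlg hW :=
  fun e he => ⟨e, he, 0, fun t _ => by simp⟩

lemma norm_div_pow_le {W e : ℂ → ℂ} (he : e ∈ expAlg) {δ : ℝ} (hδ : 0 < δ)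
    (hW : ∀ t : ℂ, 1 / 2 ≤ |t.re| → δ ≤ ‖W t‖) (N : ℕ) : ∃ K C : ℝ, 0 ≤ K ∧ 0 ≤ C ∧
      ∀ t : ℂ, 1 / 2 ≤ |t.re| → ‖e t / W t ^ N‖ ≤ K * Real.exp (C * |t.re|) := by
  obtain ⟨-, K, C, hK, hC, h⟩ := he
  refine ⟨K / δ ^ N, C, by positivity, hC, fun t ht => ?_⟩
  rw [norm_div, norm_pow, div_mul_eq_mul_div]
  exact div_le_div₀ (by positivity) (h t) (by positivity) (pow_le_pow_left₀ hδ.le (hW t ht) N)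

/-- A function that is bounded on the real axis and a quotient in two ways, along the imaginary
axis and along its translate, takes the same value at `0` and `1`. -/
lemma apply_zero_eq_apply_one {W : ℂ → ℂ} (hW : W ∈ expAlg) {δ : ℝ} (hδ : 0 < δ)
    (hWδ : ∀ t : ℂ, 1 / 2 ≤ |t.re| → δ ≤ ‖W t‖) (hW0 : ∀ t : ℂ, t.re ≠ 0 → W t ≠ 0)
    {c c' : ℂ → ℂ} (hc : c ∈ quotAlg hW) (hc' : c' ∈ quotAlg hW)
    (h : ∀ t : ℝ, c t = c' (t - 1)) {M : ℝ} (hM : ∀ t : ℝ, ‖c t‖ ≤ M) : c 0 = c 1 := by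
  obtain ⟨e, he, N, hcN⟩ := hc
  obtain ⟨e', he', N', hcN'⟩ := hc'
  set v : ℂ → ℂ := fun t => e t / W t ^ N with hv
  set u : ℂ → ℂ := fun t => e' (t - 1) / W (t - 1) ^ N' with hu
  have hvc : ∀ t : ℝ, t ≠ 0 → v t = c t := fun t ht => by
    have h1 : (t : ℂ).re ≠ 0 := by simpa using ht
    rw [hv]
    exact (eq_div_of_mul_eq (pow_ne_zero _ (hW0 _ h1)) (hcN t (Or.inr h1))).symm
  have huc : ∀ t : ℝ, t ≠ 1 → u t = c t := fun t ht => by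
    have h1 : ((t : ℂ) - 1).re ≠ 0 := by simpa [sub_eq_zero] using ht
    rw [hu, h]
    exact (eq_div_of_mul_eq (pow_ne_zero _ (hW0 _ h1)) (hcN' _ (Or.inr h1))).symm
  have hvd : ∀ t : ℂ, 0 < t.re → DifferentiableAt ℂ v t := fun t ht =>
    (he.1 t).div ((hW.1 t).pow N) (pow_ne_zero _ (hW0 t ht.ne'))
  have hud : ∀ t : ℂ, t.re < 1 → DifferentiableAt ℂ u t := fun t ht => by
    have h1 : (t - 1).re ≠ 0 := by rw [Complex.sub_re, Complex.one_re]; linarith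
    have h2 : DifferentiableAt ℂ (fun t : ℂ => t - 1) t := by fun_prop
    exact DifferentiableAt.div (DifferentiableAt.comp t (he'.1 (t - 1)) h2)
      ((DifferentiableAt.comp t (hW.1 (t - 1)) h2).pow N') (pow_ne_zero _ (hW0 _ h1))
  have huv : ∀ t : ℂ, 0 < t.re → t.re < 1 → u t = v t := by
    have hopen : IsOpen (Complex.re ⁻¹' Set.Ioo (0 : ℝ) 1) :=
      isOpen_Ioo.preimage Complex.continuous_re
    have hconv : Convex ℝ (Complex.re ⁻¹' Set.Ioo (0 : ℝ) 1) :=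
      (convex_Ioo (0 : ℝ) 1).linear_preimage Complex.reLm
    have hua : AnalyticOnNhd ℂ u (Complex.re ⁻¹' Set.Ioo (0 : ℝ) 1) :=
      DifferentiableOn.analyticOnNhd (fun t ht => (hud t ht.2).differentiableWithinAt) hopen
    have hva : AnalyticOnNhd ℂ v (Complex.re ⁻¹' Set.Ioo (0 : ℝ) 1) :=
      DifferentiableOn.analyticOnNhd (fun t ht => (hvd t ht.1).differentiableWithinAt) hopen
    have hmem : ((1 / 2 : ℝ) : ℂ) ∈ Complex.re ⁻¹' Set.Ioo (0 : ℝ) 1 := by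
      rw [Set.mem_preimage, Complex.ofReal_re]; norm_num
    have hfreq : ∃ᶠ z in nhdsWithin ((1 / 2 : ℝ) : ℂ) {((1 / 2 : ℝ) : ℂ)}ᶜ, u z = v z := by
      have h1 : Filter.Tendsto (fun x : ℝ => (x : ℂ)) (nhdsWithin (1 / 2) {1 / 2}ᶜ)
          (nhdsWithin ((1 / 2 : ℝ) : ℂ) {((1 / 2 : ℝ) : ℂ)}ᶜ) := by
        refine tendsto_nhdsWithin_iff.2 ⟨Complex.continuous_ofReal.continuousAt.tendsto.mono_left
          nhdsWithin_le_nhds, ?_⟩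
        filter_upwards [self_mem_nhdsWithin] with x hx hx'
        exact hx (Complex.ofReal_injective hx')
      refine h1.frequently (Filter.Eventually.frequently ?_)
      filter_upwards [nhdsWithin_le_nhds (Ioo_mem_nhds (show (0 : ℝ) < 1 / 2 by norm_num)
        (show (1 / 2 : ℝ) < 1 by norm_num))] with x hx
      rw [huc x hx.2.ne, hvc x hx.1.ne']
    intro t h0 h1
    exact hua.eqOn_of_preconnected_of_frequently_eq hva hconv.isPreconnected hmem hfreq ⟨h0, h1⟩
  set w : ℂ → ℂ := fun t => if t.re ≤ 1 / 2 then u t else v t with hw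
  have hwu : ∀ t : ℂ, t.re < 1 → w t = u t := fun t ht => by
    rw [hw]
    dsimp only
    split_ifs with h1
    · rfl
    · exact (huv t (by linarith) ht).symm
  have hwv : ∀ t : ℂ, 0 < t.re → w t = v t := fun t ht => by
    rw [hw]
    dsimp only
    split_ifs with h1
    · exact huv t ht (by linarith)
    · rfl
  have hwd : Differentiable ℂ w := by
    intro t
    rcases lt_or_ge t.re 1 with h1 | h1
    · refine (hud t h1).congr_of_eventuallyEq ?_
      filter_upwards [(isOpen_Iio.preimage Complex.continuous_re).mem_nhds h1] with x hx
      exact hwu x hx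
    · have h1 : 0 < t.re := by linarith
      refine (hvd t h1).congr_of_eventuallyEq ?_
      filter_upwards [(isOpen_Ioi.preimage Complex.continuous_re).mem_nhds h1] with x hx
      exact hwv x hx
  have hwc : ∀ t : ℝ, w t = c t := by
    intro t
    rcases lt_or_ge t 1 with h1 | h1
    · rw [hwu t (by simpa using h1), huc t h1.ne]
    · have h2 : 0 < t := by linarith
      rw [hwv t (by simpa using h2), hvc t h2.ne']
  obtain ⟨K, C, hK, hC, hKC⟩ := norm_div_pow_le he hδ hWδ N
  obtain ⟨K', C', hK', hC', hKC'⟩ := norm_div_pow_le he' hδ hWδ N'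
  have hwb : ∀ t : ℂ, ‖w t‖ ≤ (K + K' * Real.exp C') * Real.exp ((C + C') * |t.re|) := by
    intro t
    have h0 := abs_nonneg t.re
    rcases le_or_gt t.re (1 / 2) with h1 | h1
    · have h2 : 1 / 2 ≤ |(t - 1).re| := by
        rw [Complex.sub_re, Complex.one_re, abs_of_neg (by linarith)]; linarith
      have h3 : |(t - 1).re| ≤ |t.re| + 1 := by
        have := abs_sub t.re 1
        rwa [abs_one] at this
      rw [hwu t (by linarith)]
      calc ‖u t‖ ≤ K' * Real.exp (C' * |(t - 1).re|) := hKC' (t - 1) h2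
        _ ≤ K' * Real.exp (C' + (C + C') * |t.re|) := by
          refine mul_le_mul_of_nonneg_left (Real.exp_le_exp.2 ?_) hK'
          nlinarith [mul_le_mul_of_nonneg_left h3 hC', mul_nonneg hC h0]
        _ ≤ _ := by
          rw [Real.exp_add, ← mul_assoc]
          exact mul_le_mul_of_nonneg_right (by linarith) (Real.exp_nonneg _)
    · rw [hwv t (by linarith)]
      calc ‖v t‖ ≤ K * Real.exp (C * |t.re|) := hKC t (h1.le.trans (le_abs_self _))
        _ ≤ _ := by
          refine mul_le_mul ?_ (Real.exp_le_exp.2 ?_) (Real.exp_nonneg _) (by positivity)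
          · have := mul_nonneg hK' (Real.exp_nonneg C')
            linarith
          · nlinarith [mul_nonneg hC' h0]
  have h01 := apply_eq_of_mem_expAlg hwd (K := K + K' * Real.exp C') (C := C + C')
    (M := max M (K + K' * Real.exp C'))
    (fun t => (hwb t).trans (mul_le_mul_of_nonneg_left (Real.exp_le_exp.2
      (mul_le_mul_of_nonneg_left (Complex.abs_re_le_norm t) (by positivity))) (by positivity)))
    (fun t => by rw [hwc]; exact (hM t).trans (le_max_left _ _))
    (fun t => by
      have := hwb (t * Complex.I)
      simp only [Complex.mul_re, Complex.I_re, Complex.I_im, Complex.ofReal_im, mul_zero,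
        sub_zero, abs_zero, Real.exp_zero, mul_one] at this
      exact this.trans (le_max_right _ _)) ((0 : ℝ) : ℂ) ((1 : ℝ) : ℂ)
  rw [hwc, hwc] at h01
  simpa using h01

/-! ### Families of germs with Taylor coefficients in an algebra -/

/-- Functions of `(t, l)` that for `t ∈ G` are analytic in `l` at `0`, with Taylor coefficients
agreeing on `G` with elements of `S`. -/
def taylorAlg (G : Set ℂ) (S : Subalgebra ℂ (ℂ → ℂ)) : Subalgebra ℂ (ℂ × ℂ → ℂ) where
  carrier := {F | (∀ t ∈ G, AnalyticAt ℂ (fun l => F (t, l)) 0) ∧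
    ∀ n, ∃ a ∈ S, ∀ t ∈ G, iteratedDeriv n (fun l => F (t, l)) 0 = a t}
  mul_mem' := by
    rintro F H ⟨hF, h⟩ ⟨hH, h'⟩
    choose a ha hFa using h
    choose b hb hHb using h'
    refine ⟨fun t ht => (hF t ht).mul (hH t ht), fun n =>
      ⟨∑ i ∈ Finset.range (n + 1), algebraMap ℂ _ (n.choose i : ℂ) * a i * b (n - i),
        sum_mem fun i _ => mul_mem (mul_mem (S.algebraMap_mem _) (ha i)) (hb (n - i)),
        fun t ht => ?_⟩⟩
    refine (iteratedDeriv_fun_mul (hF t ht).contDiffAt (hH t ht).contDiffAt).trans ?_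
    rw [Finset.sum_apply]
    refine Finset.sum_congr rfl fun i _ => ?_
    rw [hFa i t ht, hHb (n - i) t ht]
    rfl
  add_mem' := by
    rintro F H ⟨hF, h⟩ ⟨hH, h'⟩
    choose a ha hFa using h
    choose b hb hHb using h'
    refine ⟨fun t ht => (hF t ht).add (hH t ht), fun n =>
      ⟨a n + b n, add_mem (ha n) (hb n), fun t ht => ?_⟩⟩
    refine (iteratedDeriv_fun_add (hF t ht).contDiffAt (hH t ht).contDiffAt).trans ?_
    rw [hFa n t ht, hHb n t ht, Pi.add_apply]
  algebraMap_mem' c := ⟨fun t _ => analyticAt_const, fun n =>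
    ⟨algebraMap ℂ _ (if n = 0 then c else 0), S.algebraMap_mem _, fun t _ => iteratedDeriv_const⟩⟩

lemma fst_mem_taylorAlg {G : Set ℂ} {S : Subalgebra ℂ (ℂ → ℂ)} {c : ℂ → ℂ} (hc : c ∈ S) :
    (fun x : ℂ × ℂ => c x.1) ∈ taylorAlg G S := by
  refine ⟨fun t _ => (analyticAt_const : AnalyticAt ℂ (fun _ : ℂ => c t) 0), fun n =>
    ⟨if n = 0 then c else 0, ?_, fun t _ => ?_⟩⟩
  · split_ifs
    exacts [hc, S.zero_mem]
  · have h1 : iteratedDeriv n (fun _ : ℂ => c t) 0 = if n = 0 then c t else 0 := iteratedDeriv_const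
    refine h1.trans ?_
    split_ifs <;> rfl

lemma snd_mem_taylorAlg {G : Set ℂ} {S : Subalgebra ℂ (ℂ → ℂ)} :
    (fun x : ℂ × ℂ => x.2) ∈ taylorAlg G S :=
  ⟨fun _ _ => analyticAt_id, fun n =>
    ⟨_, S.algebraMap_mem (iteratedDeriv n (fun l : ℂ => l) 0), fun _ _ => rfl⟩⟩

lemma inv_mem_taylorAlg {G : Set ℂ} {S : Subalgebra ℂ (ℂ → ℂ)} {F : ℂ × ℂ → ℂ}
    (hF : F ∈ taylorAlg G S) (h0 : ∀ t ∈ G, F (t, 0) ≠ 0) {b : ℂ → ℂ} (hb : b ∈ S)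
    (hbF : ∀ t ∈ G, (F (t, 0))⁻¹ = b t) : (fun x => (F x)⁻¹) ∈ taylorAlg G S := by
  obtain ⟨hF1, hF2⟩ := hF
  choose a ha hFa using hF2
  have hinv : ∀ t ∈ G, AnalyticAt ℂ (fun l => (F (t, l))⁻¹) 0 :=
    fun t ht => (hF1 t ht).inv (h0 t ht)
  refine ⟨hinv, fun n => ?_⟩
  induction n using Nat.strong_induction_on with
  | _ n ih =>
  rcases Nat.eq_zero_or_pos n with rfl | hn
  · exact ⟨b, hb, fun t ht => by rw [iteratedDeriv_zero]; exact hbF t ht⟩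
  choose! d hd hFd using ih
  refine ⟨-b * ∑ i ∈ Finset.range n,
    algebraMap ℂ _ (n.choose (i + 1) : ℂ) * a (i + 1) * d (n - (i + 1)),
    mul_mem (neg_mem hb) (sum_mem fun i hi => mul_mem (mul_mem (S.algebraMap_mem _) (ha _))
      (hd _ (by omega))), fun t ht => ?_⟩
  have h1 := iteratedDeriv_fun_mul (n := n) (hF1 t ht).contDiffAt (hinv t ht).contDiffAt
  have h2 : (fun l => F (t, l) * (F (t, l))⁻¹) =ᶠ[nhds 0] fun _ => 1 := by
    filter_upwards [(hF1 t ht).continuousAt.eventually_ne (h0 t ht)] with l hl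
    exact mul_inv_cancel₀ hl
  rw [h2.iteratedDeriv_eq, iteratedDeriv_const, if_neg hn.ne', Finset.sum_range_succ',
    Nat.choose_zero_right, Nat.cast_one, one_mul, iteratedDeriv_zero, Nat.sub_zero] at h1
  have h3 : iteratedDeriv n (fun l => (F (t, l))⁻¹) 0 = -(F (t, 0))⁻¹ *
      ∑ i ∈ Finset.range n, (n.choose (i + 1) : ℂ) * iteratedDeriv (i + 1) (fun l => F (t, l)) 0 *
        iteratedDeriv (n - (i + 1)) (fun l => (F (t, l))⁻¹) 0 := by
    rw [eq_neg_of_add_eq_zero_left h1.symm, neg_mul_neg, inv_mul_cancel_left₀ (h0 t ht)]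
  rw [h3, hbF t ht, Pi.mul_apply, Finset.sum_apply]
  congr 1
  refine Finset.sum_congr rfl fun i hi => ?_
  rw [hFa (i + 1) t ht, hFd (n - (i + 1)) (by omega) t ht]
  rfl

end TypeI

namespace TypeI

lemma ofReal_mem_offAxis (t : ℝ) : (t : ℂ) ∈ offAxis := by
  by_cases h : t = 0
  · exact Or.inl (by simp [h])
  · exact Or.inr (by simpa using h)

lemma cosh_mul_ne_zero {t : ℂ} (ht : t ∈ offAxis) (a : ℝ) : Complex.cosh (t * a) ≠ 0 := by
  rcases ht with rfl | ht
  · simp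
  · by_cases ha : a = 0
    · simp [ha]
    · exact cosh_ne_zero_of_re (by rw [Complex.re_mul_ofReal]; exact mul_ne_zero ht ha)

lemma exists_le_norm_cosh (a : ℝ) :
    ∃ δ : ℝ, 0 < δ ∧ ∀ t : ℂ, 1 / 2 ≤ |t.re| → δ ≤ ‖Complex.cosh (t * a)‖ := by
  by_cases ha : a = 0
  · exact ⟨1, one_pos, fun t _ => by simp [ha]⟩
  · refine ⟨Real.sinh (1 / 2 * |a|), Real.sinh_pos_iff.2 (by positivity), fun t ht => ?_⟩
    refine le_trans ?_ (abs_sinh_re_le_norm_cosh (t * a))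
    rw [Real.abs_sinh, Complex.re_mul_ofReal, abs_mul]
    exact Real.sinh_le_sinh.2 (mul_le_mul_of_nonneg_right ht (abs_nonneg a))

/-- The function `t ↦ ∏ cosh (t * A i)`. -/
def coshProd (n : ℕ) (A : ℕ → ℝ) (t : ℂ) : ℂ := ∏ i : Fin n, Complex.cosh (t * A i)

lemma coshProd_mem (n : ℕ) (A : ℕ → ℝ) : coshProd n A ∈ expAlg := by
  have : coshProd n A = ∏ i : Fin n, fun t : ℂ => Complex.cosh (t * A i) := by
    ext t
    rw [Finset.prod_apply]
    rfl
  rw [this]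
  exact prod_mem fun i _ => cosh_mem_expAlg (A i)

lemma coshProd_ne_zero {t : ℂ} (ht : t ∈ offAxis) (n : ℕ) (A : ℕ → ℝ) : coshProd n A t ≠ 0 :=
  Finset.prod_ne_zero_iff.2 fun i _ => cosh_mul_ne_zero ht (A i)

lemma exists_le_norm_coshProd (n : ℕ) (A : ℕ → ℝ) :
    ∃ δ : ℝ, 0 < δ ∧ ∀ t : ℂ, 1 / 2 ≤ |t.re| → δ ≤ ‖coshProd n A t‖ := by
  choose δ hδ h using fun i : Fin n => exists_le_norm_cosh (A i)
  refine ⟨∏ i, δ i, Finset.prod_pos fun i _ => hδ i, fun t ht => ?_⟩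
  rw [coshProd, norm_prod]
  exact Finset.prod_le_prod (fun i _ => (hδ i).le) fun i _ => h i t ht

/-- The common denominator `t ↦ ∏ cosh (t * A i) * ∏ cosh (t * B j)`. -/
def coshDenom (r r' : ℕ) (A B : ℕ → ℝ) : ℂ → ℂ := coshProd r A * coshProd r' B

lemma coshDenom_mem (r r' : ℕ) (A B : ℕ → ℝ) : coshDenom r r' A B ∈ expAlg :=
  mul_mem (coshProd_mem r A) (coshProd_mem r' B)

section

variable {r s r' s' : ℕ} {A B : ℕ → ℝ}

lemma entryMem_taylorAlg (hs : ∀ k, s ≤ k → A k = 0) (hs' : ∀ k, s' ≤ k → B k = 0)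
    {f : Matrix (Fin r) (Fin s) ℂ → Matrix (Fin r') (Fin s') ℂ} (hf : IsPolyMapI f)
    (hfAB : ∀ t ∈ offAxis, f (Dg r s fun k => Complex.tanh (t * A k)) =
      Dg r' s' fun k => Complex.tanh (t * B k)) (Z : Matrix (Fin r) (Fin s) ℂ) :
    EntryMem (taylorAlg offAxis (quotAlg (coshDenom_mem r r' A B)))
      fun x : ℂ × ℂ => mob r' s' B (-x.1) (f (mob r s A x.1 (x.2 • Z))) := by
  have hle := expAlg_le_quotAlg (coshDenom_mem r r' A B)
  have hmob0 : ∀ t ∈ offAxis, mob r s A t (0 : Matrix (Fin r) (Fin s) ℂ) =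
      Dg r s fun k => Complex.tanh (t * A k) := by
    intro t ht
    have h1 := mob_Dg hs (r := r) t (fun _ => 0) fun k _ => by
      rw [zero_mul, add_zero]; exact cosh_mul_ne_zero ht (A k)
    rw [show (fun _ : ℕ => (0 : ℂ)) = 0 from rfl, Dg_zero] at h1
    rw [h1]
    exact Dg_congr fun k _ _ => by simp [Complex.tanh_eq_sinh_div_cosh]
  have h1 : EntryMem (taylorAlg offAxis (quotAlg (coshDenom_mem r r' A B)))
      fun x : ℂ × ℂ => mob r s A x.1 (x.2 • Z) := by
    have hc : ∀ k, (fun x : ℂ × ℂ => Complex.cosh (x.1 * A k)) ∈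
        taylorAlg offAxis (quotAlg (coshDenom_mem r r' A B)) :=
      fun k => fst_mem_taylorAlg (hle (cosh_mem_expAlg (A k)))
    have hsh : ∀ k, (fun x : ℂ × ℂ => Complex.sinh (x.1 * A k)) ∈
        taylorAlg offAxis (quotAlg (coshDenom_mem r r' A B)) :=
      fun k => fst_mem_taylorAlg (hle (sinh_mem_expAlg (A k)))
    have hM : EntryMem (taylorAlg offAxis (quotAlg (coshDenom_mem r r' A B)))
        fun x : ℂ × ℂ => x.2 • Z := EntryMem.smul snd_mem_taylorAlg (EntryMem.const Z)
    have hdet : ∀ t : ℂ, (mobN r s A t ((0 : ℂ) • Z)).det = coshProd r A t := fun t => by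
      rw [zero_smul, mobN, Matrix.zero_mul, add_zero, CC, det_Dg, coshProd]
    refine hM.mob hc hsh (inv_mem_taylorAlg (hM.mobN hc hsh).det ?_ (b := (coshProd r A)⁻¹) ?_ ?_)
    · intro t ht
      exact (hdet t).trans_ne (coshProd_ne_zero ht r A)
    · refine ⟨_, coshProd_mem r' B, 1, fun t ht => ?_⟩
      rw [pow_one, coshDenom, Pi.inv_apply, Pi.mul_apply,
        inv_mul_cancel_left₀ (coshProd_ne_zero ht r A)]
    · intro t ht
      exact congrArg Inv.inv (hdet t)
  have h2 := h1.comp_poly hf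
  have hc : ∀ k, (fun x : ℂ × ℂ => Complex.cosh (-x.1 * B k)) ∈
      taylorAlg offAxis (quotAlg (coshDenom_mem r r' A B)) := fun k => by
    simp only [neg_mul, Complex.cosh_neg]
    exact fst_mem_taylorAlg (hle (cosh_mem_expAlg (B k)))
  have hsh : ∀ k, (fun x : ℂ × ℂ => Complex.sinh (-x.1 * B k)) ∈
      taylorAlg offAxis (quotAlg (coshDenom_mem r r' A B)) := fun k => by
    simp only [neg_mul, Complex.sinh_neg]
    exact neg_mem (fst_mem_taylorAlg (hle (sinh_mem_expAlg (B k))))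
  have hdet : ∀ t ∈ offAxis, (mobN r' s' B (-t) (f (mob r s A t ((0 : ℂ) • Z)))).det =
      (coshProd r' B t)⁻¹ := by
    intro t ht
    rw [zero_smul, hmob0 t ht, hfAB t ht, mobN_Dg hs', det_Dg, coshProd, ← Finset.prod_inv_distrib]
    refine Finset.prod_congr rfl fun j _ => ?_
    have hne := cosh_mul_ne_zero ht (B j)
    rw [neg_mul, Complex.cosh_neg, Complex.sinh_neg, Complex.tanh_eq_sinh_div_cosh]
    field_simp
    linear_combination Complex.cosh_sq_sub_sinh_sq (t * B j)
  refine h2.mob hc hsh (inv_mem_taylorAlg (h2.mobN hc hsh).det ?_ (b := coshProd r' B)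
    (hle (coshProd_mem r' B)) ?_)
  · intro t ht
    exact (hdet t ht).trans_ne (inv_ne_zero (coshProd_ne_zero ht r' B))
  · intro t ht
    refine (congrArg Inv.inv (hdet t ht)).trans (inv_inv _)

namespace Intertwined

variable {f g : Matrix (Fin r) (Fin s) ℂ → Matrix (Fin r') (Fin s') ℂ}

lemma apply_tanh (h : Intertwined r s r' s' A B f g) (t : ℂ) (ht : t ∈ offAxis) :
    f (Dg r s fun k => Complex.tanh (t * A k)) = Dg r' s' fun k => Complex.tanh (t * B k) := by
  rcases ht with rfl | ht
  · simp only [zero_mul, Complex.tanh_zero]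
    exact (congrArg f (Dg_zero r s)).trans (h.f_zero.trans (Dg_zero r' s').symm)
  · refine h.apply_spectral (φ := fun a => Complex.tanh (t * a)) (by simp) fun i hi => ?_
    have hre : (t * A i).re ≠ 0 := by rw [Complex.re_mul_ofReal]; exact mul_ne_zero ht hi
    rw [Complex.tanh_eq_sinh_div_cosh]
    exact div_ne_zero (sinh_ne_zero_of_re hre) (cosh_ne_zero_of_re hre)

lemma apply_tanh' (h : Intertwined r s r' s' A B f g) (t : ℂ) (ht : t ∈ offAxis) :
    g (Dg r s fun k => Complex.tanh (t * A k)) = Dg r' s' fun k => Complex.tanh (t * B k) := by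
  have h1 := h.neg.apply_tanh (-t) (by
    rcases ht with rfl | ht
    · exact Or.inl neg_zero
    · exact Or.inr (by rw [Complex.neg_re]; exact neg_ne_zero.2 ht))
  simp only [neg_mul, Complex.tanh_neg] at h1
  have h2 : ∀ (m n : ℕ) (x : ℕ → ℂ), (Dg m n fun k => -x k) = -Dg m n x :=
    fun m n x => (Dg_neg m n x).symm
  rw [h2, h2, neg_neg] at h1
  exact neg_injective h1

lemma mob_apply_mob (h : Intertwined r s r' s' A B f g) (t : ℝ) {Z : Matrix (Fin r) (Fin s) ℂ}
    (hZ : Z ∈ OmegaI r s) : mob r' s' B (-t) (f (mob r s A t Z)) =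
      mob r' s' B (-(t - 1)) (g (mob r s A (t - 1) Z)) := by
  have h1 := mob_mob h.eq_zero h.eq_zero_s (t - 1) 1 hZ
  have hm : mob r s A (t - 1 : ℝ) Z ∈ OmegaI r s := mob_mem h.eq_zero h.eq_zero_s _ hZ
  have h2 := h.comm _ hm
  have h3 := mob_mob h.eq_zero' h.eq_zero_s' 1 (-t) (h.mapsg hm)
  push_cast at h1 h2 h3
  rw [sub_add_cancel] at h1
  rw [h1] at h2
  rw [h2, h3]
  congr 1
  ring

lemma differentiableOn_mob_apply_mob (h : Intertwined r s r' s' A B f g) (t : ℝ)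
    {Z : Matrix (Fin r) (Fin s) ℂ} (hZ : Z ∈ OmegaI r s) :
    EntryMem (diffAlg (Metric.ball 0 1))
      fun l : ℂ => mob r' s' B (-t) (f (mob r s A t (l • Z))) := by
  have hl : (fun l : ℂ => l) ∈ diffAlg (Metric.ball (0 : ℂ) 1) := differentiableOn_id
  have hmaps : Set.MapsTo (fun l : ℂ => l • Z) (Metric.ball 0 1) (OmegaI r s) :=
    fun l hl => smul_mem_omega hZ (mem_ball_zero_iff.1 hl).le
  have h1 := mob_entryMem_diff h.eq_zero h.eq_zero_s t (EntryMem.smul hl (EntryMem.const Z)) hmaps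
  have h2 := mob_entryMem_diff h.eq_zero' h.eq_zero_s' (-t) (h1.comp_poly h.polyf)
    fun l hl => h.mapsf (mob_mem h.eq_zero h.eq_zero_s t (hmaps hl))
  push_cast at h2
  exact h2

lemma differentiable_apply_smul {f : Matrix (Fin r) (Fin s) ℂ → Matrix (Fin r') (Fin s') ℂ}
    (hf : IsPolyMapI f) (Z : Matrix (Fin r) (Fin s) ℂ) (i : Fin r') (j : Fin s') :
    Differentiable ℂ fun l : ℂ => f (l • Z) i j := by
  have hl : (fun l : ℂ => l) ∈ diffAlg (Set.univ : Set ℂ) := differentiableOn_id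
  exact differentiableOn_univ.1 ((EntryMem.smul hl (EntryMem.const Z)).comp_poly hf i j)

theorem eq_on (h : Intertwined r s r' s' A B f g) : ∀ Z ∈ OmegaI r s, f Z = g Z := by
  intro Z hZ
  ext i j
  have hW := coshDenom_mem r r' A B
  have hF := (entryMem_taylorAlg h.eq_zero_s h.eq_zero_s' h.polyf h.apply_tanh Z i j).2
  have hG := (entryMem_taylorAlg h.eq_zero_s h.eq_zero_s' h.polyg h.apply_tanh' Z i j).2
  obtain ⟨δ₁, hδ₁, hW₁⟩ := exists_le_norm_coshProd r A
  obtain ⟨δ₂, hδ₂, hW₂⟩ := exists_le_norm_coshProd r' B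
  have key : ∀ n, iteratedDeriv n (fun l : ℂ => f (l • Z) i j) 0 =
      iteratedDeriv n (fun l : ℂ => g (l • Z) i j) 0 := by
    intro n
    obtain ⟨c, hc, hcF⟩ := hF n
    obtain ⟨c', hc', hcG⟩ := hG n
    have hshift : ∀ t : ℝ, c t = c' (t - 1) := by
      intro t
      have ht := ofReal_mem_offAxis (t - 1)
      push_cast at ht
      rw [← hcF t (ofReal_mem_offAxis t), ← hcG _ ht]
      refine Filter.EventuallyEq.iteratedDeriv_eq n ?_
      filter_upwards [Metric.ball_mem_nhds (0 : ℂ) one_pos] with l hl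
      have := h.mob_apply_mob t (smul_mem_omega hZ (mem_ball_zero_iff.1 hl).le)
      exact congrFun (congrFun this i) j
    have hbound : ∀ t : ℝ, ‖c t‖ ≤ n.factorial * 1 / (1 / 2) ^ n := by
      intro t
      rw [← hcF t (ofReal_mem_offAxis t)]
      refine Complex.norm_iteratedDeriv_le_of_forall_mem_sphere_norm_le n (by norm_num) ?_ ?_
      · refine DifferentiableOn.diffContOnCl (DifferentiableOn.mono
          (h.differentiableOn_mob_apply_mob t hZ i j) ?_)
        exact Metric.closure_ball_subset_closedBall.trans
          (Metric.closedBall_subset_ball (by norm_num))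
      · intro l hl
        have hl1 : ‖l‖ ≤ 1 := by rw [mem_sphere_zero_iff_norm.1 hl]; norm_num
        have hm := mob_mem h.eq_zero' h.eq_zero_s' (-t)
          (h.mapsf (mob_mem h.eq_zero h.eq_zero_s t (smul_mem_omega hZ hl1)))
        push_cast at hm
        exact (entry_lt hm i j).le
    have h01 := apply_zero_eq_apply_one hW (mul_pos hδ₁ hδ₂)
      (fun t ht => by
        rw [coshDenom, Pi.mul_apply, norm_mul]
        exact mul_le_mul (hW₁ t ht) (hW₂ t ht) hδ₂.le (norm_nonneg _))
      (fun t ht => mul_ne_zero (coshProd_ne_zero (Or.inr ht) r A)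
        (coshProd_ne_zero (Or.inr ht) r' B)) hc hc' hshift hbound
    have h1 := hshift 1
    rw [Complex.ofReal_one, sub_self, ← h01] at h1
    rw [← hcF 0 (Or.inl rfl), ← hcG 0 (Or.inl rfl)] at h1
    simpa only [neg_zero, mob_zero] using h1
  have h1 := Complex.taylorSeries_eq_of_entire' (c := 0) (z := 1)
    (differentiable_apply_smul h.polyf Z i j)
  have h2 := Complex.taylorSeries_eq_of_entire' (c := 0) (z := 1)
    (differentiable_apply_smul h.polyg Z i j)
  simp only [key] at h1
  simpa only [one_smul] using h1.symm.trans h2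

end Intertwined

end

end TypeI

namespace TypeI

lemma EntryMem.linearMap {α : Type*} {S : Subalgebra ℂ (α → ℂ)} {r s r' s' : ℕ}
    {M : α → Matrix (Fin r) (Fin s) ℂ} (hM : EntryMem S M)
    (L : Matrix (Fin r) (Fin s) ℂ →ₗ[ℂ] Matrix (Fin r') (Fin s') ℂ) :
    EntryMem S fun x => L (M x) := by
  intro i j
  have h : (fun x => L (M x) i j) = ∑ p : Fin r, ∑ q : Fin s,
      (fun x => M x p q) * algebraMap ℂ (α → ℂ) (L (Matrix.single p q 1) i j) := by
    ext x
    conv_lhs => rw [matrix_eq_sum_single (M x)]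
    simp only [map_sum, Matrix.sum_apply, Finset.sum_apply, Pi.mul_apply]
    refine Finset.sum_congr rfl fun p _ => Finset.sum_congr rfl fun q _ => ?_
    have h1 : Matrix.single p q (M x p q) = M x p q • Matrix.single p q (1 : ℂ) := by
      rw [Matrix.smul_single, smul_eq_mul, mul_one]
    rw [h1, map_smul]
    rfl
  rw [h]
  exact sum_mem fun p _ => sum_mem fun q _ => mul_mem (hM p q) (S.algebraMap_mem _)

lemma exists_eq_mul_mob_mul {r s : ℕ} (hrs : r ≤ s) {M : Matrix (Fin r) (Fin s) ℂ}
    (hM : M ∈ OmegaI r s) :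
    ∃ (U : Matrix (Fin r) (Fin r) ℂ) (V : Matrix (Fin s) (Fin s) ℂ) (A : ℕ → ℝ),
      U * Uᴴ = 1 ∧ V * Vᴴ = 1 ∧ (∀ k, 0 ≤ A k) ∧ (∀ k, r ≤ k → A k = 0) ∧
      M = U * mob r s A 1 0 * V := by
  obtain ⟨U, V, σ, hU, hV, hσ0, hσr, h⟩ := exists_svd hrs M
  have hσ1 : ∀ k, σ k < 1 := fun k => by
    rcases lt_or_ge k r with hk | hk
    · exact svd_lt_one hM hU hV hσ0 h hk (hk.trans_le hrs)
    · rw [hσr k hk]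
      exact one_pos
  have hA0 : ∀ k, r ≤ k → Real.artanh (σ k) = 0 := fun k hk => by
    rw [hσr k hk, Real.artanh_zero]
  refine ⟨U, V, fun k => Real.artanh (σ k), hU, hV,
    fun k => Real.artanh_nonneg (hσ0 k), hA0, ?_⟩
  rw [h, ← Dg_zero, mob_Dg fun k hk => hA0 k (hrs.trans hk)]
  · congr 2
    refine Dg_congr fun k _ _ => ?_
    simp only [Pi.zero_apply, zero_mul, add_zero, one_mul]
    rw [← Complex.tanh_eq_sinh_div_cosh, ← Complex.ofReal_tanh,
      Real.tanh_artanh ⟨by linarith [hσ0 k], hσ1 k⟩]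
  · intro k _
    simpa only [Pi.zero_apply, zero_mul, add_zero, one_mul] using cosh_ofReal_ne_zero _

lemma unitary_cancel {m n : ℕ} {U : Matrix (Fin m) (Fin m) ℂ} {V : Matrix (Fin n) (Fin n) ℂ}
    (hU : U * Uᴴ = 1) (hV : V * Vᴴ = 1) (Z : Matrix (Fin m) (Fin n) ℂ) :
    U * (Uᴴ * Z * Vᴴ) * V = Z := by
  calc U * (Uᴴ * Z * Vᴴ) * V = (U * Uᴴ) * Z * (Vᴴ * V) := by simp only [Matrix.mul_assoc]
    _ = Z := by rw [hU, mul_eq_one_comm.1 hV, Matrix.one_mul, Matrix.mul_one]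

theorem exists_isotropic_of_equivalent {r s r' s' : ℕ} (hrs : r ≤ s) (hrs' : r' ≤ s')
    {f g : Matrix (Fin r) (Fin s) ℂ → Matrix (Fin r') (Fin s') ℂ}
    (hf : IsPolyMapI f) (hg : IsPolyMapI g)
    (hfm : Set.MapsTo f (OmegaI r s) (OmegaI r' s'))
    (hgm : Set.MapsTo g (OmegaI r s) (OmegaI r' s')) (hf0 : f 0 = 0) (hg0 : g 0 = 0)
    {τ : Matrix (Fin r) (Fin s) ℂ → Matrix (Fin r) (Fin s) ℂ}
    {σ : Matrix (Fin r') (Fin s') ℂ → Matrix (Fin r') (Fin s') ℂ}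
    (hτ : IsAutomorphismOf (OmegaI r s) τ) (hσ : IsAutomorphismOf (OmegaI r' s') σ)
    (h : ∀ Z ∈ OmegaI r s, f Z = σ (g (τ Z))) :
    ∃ τ σ, IsAutomorphismOf (OmegaI r s) τ ∧ IsAutomorphismOf (OmegaI r' s') σ ∧
      τ 0 = 0 ∧ σ 0 = 0 ∧ ∀ Z ∈ OmegaI r s, f Z = σ (g (τ Z)) := by
  obtain ⟨x, hx, hτx⟩ : ∃ x ∈ OmegaI r s, τ x = 0 := by
    obtain ⟨-, -, τ', hτ', -, -, h'⟩ := hτ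
    exact ⟨τ' 0, hτ' zero_mem_omega, h' 0 zero_mem_omega⟩
  obtain ⟨U, V, A, hU, hV, hA, hAr, hxA⟩ := exists_eq_mul_mob_mul hrs hx
  obtain ⟨U', V', B, hU', hV', hB, hBr, hyB⟩ :=
    exists_eq_mul_mob_mul hrs' (hσ.1 zero_mem_omega)
  have hAs : ∀ k, s ≤ k → A k = 0 := fun k hk => hAr k (hrs.trans hk)
  have hBs : ∀ k, s' ≤ k → B k = 0 := fun k hk => hBr k (hrs'.trans hk)
  have hUs : Uᴴ * Uᴴᴴ = 1 := by simpa using mul_eq_one_comm.1 hU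
  have hVs : Vᴴ * Vᴴᴴ = 1 := by simpa using mul_eq_one_comm.1 hV
  have hUs' : U'ᴴ * U'ᴴᴴ = 1 := by simpa using mul_eq_one_comm.1 hU'
  have hVs' : V'ᴴ * V'ᴴᴴ = 1 := by simpa using mul_eq_one_comm.1 hV'
  have hcancel : ∀ Z : Matrix (Fin r') (Fin s') ℂ, U'ᴴ * (U' * Z * V') * V'ᴴ = Z := fun Z => by
    simpa using unitary_cancel hUs' hVs' Z
  obtain ⟨T, hT⟩ : ∃ T, T = fun Z => τ (U * mob r s A 1 Z * V) := ⟨_, rfl⟩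
  obtain ⟨S, hS⟩ : ∃ S, S = fun W => mob r' s' B (-1) (U'ᴴ * σ W * V'ᴴ) := ⟨_, rfl⟩
  have hTaut : IsAutomorphismOf (OmegaI r s) T := by
    have h1 := isAutomorphismOf_mob hAr hAs 1
    rw [Complex.ofReal_one] at h1
    have h2 := isAutomorphismOf_comp h1 (isAutomorphismOf_unitary hU hV)
    have h3 := isAutomorphismOf_comp h2 hτ
    rw [hT]
    exact h3
  have hSaut : IsAutomorphismOf (OmegaI r' s') S := by
    have h1 := isAutomorphismOf_mob hBr hBs (-1)
    rw [Complex.ofReal_neg, Complex.ofReal_one] at h1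
    have h2 := isAutomorphismOf_comp hσ (isAutomorphismOf_unitary hUs' hVs')
    have h3 := isAutomorphismOf_comp h2 h1
    rw [hS]
    exact h3
  have hT0 : T 0 = 0 := by
    simp only [hT]
    rw [← hxA, hτx]
  have hS0 : S 0 = 0 := by
    have h1 := mob_neg_mob hBr hBs 1 (zero_mem_omega (r := r') (s := s'))
    rw [Complex.ofReal_one] at h1
    simp only [hS]
    rw [hyB, hcancel, h1]
  obtain ⟨L, hL⟩ := exists_linear_of_isAutomorphismOf hrs hTaut hT0
  obtain ⟨L', hL'⟩ := exists_linear_of_isAutomorphismOf hrs' hSaut hS0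
  have hmapsg : ∀ Z ∈ OmegaI r s, g (L Z) ∈ OmegaI r' s' := fun Z hZ => by
    rw [← hL Z hZ]
    exact hgm (hTaut.1 hZ)
  have hI : Intertwined r s r' s' A B (fun Z => U'ᴴ * f (U * Z * V) * V'ᴴ)
      fun Z => L' (g (L Z)) :=
    { le := hrs
      le' := hrs'
      nonneg := hA
      nonneg' := hB
      eq_zero := hAr
      eq_zero' := hBr
      polyf := EntryMem.isPolyMap fun _ hZ => ((EntryMem.const _).mul
        ((((EntryMem.const U).mul hZ).mul (EntryMem.const V)).comp_poly hf)).mul (EntryMem.const _)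
      polyg := EntryMem.isPolyMap fun _ hZ =>
        ((hZ.linearMap L.toLinearMap).comp_poly hg).linearMap L'.toLinearMap
      mapsf := fun Z hZ =>
        unitary_mul_mem_omega (hfm (unitary_mul_mem_omega hZ hU hV)) hUs' hVs'
      mapsg := fun Z hZ => by
        have h1 := hSaut.1 (hmapsg Z hZ)
        rwa [hL' _ (hmapsg Z hZ)] at h1
      f_zero := by simp [hf0]
      g_zero := by rw [map_zero, hg0, map_zero]
      comm := fun Z hZ => by
        have hm : mob r s A 1 Z ∈ OmegaI r s := by
          simpa only [Complex.ofReal_one] using mob_mem hAr hAs 1 hZ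
        have h1 := mob_mob_neg hBr hBs 1
          (unitary_mul_mem_omega (hσ.1 (hmapsg Z hZ)) hUs' hVs')
        rw [Complex.ofReal_one] at h1
        rw [← hL' _ (hmapsg Z hZ), hS, h1, ← hL Z hZ, hT, h _ (unitary_mul_mem_omega hm hU hV)] }
  have hTU := isAutomorphismOf_comp (isAutomorphismOf_unitary hUs hVs) hTaut
  have hSU := isAutomorphismOf_comp hSaut (isAutomorphismOf_unitary hU' hV')
  refine ⟨_, _, hTU, hSU, by simp [hT0], by simp [hS0], fun Z hZ => ?_⟩
  have hZ' : Uᴴ * Z * Vᴴ ∈ OmegaI r s := unitary_mul_mem_omega hZ hUs hVs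
  have h1 : U'ᴴ * f (U * (Uᴴ * Z * Vᴴ) * V) * V'ᴴ = L' (g (L (Uᴴ * Z * Vᴴ))) := hI.eq_on _ hZ'
  rw [unitary_cancel hU hV, ← hL' _ (hmapsg _ hZ'), ← hL _ hZ'] at h1
  simp only [← h1]
  rw [unitary_cancel hU' hV']

end TypeI

/-- Theorem 1.1, type I case: two proper holomorphic polynomial maps between type I domains
preserving the origin are equivalent iff they are isotropically equivalent at `0`. -/
theorem equivalent_iff_isotropically_equivalent_typeI
    (r s r' s' : ℕ) (hr : 1 ≤ r) (hrs : r ≤ s) (hr' : 1 ≤ r') (hrs' : r' ≤ s')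
    (f g : Matrix (Fin r) (Fin s) ℂ → Matrix (Fin r') (Fin s') ℂ)
    (hfpoly : IsPolyMapI f) (hgpoly : IsPolyMapI g)
    (hfmaps : Set.MapsTo f (OmegaI r s) (OmegaI r' s'))
    (hgmaps : Set.MapsTo g (OmegaI r s) (OmegaI r' s'))
    (hfproper : IsProperOn f (OmegaI r s) (OmegaI r' s'))
    (hgproper : IsProperOn g (OmegaI r s) (OmegaI r' s'))
    (hf0 : f 0 = 0) (hg0 : g 0 = 0) :
    (∃ τ σ, IsAutomorphismOf (OmegaI r s) τ ∧ IsAutomorphismOf (OmegaI r' s') σ ∧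
        ∀ Z ∈ OmegaI r s, f Z = σ (g (τ Z))) ↔
      (∃ τ σ, IsAutomorphismOf (OmegaI r s) τ ∧ IsAutomorphismOf (OmegaI r' s') σ ∧
        τ 0 = 0 ∧ σ 0 = 0 ∧ ∀ Z ∈ OmegaI r s, f Z = σ (g (τ Z))) := by
  constructor
  · rintro ⟨τ, σ, hτ, hσ, h⟩
    exact TypeI.exists_isotropic_of_equivalent hrs hrs' hfpoly hgpoly hfmaps hgmaps hf0 hg0 hτ hσ h
  · rintro ⟨τ, σ, hτ, hσ, -, -, h⟩
    exact ⟨τ, σ, hτ, hσ, h⟩
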